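/- arXiv:0810.1007 — 3 statements merged into one kernel-verified Lean document; each statement's English description precedes it below -/
import Mathlib

section
/- Let T : ℂ[z₁,…,zₙ] → ℂ[z₁,…,zₙ] be a linear operator. Then T preserves ℍ_{π/2}-stability (i.e., for every ℍ_{π/2}-stable f the polynomial T(f) is ℍ_{π/2}-stable or identically zero) if and only if either (a) T has range of dimension at most one and is of the form T(f) = α(f)P, where α is a linear functional on ℂ[z₁,…,zₙ] and P is an ℍ_{π/2}-stable polynomial, or (b) the formal power series T[e^{z·w}] := Σ_{α∈ℕⁿ} T(z^α) w^α/α! converges on all of ℂ^{2n} to an entire function in the 2n variables z₁,…,zₙ,w₁,…,wₙ which is the limit, uniformly on compact subsets of ℂ^{2n}, of ℍ_{π/2}-stable polynomials in 2n variables. -/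
open MvPolynomial Filter


namespace BB

theorem multiset_re_sum_nonneg (S : Multiset ℂ) (f : ℂ → ℂ) (h : ∀ r ∈ S, 0 ≤ (f r).re) :
    0 ≤ (S.map f).sum.re := by
  induction S using Multiset.induction with
  | empty => simp
  | cons a S ih =>
    simp only [Multiset.map_cons, Multiset.sum_cons, Complex.add_re]
    have h1 := h a (Multiset.mem_cons_self a S)
    have h2 := ih (fun r hr => h r (Multiset.mem_cons_of_mem hr))
    linarith

theorem roots_re_nonpos {p : Polynomial ℂ} (hp : ∀ x : ℂ, 0 < x.re → p.eval x ≠ 0) :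
    ∀ r ∈ p.roots, r.re ≤ 0 := by
  intro r hr
  by_contra h
  push Not at h
  exact hp r h (Polynomial.isRoot_of_mem_roots hr)

/-- Gauss-Lucas type positivity of the logarithmic derivative. -/
theorem logDeriv_re_nonneg {p : Polynomial ℂ} (hp : ∀ x : ℂ, 0 < x.re → p.eval x ≠ 0)
    {x : ℂ} (hx : 0 < x.re) : 0 ≤ (p.derivative.eval x / p.eval x).re := by
  rw [(IsAlgClosed.splits p).eval_derivative_div_eval_of_ne_zero (hp x hx)]
  apply multiset_re_sum_nonneg
  intro r hr
  have := roots_re_nonpos hp r hr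
  rw [one_div, Complex.inv_re]
  apply div_nonneg _ (Complex.normSq_nonneg _)
  simp; linarith

theorem multiset_disc (S : Multiset ℂ) (f : ℂ → ℂ) (c : ℝ) 
    (h : ∀ r ∈ S, ‖f r - c‖ ≤ c) :
    ‖(S.map f).sum - (S.card : ℂ) * c‖ ≤ S.card * c := by
  induction S using Multiset.induction with
  | empty => simp
  | cons a S ih =>
    simp only [Multiset.map_cons, Multiset.sum_cons, Multiset.card_cons]
    have h1 := h a (Multiset.mem_cons_self a S)
    have h2 := ih (fun r hr => h r (Multiset.mem_cons_of_mem hr))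
    have : f a + (S.map f).sum - ((S.card + 1 : ℕ) : ℂ) * c
        = (f a - c) + ((S.map f).sum - (S.card : ℂ) * c) := by push_cast; ring
    rw [this]
    refine (norm_add_le _ _).trans ?_
    push_cast
    linarith


theorem disc_iff (u : ℂ) (c : ℝ) (hc : 0 ≤ c) :
    ‖u - c‖ ≤ c ↔ Complex.normSq u ≤ 2 * c * u.re := by
  have h1 : ‖u - c‖ ≤ c ↔ ‖u - c‖ ^ 2 ≤ c ^ 2 := by
    constructor
    · intro h; exact pow_le_pow_left₀ (norm_nonneg _) h 2
    · intro h; exact le_of_sq_le_sq h hc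
  rw [h1, ← Complex.normSq_eq_norm_sq, Complex.normSq_apply, Complex.normSq_apply]
  simp only [Complex.sub_re, Complex.sub_im, Complex.ofReal_re, Complex.ofReal_im]
  constructor <;> intro h <;> nlinarith

/-- Laguerre's theorem for the right half-plane. -/
theorem laguerre {p : Polynomial ℂ} (hp : ∀ x : ℂ, 0 < x.re → p.eval x ≠ 0)
    {m : ℕ} (hm : p.natDegree ≤ m) (hm0 : m ≠ 0) {x a : ℂ} (hx : 0 < x.re) (ha : 0 < a.re) :
    (m : ℂ) * p.eval x + (a - x) * p.derivative.eval x ≠ 0 := by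
  have hpx := hp x hx
  rw [(IsAlgClosed.splits p).eval_derivative_eq_eval_mul_sum hpx]
  set s := (p.roots.map fun z ↦ 1 / (x - z)).sum with hs
  have hcpos : (0 : ℝ) < 1 / (2 * x.re) := by positivity
  set c : ℝ := 1 / (2 * x.re) with hc
  have hd : ‖s - (p.roots.card : ℂ) * c‖ ≤ p.roots.card * c := by
    apply multiset_disc
    intro r hr
    rw [disc_iff _ _ hcpos.le]
    have hr := roots_re_nonpos hp r hr
    have hne : x - r ≠ 0 := by
      intro h
      have : (x - r).re = 0 := by rw [h]; simp
      simp at this; linarith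
    have hn : 0 < Complex.normSq (x - r) := Complex.normSq_pos.mpr hne
    rw [one_div, Complex.inv_re, map_inv₀, inv_eq_one_div, ← mul_div_assoc]
    apply div_le_div_of_nonneg_right _ hn.le
    simp only [hc, Complex.sub_re]
    have : 2 * (1 / (2 * x.re)) * (x.re - r.re) = (x.re - r.re) / x.re := by
      field_simp
    rw [this, le_div_iff₀ hx]; linarith
  have hcard : p.roots.card ≤ m := (Polynomial.card_roots' p).trans hm
  have hd2 : ‖s - ((m * c : ℝ) : ℂ)‖ ≤ m * c := by
    have : s - ((m * c : ℝ) : ℂ) = (s - (p.roots.card : ℂ) * c)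
        - (((m - p.roots.card : ℝ) * c : ℝ) : ℂ) := by push_cast; ring
    rw [this]
    refine (norm_sub_le _ _).trans ?_
    have hh : (0 : ℝ) ≤ (m - p.roots.card : ℝ) * c := by
      apply mul_nonneg _ hcpos.le
      have : (p.roots.card : ℝ) ≤ m := by exact_mod_cast hcard
      linarith
    rw [Complex.norm_real, Real.norm_of_nonneg hh]
    linarith
  rw [disc_iff _ _ (by positivity)] at hd2
  intro h0
  have h1 : (m : ℂ) = (x - a) * s := by
    have : p.eval x * ((m : ℂ) + (a - x) * s) = 0 := by rw [← h0]; ring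
    have := (mul_eq_zero.mp this).resolve_left hpx
    linear_combination this
  have hs0 : s ≠ 0 := by
    intro h
    rw [h, mul_zero] at h1
    exact hm0 (by exact_mod_cast h1)
  have h2 : (m : ℂ) * (starRingEnd ℂ) s = (x - a) * (Complex.normSq s : ℂ) := by
    rw [h1, mul_assoc, Complex.mul_conj]
  have h3 := congrArg Complex.re h2
  simp at h3
  have h4 : 0 < Complex.normSq s := Complex.normSq_pos.mpr hs0
  have h5 : 2 * (m * c) * s.re = m * s.re / x.re := by
    simp only [hc]; field_simp
  rw [h5, le_div_iff₀ hx, h3] at hd2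
  nlinarith

theorem norm_eval_le_of_re {p : Polynomial ℂ} (hp : ∀ x : ℂ, 0 < x.re → p.eval x ≠ 0)
    {R : ℝ} {t : ℂ} (ht : |t.re| ≤ R) :
    ‖p.eval t‖ ≤ ‖p.eval (⟨R, t.im⟩ : ℂ)‖ := by
  have hr := roots_re_nonpos hp
  rw [(IsAlgClosed.splits p).eval_eq_prod_roots, (IsAlgClosed.splits p).eval_eq_prod_roots]
  rw [norm_mul, norm_mul]
  apply mul_le_mul_of_nonneg_left _ (norm_nonneg _)
  generalize p.roots = S at hr
  induction S using Multiset.induction with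
  | empty => simp
  | cons a S ih =>
    simp only [Multiset.map_cons, Multiset.prod_cons, norm_mul]
    apply mul_le_mul _ (ih (fun r h => hr r (Multiset.mem_cons_of_mem h))) (norm_nonneg _)
      (norm_nonneg _)
    have ha := hr a (Multiset.mem_cons_self a S)
    apply le_of_sq_le_sq _ (norm_nonneg _)
    rw [← Complex.normSq_eq_norm_sq, ← Complex.normSq_eq_norm_sq, Complex.normSq_apply,
      Complex.normSq_apply]
    simp only [Complex.sub_re, Complex.sub_im]
    obtain ⟨h1, h2⟩ := abs_le.mp ht
    nlinarith [mul_nonneg (by linarith : 0 ≤ R - t.re) (by linarith : 0 ≤ R + t.re - 2 * a.re)]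

theorem iteratedDeriv_poly (p : Polynomial ℂ) (j : ℕ) :
    iteratedDeriv j (fun t => p.eval t) = fun t => (Polynomial.derivative^[j] p).eval t := by
  induction j generalizing p with
  | zero => simp
  | succ j ih =>
    rw [iteratedDeriv_succ', Function.iterate_succ, Function.comp_apply, ← ih]
    congr 1
    ext t
    simp

theorem coeff_cauchy (p : Polynomial ℂ) {R M : ℝ} (hR : 0 < R)
    (h : ∀ t : ℂ, ‖t‖ = R → ‖p.eval t‖ ≤ M) (j : ℕ) : ‖p.coeff j‖ * R ^ j ≤ M := by
  have := Complex.norm_iteratedDeriv_le_of_forall_mem_sphere_norm_le (c := 0)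
    (f := fun t => p.eval t) j hR
    (p.differentiable.diffContOnCl) (C := M) (by
      intro z hz; apply h; simpa using hz)
  rw [iteratedDeriv_poly] at this
  simp only [← Polynomial.coeff_zero_eq_eval_zero, Polynomial.coeff_iterate_derivative,
    zero_add, Nat.descFactorial_self, nsmul_eq_mul, norm_mul, Complex.norm_natCast] at this
  rw [le_div_iff₀ (by positivity), mul_assoc] at this
  exact le_of_mul_le_mul_left this (by positivity)

theorem szasz_coeffs (S : Multiset ℂ) :
    let p := (S.map fun s => (1 + Polynomial.C s * Polynomial.X : Polynomial ℂ)).prod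
    p.coeff 0 = 1 ∧ p.coeff 1 = S.sum ∧
      2 * p.coeff 2 = S.sum ^ 2 - (S.map fun s => s ^ 2).sum := by
  induction S using Multiset.induction with
  | empty => simp [Polynomial.coeff_one]
  | cons a S ih =>
    simp only [Multiset.map_cons, Multiset.prod_cons, Multiset.sum_cons] at ih ⊢
    obtain ⟨h0, h1, h2⟩ := ih
    simp only [add_mul, one_mul, mul_assoc, Polynomial.coeff_add, Polynomial.coeff_C_mul,
      Polynomial.coeff_X_mul, Polynomial.mul_coeff_zero, Polynomial.coeff_X_zero, zero_mul,
      mul_zero, add_zero, h0, h1, true_and, mul_one]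
    refine ⟨add_comm _ _, ?_⟩
    rw [mul_add, h2]
    ring

theorem norm_one_add_le (u : ℂ) : ‖1 + u‖ ≤ Real.exp (u.re + ‖u‖ ^ 2 / 2) := by
  apply le_of_sq_le_sq _ (Real.exp_nonneg _)
  rw [← Real.exp_nat_mul, ← Complex.normSq_eq_norm_sq, ← Complex.normSq_eq_norm_sq,
    Complex.normSq_apply, Complex.normSq_apply]
  have := Real.add_one_le_exp (((2 : ℕ) : ℝ) * (u.re + (u.re * u.re + u.im * u.im) / 2))
  refine le_trans ?_ this
  simp only [Complex.add_re, Complex.add_im, Complex.one_re, Complex.one_im]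
  push_cast
  nlinarith

theorem szasz_prod (S : Multiset ℂ) (t : ℂ) :
    ‖(S.map fun s => 1 + s * t).prod‖ ≤
      Real.exp ((S.sum * t).re + (S.map fun s => ‖s‖ ^ 2).sum * ‖t‖ ^ 2 / 2) := by
  induction S using Multiset.induction with
  | empty => simp
  | cons a S ih =>
    simp only [Multiset.map_cons, Multiset.prod_cons, Multiset.sum_cons, norm_mul]
    refine (mul_le_mul (norm_one_add_le _) ih (norm_nonneg _) (Real.exp_nonneg _)).trans ?_
    rw [← Real.exp_add]
    apply Real.exp_le_exp.mpr
    rw [add_mul, Complex.add_re, norm_mul]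
    apply le_of_eq
    ring

theorem szasz_sq (S : Multiset ℂ) (h : ∀ s ∈ S, 0 ≤ s.re) :
    0 ≤ S.sum.re ∧ (S.map fun s => ‖s‖ ^ 2).sum ≤ 2 * S.sum.re ^ 2 - (S.map fun s => s ^ 2).sum.re := by
  induction S using Multiset.induction with
  | empty => simp
  | cons a S ih =>
    simp only [Multiset.map_cons, Multiset.sum_cons, Complex.add_re]
    obtain ⟨h1, h2⟩ := ih (fun r hr => h r (Multiset.mem_cons_of_mem hr))
    have ha := h a (Multiset.mem_cons_self a S)
    refine ⟨by linarith, ?_⟩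
    rw [← Complex.normSq_eq_norm_sq, Complex.normSq_apply]
    have : (a ^ 2).re = a.re * a.re - a.im * a.im := by rw [pow_two, Complex.mul_re]
    rw [this]
    nlinarith [mul_nonneg ha h1]

/-- Szasz's inequality. -/
theorem szasz {p : Polynomial ℂ} (hp : ∀ x : ℂ, 0 < x.re → p.eval x ≠ 0)
    (h0 : p.coeff 0 ≠ 0) (t : ℂ) :
    ‖p.eval t‖ ≤ ‖p.coeff 0‖ * Real.exp (‖p.coeff 1 / p.coeff 0‖ * ‖t‖ +
      (3 * ‖p.coeff 1 / p.coeff 0‖ ^ 2 + 2 * ‖p.coeff 2 / p.coeff 0‖) * ‖t‖ ^ 2 / 2) := by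
  have hr := roots_re_nonpos hp
  have hr0 : ∀ r ∈ p.roots, r ≠ 0 := by
    rintro r h rfl
    exact h0 (by rw [Polynomial.coeff_zero_eq_eval_zero]; exact Polynomial.isRoot_of_mem_roots h)
  set S := p.roots.map (fun r => -1 / r) with hS
  set q := (S.map fun s => (1 + Polynomial.C s * Polynomial.X : Polynomial ℂ)).prod with hq
  have hpq : ∃ c : ℂ, p = Polynomial.C c * q := by
    have : ∀ R : Multiset ℂ, (∀ r ∈ R, r ≠ 0) → ∃ c : ℂ,
        (R.map fun a => Polynomial.X - Polynomial.C a).prod = Polynomial.C c *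
          ((R.map (fun r => -1 / r)).map fun s => (1 + Polynomial.C s * Polynomial.X : Polynomial ℂ)).prod := by
      intro R
      induction R using Multiset.induction with
      | empty => intro _; exact ⟨1, by simp⟩
      | cons a R ih =>
        intro hR
        obtain ⟨c, hc⟩ := ih (fun r hr => hR r (Multiset.mem_cons_of_mem hr))
        have ha := hR a (Multiset.mem_cons_self a R)
        refine ⟨-a * c, ?_⟩
        simp only [Multiset.map_cons, Multiset.prod_cons, hc]
        have : (Polynomial.X - Polynomial.C a : Polynomial ℂ) =
            Polynomial.C (-a) * (1 + Polynomial.C (-1 / a) * Polynomial.X) := by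
          rw [mul_add, ← mul_assoc, ← Polynomial.C_mul]
          have : -a * (-1 / a) = 1 := by field_simp
          rw [this]; simp; ring
        rw [this, Polynomial.C_mul]
        ring
    obtain ⟨c, hc⟩ := this p.roots hr0
    refine ⟨p.leadingCoeff * c, ?_⟩
    conv_lhs => rw [(IsAlgClosed.splits p).eq_prod_roots, hc]
    rw [Polynomial.C_mul, mul_assoc]
  obtain ⟨c, hc⟩ := hpq
  obtain ⟨q0, q1, q2⟩ := szasz_coeffs S
  rw [← hq] at q0 q1 q2
  have hc0 : p.coeff 0 = c := by rw [hc, Polynomial.coeff_C_mul, q0, mul_one]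
  have hcne : c ≠ 0 := hc0 ▸ h0
  have hA : p.coeff 1 / p.coeff 0 = S.sum := by
    rw [hc0, hc, Polynomial.coeff_C_mul, q1]; field_simp
  have hB : p.coeff 2 / p.coeff 0 = q.coeff 2 := by
    rw [hc0, hc, Polynomial.coeff_C_mul]; field_simp
  have hSre : ∀ s ∈ S, 0 ≤ s.re := by
    intro s hs
    rw [hS, Multiset.mem_map] at hs
    obtain ⟨r, hrm, rfl⟩ := hs
    have := hr r hrm
    rw [neg_div, one_div, Complex.neg_re, Complex.inv_re, neg_nonneg]
    exact div_nonpos_of_nonpos_of_nonneg this (Complex.normSq_nonneg _)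
  rw [hA, hB, hc0, hc, Polynomial.eval_mul, Polynomial.eval_C, norm_mul]
  apply mul_le_mul_of_nonneg_left _ (norm_nonneg _)
  have he : q.eval t = (S.map fun s => 1 + s * t).prod := by
    rw [hq, Polynomial.eval_multiset_prod, Multiset.map_map]
    simp
  rw [he]
  refine (szasz_prod S t).trans (Real.exp_le_exp.mpr ?_)
  obtain ⟨_, h2⟩ := szasz_sq S hSre
  have h3 : (S.sum * t).re ≤ ‖S.sum‖ * ‖t‖ := by
    rw [← norm_mul]; exact Complex.re_le_norm _
  have h4 : -(S.map fun s => s ^ 2).sum.re ≤ ‖S.sum‖ ^ 2 + 2 * ‖q.coeff 2‖ := by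
    have : (S.map fun s => s ^ 2).sum = S.sum ^ 2 - 2 * q.coeff 2 := by rw [q2]; ring
    rw [this]
    have h5 := (Complex.abs_re_le_norm (S.sum ^ 2 - 2 * q.coeff 2))
    have h6 := norm_sub_le (S.sum ^ 2) (2 * q.coeff 2)
    rw [norm_pow, norm_mul, Complex.norm_ofNat] at h6
    linarith [neg_abs_le (S.sum ^ 2 - 2 * q.coeff 2).re]
  have h5 : S.sum.re ^ 2 ≤ ‖S.sum‖ ^ 2 := by
    rw [← sq_abs]; exact pow_le_pow_left₀ (abs_nonneg _) (Complex.abs_re_le_norm _) 2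
  have h6 : (S.map fun s => ‖s‖ ^ 2).sum ≤ 3 * ‖S.sum‖ ^ 2 + 2 * ‖q.coeff 2‖ := by linarith
  have h7 := mul_le_mul_of_nonneg_right h6 (sq_nonneg ‖t‖)
  linarith

end BB


namespace BB
open Topology Metric

def Stab {σ : Type*} (P : MvPolynomial σ ℂ) : Prop :=
  ∀ z : σ → ℂ, (∀ i, 0 < (z i).re) → eval z P ≠ 0

def RH (σ : Type*) : Set (σ → ℂ) := {z | ∀ i, 0 < (z i).re}

theorem isOpen_RH (σ : Type*) [Fintype σ] : IsOpen (RH σ) := by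
  have : RH σ = ⋂ i, {z : σ → ℂ | 0 < (z i).re} := by ext z; simp [RH]
  rw [this]
  exact isOpen_iInter_of_finite fun i => isOpen_lt continuous_const (by fun_prop)

theorem convex_RH (σ : Type*) : Convex ℝ (RH σ) := by
  intro x hx y hy a b ha hb hab i
  have h1 := hx i
  have h2 := hy i
  simp only [Pi.add_apply, Pi.smul_apply, Complex.add_re, Complex.real_smul, Complex.mul_re,
    Complex.ofReal_re, Complex.ofReal_im, zero_mul, sub_zero]
  rcases ha.eq_or_lt with rfl | ha
  · have : b = 1 := by linarith
    subst this; simpa using h2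
  · have := mul_pos ha h1
    have := mul_nonneg hb h2.le
    linarith

theorem hurwitz_one {ι : Type*} {l : Filter ι} [NeBot l] {U : Set ℂ} (hU : IsOpen U)
    (hc : IsPreconnected U) (f : ι → ℂ → ℂ) (g : ℂ → ℂ)
    (hf : ∀ k, Differentiable ℂ (f k))
    (hlim : ∀ K ⊆ U, IsCompact K → TendstoUniformlyOn f g l K)
    (hne : ∀ k, ∀ z ∈ U, f k z ≠ 0) {p q : ℂ} (hp : p ∈ U) (hq : q ∈ U) (hgp : g p = 0) :
    g q = 0 := by
  have hloc : TendstoLocallyUniformlyOn f g l U :=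
    (tendstoLocallyUniformlyOn_iff_forall_isCompact hU).mpr hlim
  have hd : DifferentiableOn ℂ g U :=
    hloc.differentiableOn (Eventually.of_forall fun k => (hf k).differentiableOn) hU
  have ha : AnalyticOnNhd ℂ g U := hd.analyticOnNhd hU
  by_contra hgq
  have hev : ∀ᶠ z in 𝓝[≠] p, g z ≠ 0 := by
    by_contra hfr
    exact hgq (ha.eqOn_zero_of_preconnected_of_frequently_eq_zero hc hp
      (fun h => hfr h) hq)
  have hev2 : ∀ᶠ z in 𝓝 p, z ≠ p → g z ≠ 0 := eventually_nhdsWithin_iff.mp hev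
  obtain ⟨r, hr, hball⟩ := Metric.eventually_nhds_iff_ball.mp (hev2.and (hU.mem_nhds hp))
  set ρ := r / 2 with hρ
  have hρ0 : 0 < ρ := by positivity
  have hsub : closedBall p ρ ⊆ ball p r := closedBall_subset_ball (by linarith)
  have hKU : closedBall p ρ ⊆ U := fun z hz => (hball z (hsub hz)).2
  have hcont : ContinuousOn (fun z => ‖g z‖) (sphere p ρ) :=
    (hd.continuousOn.mono (sphere_subset_closedBall.trans hKU)).norm
  obtain ⟨z0, hz0, hmin⟩ := (isCompact_sphere p ρ).exists_isMinOn
    ((NormedSpace.sphere_nonempty).mpr hρ0.le) hcont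
  have hδ : 0 < ‖g z0‖ := by
    rw [norm_pos_iff]
    exact (hball z0 (hsub (sphere_subset_closedBall hz0))).1 (ne_of_mem_sphere hz0 hρ0.ne')
  have hev3 := Metric.tendstoUniformlyOn_iff.mp (hlim _ hKU (isCompact_closedBall p ρ))
    (‖g z0‖ / 2) (by positivity)
  obtain ⟨k, hk⟩ := hev3.exists
  have hk0 := hk p (mem_closedBall_self hρ0.le)
  rw [hgp, dist_zero_left] at hk0
  have hsph : ∀ z ∈ sphere p ρ, ‖g z0‖ / 2 ≤ ‖f k z‖ := by
    intro z hz
    have h1 := hk z (sphere_subset_closedBall hz)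
    have h2 : ‖g z0‖ ≤ ‖g z‖ := hmin hz
    rw [dist_eq_norm] at h1
    have h3 := norm_sub_norm_le (g z) (f k z)
    linarith
  have hmax := Complex.norm_le_of_forall_mem_frontier_norm_le (f := fun z => (f k z)⁻¹)
    (U := ball p ρ) (C := (‖g z0‖ / 2)⁻¹) (z := p) isBounded_ball
    (by
      apply DifferentiableOn.diffContOnCl
      rw [closure_ball _ hρ0.ne']
      exact (hf k).differentiableOn.inv fun z hz => hne k z (hKU hz))
    (by
      intro z hz
      rw [frontier_ball _ hρ0.ne'] at hz
      rw [norm_inv]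
      exact inv_anti₀ (by positivity) (hsph z hz))
    (subset_closure (mem_ball_self hρ0))
  rw [norm_inv] at hmax
  have hfp : 0 < ‖f k p‖ := norm_pos_iff.mpr (hne k p hp)
  have := (inv_le_inv₀ hfp (by positivity)).mp hmax
  linarith

theorem hurwitz {ι σ : Type*} [Fintype σ] {l : Filter ι} [NeBot l]
    (f : ι → (σ → ℂ) → ℂ) (g : (σ → ℂ) → ℂ)
    (hf : ∀ k, Differentiable ℂ (f k))
    (hlim : ∀ K ⊆ RH σ, IsCompact K → TendstoUniformlyOn f g l K)
    (hne : ∀ k, ∀ z ∈ RH σ, f k z ≠ 0) :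
    (∀ z ∈ RH σ, g z ≠ 0) ∨ (∀ z ∈ RH σ, g z = 0) := by
  by_contra! hcon
  obtain ⟨⟨p, hp, hgp⟩, ⟨q, hq, hgq⟩⟩ := hcon
  let φ : ℂ → (σ → ℂ) := fun t => p + t • (q - p)
  have hφ : Continuous φ := by fun_prop
  have hφd : Differentiable ℂ φ := by fun_prop
  have hconv : Convex ℝ (φ ⁻¹' RH σ) := by
    intro x hx y hy a b ha hb hab
    have : φ (a • x + b • y) = a • φ x + b • φ y := by
      ext i
      simp only [φ, Pi.add_apply, Pi.smul_apply, Complex.real_smul, smul_eq_mul, Pi.sub_apply]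
      have : (b : ℂ) = 1 - a := by rw [← Complex.ofReal_one, ← hab]; push_cast; ring
      rw [this]; ring
    show φ (a • x + b • y) ∈ RH σ
    rw [this]
    exact convex_RH σ hx hy ha hb hab
  have := hurwitz_one (l := l) ((isOpen_RH σ).preimage hφ) hconv.isPreconnected
    (fun k => f k ∘ φ) (g ∘ φ) (fun k => (hf k).comp hφd)
    (by
      intro K hK hKc
      have h1 := hlim (φ '' K) (by rintro _ ⟨t, ht, rfl⟩; exact hK ht) (hKc.image hφ)
      refine (h1.comp φ).mono ?_
      exact Set.subset_preimage_image φ K)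
    (fun k z hz => hne k _ hz) (p := 0) (q := 1) (by simpa [φ] using hp) (by simpa [φ] using hq)
    (by simpa [φ] using hgp)
  exact hgq (by simpa [φ] using this)

theorem hurwitz_param {σ : Type*} [Fintype σ] (Φ : ℂ → (σ → ℂ) → ℂ)
    (hc : Continuous (Function.uncurry Φ)) (hd : ∀ e, Differentiable ℂ (Φ e))
    (hne : ∀ e : ℝ, 0 < e → ∀ z ∈ RH σ, Φ e z ≠ 0) :
    (∀ z ∈ RH σ, Φ 0 z ≠ 0) ∨ (∀ z ∈ RH σ, Φ 0 z = 0) := by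
  apply hurwitz (l := (atTop : Filter ℕ)) (fun k => Φ ((1 / ((k : ℝ) + 1) : ℝ) : ℂ)) (Φ 0)
    (fun k => hd _) _ (fun k => hne _ (by positivity))
  intro K _ hK
  let Ψ : C(ℂ × (σ → ℂ), ℂ) := ⟨Function.uncurry Φ, hc⟩
  have h1 : Tendsto (fun k : ℕ => Ψ.curry ((1 / ((k : ℝ) + 1) : ℝ) : ℂ)) atTop (𝓝 (Ψ.curry 0)) := by
    apply (Ψ.curry.continuous.tendsto 0).comp
    have := (Complex.continuous_ofReal.tendsto 0).comp (tendsto_one_div_add_atTop_nhds_zero_nat (𝕜 := ℝ))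
    rw [Complex.ofReal_zero] at this
    exact this
  exact (ContinuousMap.tendsto_iff_forall_isCompact_tendstoUniformlyOn.mp h1) K hK

theorem eq_zero_of_RH {σ : Type*} {P : MvPolynomial σ ℂ} (h : ∀ z ∈ RH σ, eval z P = 0) : P = 0 := by
  apply MvPolynomial.funext_set (fun _ : σ => {x : ℂ | 0 < x.re})
  · intro _
    have : Set.Infinite (Set.range fun k : ℕ => ((k : ℂ) + 1)) :=
      Set.infinite_range_of_injective fun a b h => by simpa using h
    refine this.mono ?_
    rintro _ ⟨k, rfl⟩
    simp; positivity
  · intro z hz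
    rw [h z (fun i => hz i trivial), map_zero]

theorem differentiable_eval {σ : Type*} [Fintype σ] (P : MvPolynomial σ ℂ) :
    Differentiable ℂ (fun z : σ → ℂ => eval z P) := by
  induction P using MvPolynomial.induction_on with
  | C a => simp
  | add p q hp hq => simp only [map_add]; exact hp.add hq
  | mul_X p i hp => 
    simp only [map_mul, eval_X]
    exact hp.mul (by fun_prop)

theorem continuous_eval' {σ : Type*} [Fintype σ] (P : MvPolynomial σ ℂ) :
    Continuous (fun z : σ → ℂ => eval z P) := (differentiable_eval P).continuous

theorem hurwitz_poly {σ : Type*} [Fintype σ] {P Q : MvPolynomial σ ℂ}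
    (h : ∀ e : ℝ, 0 < e → ∀ z ∈ RH σ, eval z P + e * eval z Q ≠ 0) : P = 0 ∨ Stab P := by
  have := hurwitz_param (fun e z => eval z P + e * eval z Q)
    (((continuous_eval' P).comp continuous_snd).add
      (continuous_fst.mul ((continuous_eval' Q).comp continuous_snd)))
    (fun e => (differentiable_eval P).add ((differentiable_eval Q).const_mul _)) h
  simp only [zero_mul, add_zero] at this
  rcases this with h1 | h1
  · exact Or.inr h1
  · exact Or.inl (eq_zero_of_RH h1)

end BB


namespace BB
open Topology Metric

open Classical in
noncomputable def restr {σ : Type*} (i : σ) (z : σ → ℂ) : MvPolynomial σ ℂ →ₐ[ℂ] Polynomial ℂ :=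
  aeval (fun s => if s = i then Polynomial.X else Polynomial.C (z s))

open Classical in
theorem eval_restr {σ : Type*} (i : σ) (z : σ → ℂ) (P : MvPolynomial σ ℂ) (x : ℂ) :
    (restr i z P).eval x = eval (Function.update z i x) P := by
  induction P using MvPolynomial.induction_on with
  | C a => simp [restr]
  | add p q hp hq => simp [hp, hq]
  | mul_X p s hp =>
    rw [map_mul, Polynomial.eval_mul, hp, map_mul, eval_X]
    congr 1
    by_cases h : s = i
    · subst h; simp [restr]
    · simp [restr, h]

theorem derivative_restr {σ : Type*} (i : σ) (z : σ → ℂ) (P : MvPolynomial σ ℂ) :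
    Polynomial.derivative (restr i z P) = restr i z (pderiv i P) := by
  classical
  induction P using MvPolynomial.induction_on with
  | C a => simp [restr]
  | add p q hp hq => simp [hp, hq]
  | mul_X p s hp =>
    have hX : Polynomial.derivative (restr i z (X s)) = restr i z (pderiv i (X s)) := by
      by_cases h : s = i
      · subst h; simp [restr]
      · simp [restr, h, pderiv_X_of_ne h]
    rw [map_mul, Polynomial.derivative_mul, hp, pderiv_mul, map_add, map_mul, map_mul, hX]

theorem natDegree_restr {σ : Type*} (i : σ) (z : σ → ℂ) (P : MvPolynomial σ ℂ) :
    (restr i z P).natDegree ≤ degreeOf i P := by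
  classical
  rw [restr, aeval_def, eval₂_eq]
  apply Polynomial.natDegree_sum_le_of_forall_le
  intro γ hγ
  refine (Polynomial.natDegree_mul_le).trans ?_
  rw [show (algebraMap ℂ (Polynomial ℂ)) = Polynomial.C from rfl, Polynomial.natDegree_C, zero_add]
  refine (Polynomial.natDegree_prod_le _ _).trans ?_
  have h1 : ∀ s ∈ γ.support, ((if s = i then Polynomial.X else Polynomial.C (z s) : Polynomial ℂ) ^ γ s).natDegree
      ≤ if s = i then γ i else 0 := by
    intro s _
    split_ifs with h
    · subst h; simp
    · rw [← Polynomial.C_pow, Polynomial.natDegree_C]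
  refine (Finset.sum_le_sum h1).trans ?_
  rw [Finset.sum_ite_eq']
  have := monomial_le_degreeOf i hγ
  split_ifs <;> omega

theorem restr_ne {σ : Type*} {P : MvPolynomial σ ℂ} (hP : Stab P) (i : σ) {z : σ → ℂ}
    (hz : z ∈ RH σ) (x : ℂ) (hx : 0 < x.re) : (restr i z P).eval x ≠ 0 := by
  classical
  rw [eval_restr]
  apply hP
  intro s
  by_cases h : s = i
  · subst h; simpa using hx
  · simpa [h] using hz s

theorem eval_restr_self {σ : Type*} (i : σ) (z : σ → ℂ) (P : MvPolynomial σ ℂ) :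
    (restr i z P).eval (z i) = eval z P := by
  classical
  rw [eval_restr, Function.update_eq_self]

theorem pderiv_div_re_nonneg {σ : Type*} {P : MvPolynomial σ ℂ} (hP : Stab P) (i : σ)
    {z : σ → ℂ} (hz : z ∈ RH σ) : 0 ≤ (eval z (pderiv i P) / eval z P).re := by
  have := logDeriv_re_nonneg (restr_ne hP i hz) (hz i)
  rwa [derivative_restr, eval_restr_self, eval_restr_self] at this

/-- Lieb-Sokal lemma. -/
theorem lieb_sokal {σ : Type*} [Fintype σ] {A B : MvPolynomial σ ℂ}
    (h : ∀ z ∈ RH σ, ∀ a : ℂ, 0 < a.re → eval z A + a * eval z B ≠ 0) (j : σ) :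
    A + pderiv j B = 0 ∨ Stab (A + pderiv j B) := by
  have hB : B = 0 ∨ Stab B := by
    apply hurwitz_poly (Q := A)
    intro e he z hz h0
    apply h z hz ((1 / e : ℝ) : ℂ) (by simpa using he)
    have : (e : ℂ) ≠ 0 := by exact_mod_cast he.ne'
    push_cast
    field_simp
    linear_combination h0
  rcases hB with rfl | hB
  · right
    rw [map_zero, add_zero]
    apply (fun hh => hh : _ → Stab A)
    intro z hz
    simpa using h z hz 1 (by simp)
  · apply hurwitz_poly (Q := B)
    intro e he z hz h0
    have hb := hB z hz
    have h1 : 0 ≤ (eval z A / eval z B).re := by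
      by_contra hneg
      push Not at hneg
      apply h z hz (-(eval z A / eval z B)) (by simpa using hneg)
      field_simp
      ring
    have h2 := pderiv_div_re_nonneg hB j hz
    have h3 : eval z A / eval z B + eval z (pderiv j B) / eval z B + e = 0 := by
      rw [map_add] at h0
      field_simp
      linear_combination h0
    have := congrArg Complex.re h3
    simp only [Complex.add_re, Complex.ofReal_re, Complex.zero_re] at this
    linarith

theorem pderiv_stab {σ : Type*} [Fintype σ] {Q : MvPolynomial σ ℂ} (h : Stab Q) (j : σ) :
    pderiv j Q = 0 ∨ Stab (pderiv j Q) := by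
  have := lieb_sokal (A := 0) (B := Q) (fun z hz a ha => by
    rw [map_zero, zero_add]
    apply mul_ne_zero _ (h z hz)
    rintro rfl; simp at ha) j
  simpa using this

noncomputable def contr {σ : Type*} (m : ℕ) (i j : σ) (F : MvPolynomial σ ℂ) : MvPolynomial σ ℂ :=
  (F - C (1 / (m : ℂ)) * (X i * pderiv i F)) + pderiv j (C (1 / (m : ℂ)) * pderiv i F)

theorem contr_stab {σ : Type*} [Fintype σ] {F : MvPolynomial σ ℂ} (h : F = 0 ∨ Stab F) {m : ℕ}
    {i j : σ} (hm : m ≠ 0) (hd : degreeOf i F ≤ m) :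
    contr m i j F = 0 ∨ Stab (contr m i j F) := by
  rcases h with rfl | h
  · left; simp [contr]
  apply lieb_sokal
  intro z hz a ha h0
  apply laguerre (restr_ne h i hz) ((natDegree_restr i z F).trans hd) hm (hz i) ha
  rw [derivative_restr, eval_restr_self, eval_restr_self]
  simp only [map_sub, map_mul, eval_C, eval_X] at h0
  have : (m : ℂ) ≠ 0 := by exact_mod_cast hm
  field_simp at h0
  linear_combination h0

theorem slice_zero {m : ℕ} {P : MvPolynomial (Fin (m + 1)) ℂ} (h : Stab P) :
    (finSuccEquiv ℂ m P).coeff 0 = 0 ∨ Stab ((finSuccEquiv ℂ m P).coeff 0) := by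
  have hk : ∀ z : Fin m → ℂ, eval z ((finSuccEquiv ℂ m P).coeff 0) = eval (Fin.cons 0 z : Fin (m+1) → ℂ) P := by
    intro z
    rw [eval_eq_eval_mv_eval', ← Polynomial.coeff_zero_eq_eval_zero, Polynomial.coeff_map]
  have := hurwitz_param (σ := Fin m) (fun e z => eval (Fin.cons e z : Fin (m+1) → ℂ) P)
    ((continuous_eval' P).comp (by 
      refine continuous_pi fun i => ?_
      refine Fin.cases ?_ (fun i => ?_) i
      · simp only [Fin.cons_zero]; fun_prop
      · simp only [Fin.cons_succ]; fun_prop))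
    (fun e => (differentiable_eval P).comp (by 
      refine differentiable_pi.mpr fun i => ?_
      refine Fin.cases ?_ (fun i => ?_) i
      · simp only [Fin.cons_zero]; fun_prop
      · simp only [Fin.cons_succ]; fun_prop))
    (fun e he z hz => h _ (by
      intro i
      refine Fin.cases ?_ (fun i => ?_) i
      · simpa using he
      · simpa using hz i))
  simp only [← hk] at this
  rcases this with h1 | h1
  · exact Or.inr h1
  · exact Or.inl (eq_zero_of_RH h1)

theorem slice_stab {m : ℕ} (j : ℕ) {P : MvPolynomial (Fin (m + 1)) ℂ} (h : P = 0 ∨ Stab P) :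
    (finSuccEquiv ℂ m P).coeff j = 0 ∨ Stab ((finSuccEquiv ℂ m P).coeff j) := by
  induction j generalizing P with
  | zero =>
    rcases h with rfl | h
    · left; simp
    · exact slice_zero h
  | succ j ih =>
    have key : (finSuccEquiv ℂ m (pderiv 0 P)).coeff j = C ((j : ℂ) + 1) * (finSuccEquiv ℂ m P).coeff (j + 1) := by
      ext γ
      rw [finSuccEquiv_coeff_coeff, coeff_C_mul, finSuccEquiv_coeff_coeff, coeff_pderiv]
      have : γ.cons j + Finsupp.single 0 1 = γ.cons (j + 1) := by
        ext s
        refine Fin.cases ?_ (fun s => ?_) s <;> simp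
      rw [this, Finsupp.cons_zero, mul_comm]
    have hj : (j : ℂ) + 1 ≠ 0 := by exact_mod_cast Nat.succ_ne_zero j
    have h2 : pderiv 0 P = 0 ∨ Stab (pderiv 0 P) := by
      rcases h with rfl | h
      · left; simp
      · exact pderiv_stab h 0
    rcases ih h2 with h3 | h3
    · left
      rw [key] at h3
      exact (mul_eq_zero.mp h3).resolve_left (mt C_eq_zero.mp hj)
    · right
      intro z hz h0
      apply h3 z hz
      rw [key, map_mul, h0, mul_zero]

end BB


namespace BB
open Topology Metric

def KR (σ : Type*) (R : ℝ) : Set (σ → ℂ) := {z | ∀ i, (z i).re = R ∧ |(z i).im| ≤ R}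

theorem KR_eq (σ : Type*) (R : ℝ) : KR σ R =
    (fun y : σ → ℝ => fun i => (⟨R, y i⟩ : ℂ)) '' (Set.pi Set.univ fun _ => Set.Icc (-R) R) := by
  ext z
  constructor
  · intro hz
    refine ⟨fun i => (z i).im, fun i _ => abs_le.mp (hz i).2, ?_⟩
    ext i
    exact Complex.ext (hz i).1.symm rfl
  · rintro ⟨y, hy, rfl⟩ i
    exact ⟨rfl, abs_le.mpr (hy i trivial)⟩

theorem isCompact_KR (σ : Type*) (R : ℝ) : IsCompact (KR σ R) := by
  rw [KR_eq]
  apply (isCompact_univ_pi fun _ => isCompact_Icc).image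
  refine continuous_pi fun i => ?_
  have : (fun y : σ → ℝ => (⟨R, y i⟩ : ℂ)) = fun y => (R : ℂ) + (y i : ℂ) * Complex.I := by
    ext y; apply Complex.ext <;> simp
  rw [this]
  fun_prop

theorem KR_subset_RH (σ : Type*) {R : ℝ} (hR : 0 < R) : KR σ R ⊆ RH σ := by
  intro z hz i
  rw [(hz i).1]; exact hR

theorem KR_nonempty (σ : Type*) {R : ℝ} (hR : 0 < R) : (KR σ R).Nonempty :=
  ⟨fun _ => (R : ℂ), fun _ => by simp [hR.le]⟩

theorem KR_norm_le {σ : Type*} {R : ℝ} (hR : 0 < R) {z : σ → ℂ} (hz : z ∈ KR σ R) (i : σ) :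
    ‖z i‖ ≤ 2 * R := by
  have := Complex.norm_le_abs_re_add_abs_im (z i)
  rw [(hz i).1, abs_of_pos hR] at this
  linarith [(hz i).2]

theorem cons_mem_RH {m : ℕ} {z : Fin m → ℂ} (hz : z ∈ RH (Fin m)) {x : ℂ} (hx : 0 < x.re) :
    (Fin.cons x z : Fin (m+1) → ℂ) ∈ RH (Fin (m+1)) := by
  intro i
  refine Fin.cases ?_ (fun i => ?_) i
  · simpa using hx
  · simpa using hz i

theorem coeff_bound_of_KR {m : ℕ} {P : MvPolynomial (Fin m) ℂ} (hP : P = 0 ∨ Stab P) {R M : ℝ}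
    (hR : 0 < R) (h : ∀ z ∈ KR (Fin m) R, ‖eval z P‖ ≤ M) (γ : Fin m →₀ ℕ) :
    ‖coeff γ P‖ * R ^ (∑ i, γ i) ≤ M := by
  induction m generalizing M with
  | zero =>
    obtain ⟨z, hz⟩ := KR_nonempty (Fin 0) hR
    have := h z hz
    have hγ : γ = 0 := Subsingleton.elim _ _
    rw [eq_C_of_isEmpty P, eval_C] at this
    simpa [hγ] using this
  | succ m ih =>
    have hγ : γ = (γ.tail).cons (γ 0) := (Finsupp.cons_tail γ).symm
    have h1 : ∀ z ∈ KR (Fin m) R, ‖eval z ((finSuccEquiv ℂ m P).coeff (γ 0))‖ ≤ M / R ^ (γ 0) := by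
      intro z hz
      rw [le_div_iff₀ (by positivity)]
      have := coeff_cauchy (Polynomial.map (eval z) (finSuccEquiv ℂ m P)) (M := M) hR ?_ (γ 0)
      · rwa [Polynomial.coeff_map] at this
      intro t ht
      have h2 : ‖Polynomial.eval (⟨R, t.im⟩ : ℂ) (Polynomial.map (eval z) (finSuccEquiv ℂ m P))‖ ≤ M := by
        rw [← eval_eq_eval_mv_eval']
        apply h
        intro i
        refine Fin.cases ?_ (fun i => ?_) i
        · simp only [Fin.cons_zero, true_and]
          rw [← ht]; exact Complex.abs_im_le_norm t
        · simpa using hz i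
      rcases hP with rfl | hP
      · simpa using h2
      refine (norm_eval_le_of_re ?_ ?_).trans h2
      · intro x hx
        rw [← eval_eq_eval_mv_eval']
        exact hP _ (cons_mem_RH (KR_subset_RH _ hR hz) hx)
      · rw [← ht]; exact Complex.abs_re_le_norm t
    have h2 := ih (slice_stab (γ 0) hP) h1 γ.tail
    rw [finSuccEquiv_coeff_coeff, ← hγ, le_div_iff₀ (by positivity)] at h2
    rw [Fin.sum_univ_succ, pow_add]
    simp only [Finsupp.tail_apply] at h2
    linarith

theorem summable_geom (σ : Type*) [Fintype σ] :
    Summable (fun γ : σ →₀ ℕ => ((1 : ℝ) / 2) ^ (∑ i, γ i)) := by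
  classical
  have : Summable (fun γ : σ → ℕ => ((1 : ℝ) / 2) ^ (∑ i, γ i)) := by
    apply summable_of_sum_le (c := 2 ^ Fintype.card σ) (fun γ => by positivity)
    intro u
    obtain ⟨N, hN⟩ : ∃ N, u ⊆ Fintype.piFinset (fun _ : σ => Finset.range N) := by
      refine ⟨(u.sup fun γ => ∑ i, γ i) + 1, fun γ hγ => ?_⟩
      rw [Fintype.mem_piFinset]
      intro i
      rw [Finset.mem_range]
      have h1 : ∑ i, γ i ≤ u.sup fun γ => ∑ i, γ i := Finset.le_sup (f := fun γ => ∑ i, γ i) hγ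
      have h2 : γ i ≤ ∑ i, γ i := Finset.single_le_sum (fun _ _ => Nat.zero_le _) (Finset.mem_univ i)
      omega
    refine (Finset.sum_le_sum_of_subset_of_nonneg hN fun _ _ _ => by positivity).trans ?_
    simp_rw [← Finset.prod_pow_eq_pow_sum]
    rw [← Finset.prod_univ_sum (fun _ : σ => Finset.range N) (fun _ j => ((1 : ℝ) / 2) ^ j)]
    rw [Finset.prod_const, Finset.card_univ]
    apply pow_le_pow_left₀ (Finset.sum_nonneg fun _ _ => by positivity)
    have := summable_geometric_two.sum_le_tsum (Finset.range N) (fun _ _ => by positivity)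
    rwa [tsum_geometric_two] at this
  exact this.comp_injective (i := fun γ : σ →₀ ℕ => (γ : σ → ℕ)) DFunLike.coe_injective

section D
variable {σ : Type*} [Fintype σ]

theorem hasSum_eval (P : MvPolynomial σ ℂ) (z : σ → ℂ) :
    HasSum (fun γ : σ →₀ ℕ => coeff γ P * ∏ i, z i ^ γ i) (eval z P) := by
  rw [eval_eq']
  apply hasSum_sum_of_ne_finset_zero
  intro γ hγ
  rw [notMem_support_iff.mp hγ, zero_mul]

theorem norm_prod_pow_le {z : σ → ℂ} {r : ℝ} (hz : ∀ i, ‖z i‖ ≤ r) (γ : σ →₀ ℕ) :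
    ‖∏ i, z i ^ γ i‖ ≤ r ^ (∑ i, γ i) := by
  rw [norm_prod, ← Finset.prod_pow_eq_pow_sum]
  apply Finset.prod_le_prod (fun _ _ => norm_nonneg _)
  intro i _
  rw [norm_pow]
  exact pow_le_pow_left₀ (norm_nonneg _) (hz i) _

theorem geom_bound {a r M : ℝ} (hr : 0 < r) {N : ℕ} (h : a * (2 * r) ^ N ≤ M) :
    a * r ^ N ≤ M * (1 / 2) ^ N := by
  rw [mul_pow] at h
  rw [one_div, inv_pow, ← div_eq_mul_inv, le_div_iff₀ (by positivity)]
  linarith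

theorem term_bound {a : ℂ} {z : σ → ℂ} {r M : ℝ} (hr : 0 < r) (hz : ∀ i, ‖z i‖ ≤ r) (γ : σ →₀ ℕ)
    (h : ‖a‖ * (2 * r) ^ (∑ i, γ i) ≤ M) :
    ‖a * ∏ i, z i ^ γ i‖ ≤ M * (1 / 2) ^ (∑ i, γ i) := by
  rw [norm_mul]
  exact (mul_le_mul_of_nonneg_left (norm_prod_pow_le hz γ) (norm_nonneg _)).trans (geom_bound hr h)

theorem summable_of_bound {c : (σ →₀ ℕ) → ℂ} 
    (hb : ∀ R : ℝ, 0 < R → ∃ M, ∀ γ, ‖c γ‖ * R ^ (∑ i, γ i) ≤ M) (z : σ → ℂ) :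
    Summable (fun γ : σ →₀ ℕ => c γ * ∏ i, z i ^ γ i) := by
  obtain ⟨M, hM⟩ := hb (2 * (‖z‖ + 1)) (by positivity)
  apply Summable.of_norm_bounded ((summable_geom σ).mul_left M)
  intro γ
  exact term_bound (by positivity) (fun i => (norm_le_pi_norm z i).trans (by linarith)) γ (hM γ)

theorem uniform_bound {P : ℕ → MvPolynomial σ ℂ}
    (hb : ∀ R : ℝ, 0 < R → ∃ M, ∀ k γ, ‖coeff γ (P k)‖ * R ^ (∑ i, γ i) ≤ M) (r : ℝ) (hr : 0 < r) :
    ∃ B, ∀ k, ∀ z : σ → ℂ, (∀ i, ‖z i‖ ≤ r) → ‖eval z (P k)‖ ≤ B := by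
  obtain ⟨M, hM⟩ := hb (2 * r) (by positivity)
  refine ⟨∑' γ : σ →₀ ℕ, M * ((1 : ℝ) / 2) ^ (∑ i, γ i), fun k z hz => ?_⟩
  rw [← (hasSum_eval (P k) z).tsum_eq]
  exact tsum_of_norm_bounded ((summable_geom σ).mul_left M).hasSum
    (fun γ => term_bound hr hz γ (hM k γ))

theorem limit_bound {P : ℕ → MvPolynomial σ ℂ} {c : (σ →₀ ℕ) → ℂ}
    (hc : ∀ γ, Tendsto (fun k => coeff γ (P k)) atTop (𝓝 (c γ)))
    (hb : ∀ R : ℝ, 0 < R → ∃ M, ∀ k γ, ‖coeff γ (P k)‖ * R ^ (∑ i, γ i) ≤ M) :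
    ∀ R : ℝ, 0 < R → ∃ M, ∀ γ, ‖c γ‖ * R ^ (∑ i, γ i) ≤ M := by
  intro R hR
  obtain ⟨M, hM⟩ := hb R hR
  exact ⟨M, fun γ => le_of_tendsto ((hc γ).norm.mul_const _) (Eventually.of_forall fun k => hM k γ)⟩

theorem uniform_limit {P : ℕ → MvPolynomial σ ℂ} {c : (σ →₀ ℕ) → ℂ}
    (hc : ∀ γ, Tendsto (fun k => coeff γ (P k)) atTop (𝓝 (c γ)))
    (hb : ∀ R : ℝ, 0 < R → ∃ M, ∀ k γ, ‖coeff γ (P k)‖ * R ^ (∑ i, γ i) ≤ M)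
    (K : Set (σ → ℂ)) (hK : IsCompact K) :
    TendstoUniformlyOn (fun k z => eval z (P k)) (fun z => ∑' γ : σ →₀ ℕ, c γ * ∏ i, z i ^ γ i)
      atTop K := by
  obtain ⟨r, hr0, hr⟩ := hK.isBounded.exists_pos_norm_le
  have hcb := limit_bound hc hb
  obtain ⟨M, hM⟩ := hb (2 * r) (by positivity)
  have hcM : ∀ γ, ‖c γ‖ * (2 * r) ^ (∑ i, γ i) ≤ M :=
    fun γ => le_of_tendsto ((hc γ).norm.mul_const _) (Eventually.of_forall fun k => hM k γ)
  have hsum : Summable (fun γ : σ →₀ ℕ => (2 * M) * ((1 : ℝ) / 2) ^ (∑ i, γ i)) :=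
    (summable_geom σ).mul_left _
  have hle : ∀ k γ, ‖coeff γ (P k) - c γ‖ * r ^ (∑ i, γ i) ≤ (2 * M) * ((1 : ℝ) / 2) ^ (∑ i, γ i) := by
    intro k γ
    apply geom_bound hr0
    have h1 := mul_le_mul_of_nonneg_right (norm_sub_le (coeff γ (P k)) (c γ))
      (by positivity : 0 ≤ (2 * r) ^ (∑ i, γ i))
    rw [add_mul] at h1
    linarith [hM k γ, hcM γ]
  have hE : Tendsto (fun k => ∑' γ : σ →₀ ℕ, ‖coeff γ (P k) - c γ‖ * r ^ (∑ i, γ i)) atTop (𝓝 0) := by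
    have := tendsto_tsum_of_dominated_convergence (𝓕 := atTop)
      (f := fun k (γ : σ →₀ ℕ) => ‖coeff γ (P k) - c γ‖ * r ^ (∑ i, γ i)) (g := fun _ => (0 : ℝ))
      hsum (fun γ => by
        have := ((hc γ).sub_const (c γ)).norm.mul_const (r ^ (∑ i, γ i))
        simpa using this)
      (Eventually.of_forall fun k γ => by
        rw [Real.norm_of_nonneg (by positivity)]
        exact hle k γ)
    simpa using this
  rw [Metric.tendstoUniformlyOn_iff]
  intro ε hε
  filter_upwards [hE.eventually_lt_const hε] with k hk z hz
  have hzi : ∀ i, ‖z i‖ ≤ r := fun i => (norm_le_pi_norm z i).trans (hr z hz)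
  refine lt_of_le_of_lt ?_ hk
  rw [dist_comm, dist_eq_norm, ← (hasSum_eval (P k) z).tsum_eq,
    ← ((hasSum_eval (P k) z).summable).tsum_sub (summable_of_bound hcb z)]
  apply tsum_of_norm_bounded (Summable.hasSum (Summable.of_nonneg_of_le (fun γ => by positivity)
    (hle k) hsum))
  intro γ
  rw [← sub_mul, norm_mul]
  exact mul_le_mul_of_nonneg_left (norm_prod_pow_le hzi γ) (norm_nonneg _)

end D

end BB


namespace BB
open Topology Metric

theorem single_bound {σ : Type*} [Fintype σ] (P : MvPolynomial σ ℂ) (R : ℝ) (hR : 0 < R) :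
    ∃ M, ∀ γ, ‖coeff γ P‖ * R ^ (∑ i, γ i) ≤ M := by
  refine ⟨∑ γ ∈ P.support, ‖coeff γ P‖ * R ^ (∑ i, γ i), fun γ => ?_⟩
  by_cases h : γ ∈ P.support
  · exact Finset.single_le_sum (f := fun γ => ‖coeff γ P‖ * R ^ (∑ i, γ i))
      (fun _ _ => by positivity) h
  · rw [notMem_support_iff.mp h, norm_zero, zero_mul]
    exact Finset.sum_nonneg fun _ _ => by positivity

theorem bound_of_eventually {σ : Type*} [Fintype σ] {P : ℕ → MvPolynomial σ ℂ} {R : ℝ} (hR : 0 < R)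
    {M : ℝ} (h : ∀ᶠ k in atTop, ∀ γ, ‖coeff γ (P k)‖ * R ^ (∑ i, γ i) ≤ M) :
    ∃ M, ∀ k γ, ‖coeff γ (P k)‖ * R ^ (∑ i, γ i) ≤ M := by
  obtain ⟨N, hN⟩ := eventually_atTop.mp h
  choose B hB using fun k => single_bound (P k) R hR
  have hB0 : ∀ k, 0 ≤ B k := fun k => le_trans (by positivity) (hB k 0)
  refine ⟨max M (∑ k ∈ Finset.range N, B k), fun k γ => ?_⟩
  by_cases hk : N ≤ k
  · exact (hN k hk γ).trans (le_max_left _ _)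
  · refine ((hB k γ).trans ?_).trans (le_max_right _ _)
    exact Finset.single_le_sum (f := B) (fun k _ => hB0 k) (Finset.mem_range.mpr (not_le.mp hk))

theorem shift_unif {α : Type*} {f : ℕ → α → ℂ} {g : α → ℂ} {K : Set α}
    (h : TendstoUniformlyOn f g atTop K) (N : ℕ) :
    TendstoUniformlyOn (fun k => f (k + N)) g atTop K :=
  fun u hu => (tendsto_add_atTop_nat N).eventually (h u hu)

theorem limit_nonvanishing {m : ℕ} {P : ℕ → MvPolynomial (Fin m) ℂ} {c : (Fin m →₀ ℕ) → ℂ}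
    (hP : ∀ k, P k = 0 ∨ Stab (P k))
    (hc : ∀ γ, Tendsto (fun k => coeff γ (P k)) atTop (𝓝 (c γ)))
    (hb : ∀ R : ℝ, 0 < R → ∃ M, ∀ k γ, ‖coeff γ (P k)‖ * R ^ (∑ i, γ i) ≤ M)
    {γ0 : Fin m →₀ ℕ} (h0 : c γ0 ≠ 0) :
    ∀ z ∈ RH (Fin m), (∑' γ : Fin m →₀ ℕ, c γ * ∏ i, z i ^ γ i) ≠ 0 := by
  obtain ⟨N, hN⟩ := eventually_atTop.mp ((hc γ0).eventually_ne h0)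
  have hst : ∀ k, Stab (P (k + N)) := fun k => (hP _).resolve_left (fun h => hN (k + N) (by omega)
    (by rw [h, coeff_zero]))
  rcases hurwitz (l := atTop) (fun k z => eval z (P (k + N)))
    (fun z => ∑' γ : Fin m →₀ ℕ, c γ * ∏ i, z i ^ γ i)
    (fun k => differentiable_eval _)
    (fun K _ hK => shift_unif (uniform_limit hc hb K hK) N) (fun k z hz => hst k z hz) with h | h
  · exact h
  exfalso
  have hu := uniform_limit hc hb (KR (Fin m) 1) (isCompact_KR _ _)
  rw [Metric.tendstoUniformlyOn_iff] at hu
  have hpos : 0 < ‖c γ0‖ := norm_pos_iff.mpr h0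
  have hle : ‖c γ0‖ ≤ ‖c γ0‖ / 2 := by
    refine le_of_tendsto (hc γ0).norm ?_
    filter_upwards [hu (‖c γ0‖ / 2) (by positivity)] with k hk
    have := coeff_bound_of_KR (hP k) one_pos (M := ‖c γ0‖ / 2) (fun z hz => by
      have h1 := hk z hz
      have h2 := h z (KR_subset_RH _ one_pos hz)
      rw [h2, dist_zero_left] at h1
      exact h1.le) γ0
    simpa using this
  linarith

theorem szasz_slice {m : ℕ} {P : MvPolynomial (Fin (m+1)) ℂ} (hP : Stab P) (d : ℕ)
    (hd : ∀ j < d, (finSuccEquiv ℂ m P).coeff j = 0) {R δ B : ℝ} (hR : 0 < R) (hδ : 0 < δ)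
    {z : Fin m → ℂ} (hz : z ∈ RH (Fin m))
    (h0 : δ ≤ ‖eval z ((finSuccEquiv ℂ m P).coeff d)‖)
    (hB : ∀ j ≤ 2, ‖eval z ((finSuccEquiv ℂ m P).coeff (d + j))‖ ≤ B) (j : ℕ) :
    ‖eval z ((finSuccEquiv ℂ m P).coeff j)‖ * R ^ j ≤
      R ^ d * (B * Real.exp ((B/δ) * R + (3 * (B/δ) ^ 2 + 2 * (B / δ)) * R ^ 2 / 2)) := by
  set p := Polynomial.map (eval z) (finSuccEquiv ℂ m P) with hp
  have hpc : ∀ j, p.coeff j = eval z ((finSuccEquiv ℂ m P).coeff j) := fun j => Polynomial.coeff_map _ _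
  simp only [← hpc] at h0 hB ⊢
  have hdvd : Polynomial.X ^ d ∣ p := by
    rw [Polynomial.X_pow_dvd_iff]
    intro j hj
    rw [hpc, hd j hj, map_zero]
  obtain ⟨h, hh⟩ := hdvd
  have hcoef : ∀ j, p.coeff (d + j) = h.coeff j := by
    intro j
    rw [hh, add_comm, Polynomial.coeff_X_pow_mul]
  have hc0 : p.coeff d = h.coeff 0 := hcoef 0
  rw [hc0] at h0
  have hne : h.coeff 0 ≠ 0 := norm_pos_iff.mp (hδ.trans_le h0)
  have hst : ∀ x : ℂ, 0 < x.re → h.eval x ≠ 0 := by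
    intro x hx he
    apply hP _ (cons_mem_RH hz hx)
    rw [eval_eq_eval_mv_eval', ← hp, hh, Polynomial.eval_mul, he, mul_zero]
  have hB0 : ‖h.coeff 0‖ ≤ B := by rw [← hcoef]; exact hB 0 (by norm_num)
  have hBnn : 0 ≤ B := (norm_nonneg _).trans hB0
  have hq : ∀ j ≤ 2, ‖h.coeff j / h.coeff 0‖ ≤ B / δ := by
    intro j hj
    rw [norm_div]
    apply div_le_div₀ hBnn _ hδ h0
    rw [← hcoef]; exact hB j hj
  refine coeff_cauchy p hR ?_ j
  intro t ht
  rw [hh, Polynomial.eval_mul, Polynomial.eval_pow, Polynomial.eval_X, norm_mul, norm_pow, ht]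
  apply mul_le_mul_of_nonneg_left _ (by positivity)
  refine (szasz hst hne t).trans ?_
  rw [ht]
  have h1 := hq 1 (by norm_num)
  have h2 := hq 2 (by norm_num)
  gcongr

theorem coeff_bounds {m : ℕ} (P : ℕ → MvPolynomial (Fin m) ℂ) (c : (Fin m →₀ ℕ) → ℂ)
    (hP : ∀ k, P k = 0 ∨ Stab (P k))
    (hc : ∀ γ, Tendsto (fun k => coeff γ (P k)) atTop (𝓝 (c γ)))
    (hz : ∀ γ, c γ = 0 → ∀ k, coeff γ (P k) = 0) :
    ∀ R : ℝ, 0 < R → ∃ M, ∀ k γ, ‖coeff γ (P k)‖ * R ^ (∑ i, γ i) ≤ M := by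
  induction m with
  | zero =>
    intro R hR
    obtain ⟨M, hM⟩ := (hc 0).norm.bddAbove_range
    refine ⟨M, fun k γ => ?_⟩
    have hγ : γ = 0 := Subsingleton.elim _ _
    have := hM ⟨k, rfl⟩
    simpa [hγ] using this
  | succ m ih =>
    intro R hR
    set S : ℕ → ℕ → MvPolynomial (Fin m) ℂ := fun j k => (finSuccEquiv ℂ m (P k)).coeff j with hS
    have hSc : ∀ j k γ, coeff γ (S j k) = coeff (γ.cons j) (P k) := fun j k γ =>
      finSuccEquiv_coeff_coeff _ _ _
    have hSs : ∀ j k, S j k = 0 ∨ Stab (S j k) := fun j k => slice_stab j (hP k)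
    have hSl : ∀ j γ, Tendsto (fun k => coeff γ (S j k)) atTop (𝓝 (c (γ.cons j))) := by
      intro j γ; simp only [hSc]; exact hc _
    have hSb : ∀ j, ∀ R : ℝ, 0 < R → ∃ M, ∀ k γ, ‖coeff γ (S j k)‖ * R ^ (∑ i, γ i) ≤ M := by
      intro j
      apply ih (S j) (fun γ => c (γ.cons j)) (hSs j) (hSl j)
      intro γ hγ k
      rw [hSc]; exact hz _ hγ k
    by_cases hall : ∃ j, ∃ γ : Fin m →₀ ℕ, c (γ.cons j) ≠ 0
    swap
    · push Not at hall
      refine ⟨0, fun k γ => ?_⟩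
      have := hall (γ 0) γ.tail
      rw [Finsupp.cons_tail] at this
      rw [hz γ this k]; simp
    classical
    set d := Nat.find hall with hd
    obtain ⟨γ0, hγ0⟩ := Nat.find_spec hall
    rw [← hd] at hγ0
    have hS0 : ∀ j < d, ∀ k, S j k = 0 := by
      intro j hj k
      ext γ
      rw [hSc, coeff_zero]
      apply hz
      have := Nat.find_min hall hj
      push Not at this
      exact this γ
    have hF := limit_nonvanishing (hSs d) (hSl d) (hSb d) hγ0
    have hU := uniform_limit (hSl d) (hSb d) (KR (Fin m) R) (isCompact_KR _ _)
    have hcont : ContinuousOn (fun z => ∑' γ : Fin m →₀ ℕ, c (γ.cons d) * ∏ i, z i ^ γ i)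
        (KR (Fin m) R) :=
      hU.continuousOn (Frequently.of_forall fun k => (differentiable_eval (S d k)).continuous.continuousOn)
    obtain ⟨z0, hz0, hmin⟩ := (isCompact_KR (Fin m) R).exists_isMinOn (KR_nonempty _ hR) hcont.norm
    set δ := ‖∑' γ : Fin m →₀ ℕ, c (γ.cons d) * ∏ i, z0 i ^ γ i‖ with hδ
    have hδ0 : 0 < δ := norm_pos_iff.mpr (hF z0 (KR_subset_RH _ hR hz0))
    obtain ⟨B0, hB0⟩ := uniform_bound (hSb d) (2 * R) (by positivity)
    obtain ⟨B1, hB1⟩ := uniform_bound (hSb (d+1)) (2 * R) (by positivity)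
    obtain ⟨B2, hB2⟩ := uniform_bound (hSb (d+2)) (2 * R) (by positivity)
    set B := max B0 (max B1 B2) with hB
    have hBj : ∀ k, ∀ z ∈ KR (Fin m) R, ∀ j ≤ 2, ‖eval z (S (d + j) k)‖ ≤ B := by
      intro k z hz j hj
      have hzn := fun i => KR_norm_le hR hz i
      interval_cases j
      · exact (hB0 k z hzn).trans (le_max_left _ _)
      · exact (hB1 k z hzn).trans ((le_max_left _ _).trans (le_max_right _ _))
      · exact (hB2 k z hzn).trans ((le_max_right _ _).trans (le_max_right _ _))
    set M0 := R ^ d * (B * Real.exp ((B/(δ/2)) * R + (3 * (B/(δ/2)) ^ 2 + 2 * (B / (δ/2))) * R ^ 2 / 2))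
    rw [Metric.tendstoUniformlyOn_iff] at hU
    apply bound_of_eventually hR (M := M0)
    filter_upwards [hU (δ / 2) (by positivity), (hSl d γ0).eventually_ne hγ0] with k hk hkne γ
    have hPk : Stab (P k) := by
      refine (hP k).resolve_left fun h => hkne ?_
      rw [hSc, h, coeff_zero]
    have key : ∀ z ∈ KR (Fin m) R, ‖eval z (S (γ 0) k)‖ ≤ M0 / R ^ (γ 0) := by
      intro z hz
      rw [le_div_iff₀ (by positivity)]
      refine szasz_slice hPk d (fun j hj => hS0 j hj k) hR (by positivity) (KR_subset_RH _ hR hz) ?_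
        (hBj k z hz) (γ 0)
      have h1 : δ ≤ _ := hmin hz
      have h2 := hk z hz
      rw [dist_eq_norm] at h2
      have h3 := norm_sub_norm_le (∑' γ : Fin m →₀ ℕ, c (γ.cons d) * ∏ i, z i ^ γ i) (eval z (S d k))
      change δ / 2 ≤ ‖eval z (S d k)‖
      linarith
    have := coeff_bound_of_KR (hSs (γ 0) k) hR key γ.tail
    rw [hSc, Finsupp.cons_tail, le_div_iff₀ (by positivity)] at this
    rw [Fin.sum_univ_succ, pow_add]
    simp only [Finsupp.tail_apply] at this
    linarith

theorem stab_rename {σ τ : Type*} (e : σ ≃ τ) {P : MvPolynomial σ ℂ} (h : Stab P) :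
    Stab (rename e P) := by
  intro z hz
  rw [eval_rename]
  exact h _ fun i => hz _

theorem coeff_bounds' {σ : Type*} [Fintype σ] (P : ℕ → MvPolynomial σ ℂ) (c : (σ →₀ ℕ) → ℂ)
    (hP : ∀ k, P k = 0 ∨ Stab (P k))
    (hc : ∀ γ, Tendsto (fun k => coeff γ (P k)) atTop (𝓝 (c γ)))
    (hz : ∀ γ, c γ = 0 → ∀ k, coeff γ (P k) = 0) :
    ∀ R : ℝ, 0 < R → ∃ M, ∀ k γ, ‖coeff γ (P k)‖ * R ^ (∑ i, γ i) ≤ M := by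
  let e := Fintype.equivFin σ
  have hco : ∀ k (γ : Fin (Fintype.card σ) →₀ ℕ),
      coeff γ (rename e (P k)) = coeff (γ.mapDomain e.symm) (P k) := by
    intro k γ
    have h := coeff_rename_mapDomain e e.injective (P k) (γ.mapDomain e.symm)
    rw [← Finsupp.mapDomain_comp] at h
    simpa using h
  intro R hR
  obtain ⟨M, hM⟩ := coeff_bounds (fun k => rename e (P k)) (fun γ => c (γ.mapDomain e.symm))
    (fun k => (hP k).imp (fun h => by rw [h, map_zero]) (stab_rename e))
    (fun γ => by simp only [hco]; exact hc _)
    (fun γ h k => by rw [hco]; exact hz _ h k) R hR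
  refine ⟨M, fun k γ => ?_⟩
  have h1 := hM k (γ.mapDomain e)
  rw [coeff_rename_mapDomain e e.injective] at h1
  have : ∑ i, (γ.mapDomain e) i = ∑ i, γ i := by
    rw [← e.sum_comp]
    exact Finset.sum_congr rfl fun i _ => Finsupp.mapDomain_apply e.injective _ _
  rwa [this] at h1

end BB


namespace BB
open Topology Metric

section A
variable {σ : Type*} [Fintype σ]

theorem exists_word (γ : σ →₀ ℕ) : ∃ w : Fin (∑ i, γ i) → σ,
    ∀ z : σ → ℂ, ∏ j, z (w j) = ∏ i, z i ^ γ i := by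
  classical
  let l := (Finsupp.toMultiset γ).toList
  have hl : l.length = ∑ i, γ i := by
    rw [Multiset.length_toList, Finsupp.card_toMultiset, Finsupp.sum_fintype _ _ (fun _ => rfl)]
    rfl
  refine ⟨fun j => l.get (Fin.cast hl.symm j), fun z => ?_⟩
  have h1 : ∏ j : Fin (∑ i, γ i), z (l.get (Fin.cast hl.symm j)) = ∏ j : Fin l.length, z (l.get j) :=
    Fintype.prod_equiv (finCongr hl.symm) _ _ (fun j => rfl)
  rw [h1]
  have h2 : ∏ j : Fin l.length, z (l.get j) = (l.map z).prod := by
    rw [← List.prod_ofFn]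
    congr 1
    apply List.ext_get <;> simp
  rw [h2]
  have h3 : (l.map z).prod = ((Finsupp.toMultiset γ).map z).prod := by
    rw [← Multiset.prod_coe, ← Multiset.map_coe, Multiset.coe_toList]
  rw [h3, Finsupp.toMultiset_map, Finsupp.prod_toMultiset, Finsupp.prod_mapDomain_index]
  · rw [Finsupp.prod_fintype]; simp
  · simp
  · intro b m₁ m₂; rw [pow_add]

noncomputable def monoML (γ : σ →₀ ℕ) : ContinuousMultilinearMap ℂ (fun _ : Fin (∑ i, γ i) => σ → ℂ) ℂ :=
  (ContinuousMultilinearMap.mkPiAlgebra ℂ (Fin (∑ i, γ i)) ℂ).compContinuousLinearMap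
    (fun j => ContinuousLinearMap.proj (R := ℂ) (φ := fun _ : σ => ℂ) ((exists_word γ).choose j))

theorem monoML_apply (γ : σ →₀ ℕ) (z : σ → ℂ) : monoML γ (fun _ => z) = ∏ i, z i ^ γ i := by
  rw [← (exists_word γ).choose_spec z]
  simp [monoML]

theorem monoML_norm (γ : σ →₀ ℕ) : ‖monoML γ‖ ≤ 1 := by
  apply ContinuousMultilinearMap.opNorm_le_bound zero_le_one
  intro m
  simp only [monoML, ContinuousMultilinearMap.compContinuousLinearMap_apply,
    ContinuousMultilinearMap.mkPiAlgebra_apply, ContinuousLinearMap.proj_apply, one_mul]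
  rw [norm_prod]
  exact Finset.prod_le_prod (fun _ _ => norm_nonneg _) fun j _ => norm_le_pi_norm _ _

theorem exists_ML (d : ℕ) (γ : σ →₀ ℕ) : ∃ A : ContinuousMultilinearMap ℂ (fun _ : Fin d => σ → ℂ) ℂ,
    (∑ i, γ i = d → ∀ z : σ → ℂ, A (fun _ => z) = ∏ i, z i ^ γ i) ∧ ‖A‖ ≤ 1 := by
  by_cases h : ∑ i, γ i = d
  · subst h
    exact ⟨monoML γ, fun _ => monoML_apply γ, monoML_norm γ⟩
  · exact ⟨0, fun h' => absurd h' h, by simp⟩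

theorem analytic_of_bound {c : (σ →₀ ℕ) → ℂ}
    (hb : ∀ R : ℝ, 0 < R → ∃ M, ∀ γ, ‖c γ‖ * R ^ (∑ i, γ i) ≤ M) :
    AnalyticOnNhd ℂ (fun z : σ → ℂ => ∑' γ : σ →₀ ℕ, c γ * ∏ i, z i ^ γ i) Set.univ := by
  classical
  choose A hA hAn using fun d (γ : σ →₀ ℕ) => exists_ML d γ
  let p : FormalMultilinearSeries ℂ (σ → ℂ) ℂ :=
    fun d => ∑ γ ∈ Finset.finsuppAntidiag (Finset.univ : Finset σ) d, c γ • A d γ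
  have hmem : ∀ d (γ : σ →₀ ℕ), γ ∈ Finset.finsuppAntidiag (Finset.univ : Finset σ) d ↔ ∑ i, γ i = d := by
    intro d γ
    rw [Finset.mem_finsuppAntidiag]; simp
  have hrad : p.radius = ⊤ := by
    rw [eq_top_iff]
    apply ENNReal.le_of_forall_nnreal_lt
    intro r _
    obtain ⟨M, hM⟩ := hb (2 * (r + 1)) (by positivity)
    have hM0 : 0 ≤ M := le_trans (by positivity) (hM 0)
    apply p.le_radius_of_bound (∑' γ : σ →₀ ℕ, M * ((1 : ℝ) / 2) ^ (∑ i, γ i))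
    intro d
    have h1 : ‖p d‖ ≤ ∑ γ ∈ Finset.finsuppAntidiag (Finset.univ : Finset σ) d, ‖c γ‖ := by
      refine (norm_sum_le _ _).trans (Finset.sum_le_sum fun γ _ => ?_)
      rw [norm_smul]
      exact mul_le_of_le_one_right (norm_nonneg _) (hAn d γ)
    refine (mul_le_mul_of_nonneg_right h1 (by positivity)).trans ?_
    rw [Finset.sum_mul]
    refine le_trans (Finset.sum_le_sum fun γ hγ => ?_)
      (((summable_geom σ).mul_left M).sum_le_tsum _ (fun _ _ => by positivity))
    rw [hmem] at hγ
    rw [← hγ]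
    refine le_trans ?_ (geom_bound (r := r + 1) (by positivity) (hM γ))
    apply mul_le_mul_of_nonneg_left _ (norm_nonneg _)
    exact pow_le_pow_left₀ (by positivity) (by linarith) _
  have hball : HasFPowerSeriesOnBall (fun z : σ → ℂ => ∑' γ : σ →₀ ℕ, c γ * ∏ i, z i ^ γ i) p 0 ⊤ := by
    refine ⟨hrad.ge, ENNReal.zero_lt_top, ?_⟩
    intro y _
    have h1 := (summable_of_bound hb y).hasSum.tsum_fiberwise (fun γ : σ →₀ ℕ => ∑ i, γ i)
    rw [zero_add]
    convert h1 using 2 with d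
    have hset : (fun γ : σ →₀ ℕ => ∑ i, γ i) ⁻¹' {d} =
        ((Finset.finsuppAntidiag (Finset.univ : Finset σ) d : Finset (σ →₀ ℕ)) : Set (σ →₀ ℕ)) := by
      ext γ
      rw [Finset.mem_coe, hmem]; rfl
    rw [hset, Finset.tsum_subtype' _ (fun γ : σ →₀ ℕ => c γ * ∏ i, y i ^ γ i)]
    simp only [p, ContinuousMultilinearMap.sum_apply, ContinuousMultilinearMap.smul_apply, smul_eq_mul]
    refine Finset.sum_congr rfl fun γ hγ => ?_
    rw [hA d γ ((hmem d γ).mp hγ)]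
  intro z _
  exact hball.analyticAt_of_mem (by simp)

end A
end BB


namespace BB
open Topology Metric

section A
variable {n : ℕ}

noncomputable def bw (k : ℕ) (α : Fin n →₀ ℕ) : ℂ :=
  ∏ i, ((Nat.choose k (α i) : ℂ) * (1 / (k : ℂ)) ^ α i)

theorem bw_tendsto (α : Fin n →₀ ℕ) :
    Tendsto (fun k => bw k α) atTop (𝓝 (1 / ((∏ i, Nat.factorial (α i) : ℕ) : ℂ))) := by
  have h1 : ∀ j : ℕ, Tendsto (fun k : ℕ => (Nat.choose k j : ℝ) * (1 / (k : ℝ)) ^ j) atTop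
      (𝓝 (1 ^ j / (j.factorial : ℝ))) := by
    intro j
    apply ProbabilityTheory.tendsto_choose_mul_pow_atTop
    apply tendsto_const_nhds.congr'
    filter_upwards [eventually_ge_atTop 1] with k hk
    have : (k : ℝ) ≠ 0 := by positivity
    field_simp
  have h2 : ∀ j : ℕ, Tendsto (fun k : ℕ => (Nat.choose k j : ℂ) * (1 / (k : ℂ)) ^ j) atTop
      (𝓝 (1 / (j.factorial : ℂ))) := by
    intro j
    have := (Complex.continuous_ofReal.tendsto _).comp (h1 j)
    simpa [Function.comp_def] using this
  have h3 := tendsto_finsetProd (Finset.univ : Finset (Fin n)) (fun i _ => h2 (α i))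
  simp only [bw]
  convert h3 using 2
  push_cast
  rw [Finset.prod_div_distrib]; simp

noncomputable def Ak (n k : ℕ) : Finset (Fin n →₀ ℕ) :=
  (Fintype.piFinset (fun _ : Fin n => Finset.range (k + 1))).map Finsupp.equivFunOnFinite.symm.toEmbedding

theorem bw_eq_zero {k : ℕ} {α : Fin n →₀ ℕ} (h : α ∉ Ak n k) : bw k α = 0 := by
  by_contra hne
  apply h
  rw [Ak, Finset.mem_map]
  refine ⟨α, ?_, ?_⟩
  · rw [Fintype.mem_piFinset]
    intro i
    rw [Finset.mem_range]
    by_contra hi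
    apply hne
    rw [bw]
    apply Finset.prod_eq_zero (Finset.mem_univ i)
    rw [Nat.choose_eq_zero_of_lt (by omega)]; simp
  · ext i; simp

noncomputable def ek (k : ℕ) (w : Fin n → ℂ) : MvPolynomial (Fin n) ℂ :=
  ∏ i, (C (w i / k) * X i + 1) ^ k

theorem ek_stab (k : ℕ) {w : Fin n → ℂ} (hw : w ∈ RH (Fin n)) : Stab (ek k w) := by
  intro z hz
  rw [ek, map_prod, Finset.prod_ne_zero_iff]
  intro i _
  rw [map_pow]
  rcases Nat.eq_zero_or_pos k with rfl | hk
  · simp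
  apply pow_ne_zero
  simp only [map_add, map_mul, eval_C, eval_X, map_one]
  intro h0
  have hz0 : z i ≠ 0 := fun h => by have := hz i; simp [h] at this
  have hk0 : (k : ℂ) ≠ 0 := by exact_mod_cast hk.ne'
  have h1 : w i = -(k * (z i)⁻¹) := by
    field_simp
    field_simp at h0
    linear_combination h0
  have h2 := hw i
  rw [h1] at h2
  have h3 : 0 < ((z i)⁻¹).re := by
    rw [Complex.inv_re]
    exact div_pos (hz i) (Complex.normSq_pos.mpr hz0)
  have hk' : (0 : ℝ) < k := by exact_mod_cast hk
  simp only [Complex.neg_re, Complex.mul_re, Complex.natCast_re, Complex.natCast_im, zero_mul, sub_zero] at h2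
  have := mul_pos hk' h3
  linarith

theorem ek_expand (k : ℕ) (w : Fin n → ℂ) :
    ek k w = ∑ α ∈ Ak n k, (bw k α * ∏ i, w i ^ α i) • monomial α 1 := by
  rw [ek]
  simp_rw [add_pow]
  rw [Finset.prod_univ_sum, Ak, Finset.sum_map]
  refine Finset.sum_congr rfl fun α _ => ?_
  simp only [Equiv.coe_toEmbedding, bw, Finsupp.equivFunOnFinite_symm_apply_apply]
  rw [← Finset.prod_mul_distrib, monomial_eq, Finsupp.prod_fintype _ _ (fun _ => pow_zero _), smul_eq_C_mul,
    map_prod, C_1, one_mul, ← Finset.prod_mul_distrib]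
  refine Finset.prod_congr rfl fun i _ => ?_
  simp only [Finsupp.equivFunOnFinite_symm_apply_apply, one_pow, mul_one, mul_pow, map_mul, map_pow, div_eq_mul_inv, one_mul, map_natCast]
  ring

variable (T : MvPolynomial (Fin n) ℂ →ₗ[ℂ] MvPolynomial (Fin n) ℂ)

noncomputable def Gk (k : ℕ) : MvPolynomial (Fin n ⊕ Fin n) ℂ :=
  ∑ α ∈ Ak n k, bw k α • (rename Sum.inl (T (monomial α 1)) * rename Sum.inr (monomial α (1 : ℂ)))

theorem eval_Gk (k : ℕ) (v : Fin n ⊕ Fin n → ℂ) :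
    eval v (Gk T k) = eval (fun i => v (Sum.inl i)) (T (ek k (fun i => v (Sum.inr i)))) := by
  rw [ek_expand, Gk, map_sum, map_sum, map_sum]
  refine Finset.sum_congr rfl fun α _ => ?_
  rw [T.map_smul, smul_eval, smul_eval, map_mul, eval_rename, eval_rename, eval_monomial,
    Finsupp.prod_fintype _ _ (fun _ => pow_zero _)]
  simp only [Function.comp_def]
  ring

theorem coeff_split (P : MvPolynomial (Fin n) ℂ) (α : Fin n →₀ ℕ) (γ : Fin n ⊕ Fin n →₀ ℕ) :
    coeff γ (rename Sum.inl P * rename Sum.inr (monomial α (1 : ℂ))) =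
      if α = (Finsupp.sumFinsuppEquivProdFinsupp γ).2 then
        coeff (Finsupp.sumFinsuppEquivProdFinsupp γ).1 P else 0 := by
  induction P using MvPolynomial.induction_on' with
  | monomial β c =>
    rw [rename_monomial, rename_monomial, monomial_mul, mul_one, ← Finsupp.sumElim_eq_add, coeff_monomial,
      coeff_monomial]
    have : (β.sumElim α = γ) ↔ (α = (Finsupp.sumFinsuppEquivProdFinsupp γ).2 ∧
        β = (Finsupp.sumFinsuppEquivProdFinsupp γ).1) := by
      rw [show β.sumElim α = Finsupp.sumFinsuppEquivProdFinsupp.symm (β, α) from rfl,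
        Equiv.symm_apply_eq, Prod.ext_iff]
      exact and_comm
    rw [if_congr this rfl rfl, ite_and]
  | add p q hp hq =>
    rw [map_add, add_mul, coeff_add, hp, hq, coeff_add]
    split_ifs <;> simp

theorem coeff_Gk (k : ℕ) (γ : Fin n ⊕ Fin n →₀ ℕ) :
    coeff γ (Gk T k) = bw k (Finsupp.sumFinsuppEquivProdFinsupp γ).2 *
      coeff (Finsupp.sumFinsuppEquivProdFinsupp γ).1
        (T (monomial (Finsupp.sumFinsuppEquivProdFinsupp γ).2 1)) := by
  rw [Gk, coeff_sum]
  simp only [coeff_smul, coeff_split, smul_eq_mul, mul_ite, mul_zero]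
  rw [Finset.sum_ite_eq']
  split_ifs with h
  · rfl
  · rw [bw_eq_zero h, zero_mul]

theorem caseA
    (hT : ∀ f, Stab f → T f = 0 ∨ Stab (T f))
    (hfr : ∃ᶠ k in atTop, ∀ w ∈ RH (Fin n), T (ek k w) ≠ 0) :
    ∃ F : ((Fin n ⊕ Fin n) → ℂ) → ℂ,
          (∀ v : (Fin n ⊕ Fin n) → ℂ,
            HasSum (fun α : Fin n →₀ ℕ =>
              eval (fun i => v (Sum.inl i)) (T (monomial α 1)) *
                (∏ i, v (Sum.inr i) ^ α i) / ((∏ i, Nat.factorial (α i) : ℕ) : ℂ))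
              (F v)) ∧
          AnalyticOnNhd ℂ F Set.univ ∧
          ∃ g : ℕ → MvPolynomial (Fin n ⊕ Fin n) ℂ,
            (∀ k, ∀ v : (Fin n ⊕ Fin n) → ℂ, (∀ s, 0 < (v s).re) → eval v (g k) ≠ 0) ∧
            ∀ K : Set ((Fin n ⊕ Fin n) → ℂ), IsCompact K →
              TendstoUniformlyOn (fun k v => eval v (g k)) F atTop K := by
  obtain ⟨φ, hφ, hne⟩ := extraction_of_frequently_atTop hfr
  let c : (Fin n ⊕ Fin n →₀ ℕ) → ℂ := fun γ =>
    (1 / ((∏ i, Nat.factorial ((Finsupp.sumFinsuppEquivProdFinsupp γ).2 i) : ℕ) : ℂ)) *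
      coeff (Finsupp.sumFinsuppEquivProdFinsupp γ).1
        (T (monomial (Finsupp.sumFinsuppEquivProdFinsupp γ).2 1))
  have hst : ∀ k, Stab (Gk T (φ k)) := by
    intro k v hv
    rw [eval_Gk]
    have hw : (fun i => v (Sum.inr i)) ∈ RH (Fin n) := fun i => hv _
    exact ((hT _ (ek_stab (φ k) hw)).resolve_left (hne k _ hw)) _ (fun i => hv _)
  have hc : ∀ γ, Tendsto (fun k => coeff γ (Gk T (φ k))) atTop (𝓝 (c γ)) := by
    intro γ
    simp only [coeff_Gk]
    exact ((bw_tendsto _).comp hφ.tendsto_atTop).mul_const _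
  have hb := coeff_bounds' (fun k => Gk T (φ k)) c (fun k => Or.inr (hst k)) hc (by
    intro γ hγ k
    simp only [c] at hγ
    rw [coeff_Gk]
    rcases mul_eq_zero.mp hγ with h | h
    · exfalso
      rw [one_div, inv_eq_zero, Nat.cast_eq_zero, Finset.prod_eq_zero_iff] at h
      obtain ⟨i, _, hi⟩ := h
      exact Nat.factorial_ne_zero _ hi
    · rw [h, mul_zero])
  have hcb := limit_bound hc hb
  refine ⟨fun v => ∑' γ, c γ * ∏ i, v i ^ γ i, ?_, analytic_of_bound hcb, fun k => Gk T (φ k),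
    fun k => hst k, fun K hK => uniform_limit hc hb K hK⟩
  intro v
  have h1 := (summable_of_bound hcb v).hasSum
  let E : (Fin n →₀ ℕ) × (Fin n →₀ ℕ) ≃ (Fin n ⊕ Fin n →₀ ℕ) :=
    (Equiv.prodComm _ _).trans Finsupp.sumFinsuppEquivProdFinsupp.symm
  rw [← E.hasSum_iff] at h1
  refine h1.prod_fiberwise fun α => ?_
  have h2 := (hasSum_eval (T (monomial α 1)) (fun i => v (Sum.inl i))).mul_right
    ((∏ i, v (Sum.inr i) ^ α i) / ((∏ i, Nat.factorial (α i) : ℕ) : ℂ))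
  rw [← mul_div_assoc] at h2
  refine Eq.mp (congrArg (fun f => HasSum f _) ?_) h2
  symm
  funext β
  have hE : Finsupp.sumFinsuppEquivProdFinsupp (E (α, β)) = (β, α) := by simp [E]
  have hE1 : ∀ i, E (α, β) (Sum.inl i) = β i := fun i => rfl
  have hE2 : ∀ i, E (α, β) (Sum.inr i) = α i := fun i => rfl
  simp only [Function.comp_apply, c, hE, Fintype.prod_sum_type, hE1, hE2]
  ring

end A
end BB


namespace BB
open Topology Metric

section A
variable {n : ℕ}

theorem factor_bound {a : ℂ} (ha : 0 < a.re) : ∃ C : ℝ, 0 < C ∧ ∀ z : ℂ, 0 < z.re →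
    1 + ‖z‖ ≤ C * ‖a * z + 1‖ := by
  have ha0 : a ≠ 0 := fun h => by simp [h] at ha
  have hρ : 0 < (a⁻¹).re := by
    rw [Complex.inv_re]
    exact div_pos ha (Complex.normSq_pos.mpr ha0)
  set ρ := (a⁻¹).re with hρd
  have hA : 0 < ‖a‖ := norm_pos_iff.mpr ha0
  set s := ‖a‖ * ρ with hs
  have hs0 : 0 < s := by positivity
  refine ⟨1 / s + 1 / ‖a‖ + 1 / (s * ‖a‖), by positivity, fun z hz => ?_⟩
  set q := ‖a * z + 1‖ with hq
  have h1 : s ≤ q := by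
    have e : a * z + 1 = a * (z + a⁻¹) := by field_simp
    rw [hq, e, norm_mul, hs]
    apply mul_le_mul_of_nonneg_left _ hA.le
    have := Complex.re_le_norm (z + a⁻¹)
    rw [Complex.add_re] at this
    linarith
  have h2 : ‖a‖ * ‖z‖ ≤ q + 1 := by
    rw [← norm_mul]
    have := norm_sub_le (a * z + 1) 1
    simpa using this
  have h3 : ‖z‖ ≤ (q + 1) / ‖a‖ := by rw [le_div_iff₀ hA]; linarith
  have h4 : 1 ≤ q / s := by rw [le_div_iff₀ hs0]; linarith
  have h5 : (q + 1) / ‖a‖ ≤ (q + q / s) / ‖a‖ := by gcongr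
  have h6 : (1 / s + 1 / ‖a‖ + 1 / (s * ‖a‖)) * q = q / s + (q + q / s) / ‖a‖ := by field_simp; ring
  rw [h6]; linarith

theorem ek_dominates (g : MvPolynomial (Fin n) ℂ) {k : ℕ} (hk : 1 ≤ k) (hg : g.totalDegree ≤ k)
    {w : Fin n → ℂ} (hw : w ∈ RH (Fin n)) :
    ∃ M : ℝ, 0 < M ∧ ∀ z ∈ RH (Fin n), ‖eval z g‖ ≤ M * ‖eval z (ek k w)‖ := by
  have hk' : (0 : ℝ) < k := by exact_mod_cast hk
  have hwk : ∀ i, 0 < (w i / k).re := by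
    intro i
    rw [Complex.div_natCast_re]
    exact div_pos (hw i) hk'
  choose C hC hCb using fun i => factor_bound (hwk i)
  refine ⟨(∑ α ∈ g.support, ‖coeff α g‖) * ∏ i, C i ^ k + 1, ?_, fun z hz => ?_⟩
  · have : 0 ≤ (∑ α ∈ g.support, ‖coeff α g‖) * ∏ i, C i ^ k :=
      mul_nonneg (Finset.sum_nonneg fun _ _ => norm_nonneg _)
        (Finset.prod_nonneg fun i _ => (pow_pos (hC i) k).le)
    linarith
  have h1 : ‖eval z g‖ ≤ (∑ α ∈ g.support, ‖coeff α g‖) * ∏ i, (1 + ‖z i‖) ^ k := by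
    rw [eval_eq', Finset.sum_mul]
    refine (norm_sum_le _ _).trans (Finset.sum_le_sum fun α hα => ?_)
    rw [norm_mul, norm_prod]
    apply mul_le_mul_of_nonneg_left _ (norm_nonneg _)
    apply Finset.prod_le_prod (fun _ _ => norm_nonneg _)
    intro i _
    rw [norm_pow]
    have h0 : α i ≤ k := ((monomial_le_degreeOf i hα).trans (degreeOf_le_totalDegree g i)).trans hg
    calc ‖z i‖ ^ α i ≤ (1 + ‖z i‖) ^ α i := pow_le_pow_left₀ (norm_nonneg _) (by linarith) _
      _ ≤ (1 + ‖z i‖) ^ k := pow_le_pow_right₀ (by linarith [norm_nonneg (z i)]) h0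
  have h2 : ∏ i, (1 + ‖z i‖) ^ k ≤ (∏ i, C i ^ k) * ‖eval z (ek k w)‖ := by
    rw [ek, map_prod, norm_prod, ← Finset.prod_mul_distrib]
    apply Finset.prod_le_prod (fun _ _ => by positivity)
    intro i _
    simp only [map_pow, map_add, map_mul, eval_C, eval_X, map_one, norm_pow]
    rw [← mul_pow]
    exact pow_le_pow_left₀ (by positivity) (hCb i (z i) (hz i)) _
  refine h1.trans ((mul_le_mul_of_nonneg_left h2 (Finset.sum_nonneg fun _ _ => norm_nonneg _)).trans ?_)
  rw [← mul_assoc]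
  apply mul_le_mul_of_nonneg_right _ (norm_nonneg _)
  linarith

variable (T : MvPolynomial (Fin n) ℂ →ₗ[ℂ] MvPolynomial (Fin n) ℂ)

theorem caseB_all (hT : ∀ f, Stab f → T f = 0 ∨ Stab (T f))
    (h : ∀ᶠ k in atTop, ∃ w ∈ RH (Fin n), T (ek k w) = 0) (g : MvPolynomial (Fin n) ℂ) :
    T g = 0 ∨ Stab (T g) := by
  obtain ⟨k, ⟨w, hw, hTw⟩, hk1, hkd⟩ :=
    (h.and ((eventually_ge_atTop 1).and (eventually_ge_atTop g.totalDegree))).exists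
  obtain ⟨M, hM, hMb⟩ := ek_dominates g hk1 hkd hw
  have he0 : ((1 / (2 * M) : ℝ) : ℂ) ≠ 0 := by
    rw [Complex.ofReal_ne_zero]; positivity
  set e : ℂ := ((1 / (2 * M) : ℝ) : ℂ) with he
  have hst : Stab (ek k w + e • g) := by
    intro z hz h0
    rw [map_add, smul_eval] at h0
    have h1 : ‖eval z (ek k w)‖ = ‖e‖ * ‖eval z g‖ := by
      rw [← norm_mul, eq_neg_of_add_eq_zero_left h0, norm_neg]
    have h2 : ‖e‖ = 1 / (2 * M) := by
      rw [he, Complex.norm_real, Real.norm_of_nonneg (by positivity)]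
    have h3 : 0 < ‖eval z (ek k w)‖ := norm_pos_iff.mpr (ek_stab k hw z hz)
    have h4 := mul_le_mul_of_nonneg_left (hMb z hz) (by positivity : 0 ≤ 1 / (2 * M))
    rw [← h2, ← h1, h2] at h4
    have h5 : 1 / (2 * M) * (M * ‖eval z (ek k w)‖) = ‖eval z (ek k w)‖ / 2 := by field_simp
    linarith
  have := hT _ hst
  rw [map_add, hTw, zero_add, T.map_smul] at this
  rcases this with h | h
  · left; exact (smul_eq_zero.mp h).resolve_left he0
  · right
    intro z hz h0
    apply h z hz
    rw [smul_eval, h0, mul_zero]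

theorem caseB (hall : ∀ g, T g = 0 ∨ Stab (T g)) :
    ∃ (l : MvPolynomial (Fin n) ℂ →ₗ[ℂ] ℂ) (P : MvPolynomial (Fin n) ℂ),
          Stab P ∧ ∀ f, T f = l f • P := by
  by_cases h0 : ∀ g, T g = 0
  · exact ⟨0, 1, fun z _ => by simp, fun f => by simp [h0 f]⟩
  push Not at h0
  obtain ⟨g0, hg0⟩ := h0
  have hP := (hall g0).resolve_left hg0
  let z0 : Fin n → ℂ := fun _ => 1
  have hz0 : ∀ i, 0 < (z0 i).re := fun i => by simp [z0]
  have hne := hP z0 hz0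
  refine ⟨(eval z0 (T g0))⁻¹ • ((aeval z0).toLinearMap ∘ₗ T), T g0, hP, fun f => ?_⟩
  have h1 : T ((eval z0 (T g0)) • f - (eval z0 (T f)) • g0) = 0 := by
    refine (hall _).resolve_right fun h => h z0 hz0 ?_
    rw [map_sub, T.map_smul, T.map_smul, map_sub, smul_eval, smul_eval]
    ring
  rw [map_sub, T.map_smul, T.map_smul, sub_eq_zero] at h1
  have h2 : ((eval z0 (T g0))⁻¹ • ((aeval z0).toLinearMap ∘ₗ T)) f = (eval z0 (T g0))⁻¹ * eval z0 (T f) := by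
    simp [aeval_eq_eval]
  rw [h2, mul_smul, ← h1, smul_smul, inv_mul_cancel₀ hne, one_smul]

end A
end BB


namespace BB
open Topology Metric

section A
variable {n : ℕ}

abbrev S3 (n : ℕ) := (Fin n ⊕ Fin n) ⊕ Fin n

noncomputable def lamW (z : Fin n → ℂ) (γ : S3 n →₀ ℕ) : ℂ :=
  (∏ i, if γ (Sum.inl (Sum.inr i)) = γ (Sum.inr i) then ((γ (Sum.inr i)).factorial : ℂ) else 0) *
    ∏ i, z i ^ γ (Sum.inl (Sum.inl i))

noncomputable def Lam (z : Fin n → ℂ) : MvPolynomial (S3 n) ℂ →ₗ[ℂ] ℂ :=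
  (basisMonomials (S3 n) ℂ).constr ℂ (lamW z)

theorem Lam_monomial (z : Fin n → ℂ) (γ : S3 n →₀ ℕ) (c : ℂ) :
    Lam z (monomial γ c) = c * lamW z γ := by
  have h : Lam z (monomial γ 1) = lamW z γ := by
    rw [Lam]
    have := (basisMonomials (S3 n) ℂ).constr_basis ℂ (lamW z) γ
    rwa [coe_basisMonomials] at this
  have : monomial γ c = c • monomial γ (1 : ℂ) := by rw [smul_monomial, smul_eq_mul, mul_one]
  rw [this, map_smul, h, smul_eq_mul]

theorem contr_add {σ : Type*} (m : ℕ) (i j : σ) (F G : MvPolynomial σ ℂ) :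
    contr m i j (F + G) = contr m i j F + contr m i j G := by
  simp only [contr, map_add, mul_add]
  ring

theorem lamW_step (z : Fin n → ℂ) (γ : S3 n →₀ ℕ) (i : Fin n) :
    (γ (Sum.inr i) : ℂ) * (γ (Sum.inl (Sum.inr i)) : ℂ) *
      lamW z (γ - Finsupp.single (Sum.inr i) 1 - Finsupp.single (Sum.inl (Sum.inr i)) 1) =
    (γ (Sum.inr i) : ℂ) * lamW z γ := by
  set γ' := γ - Finsupp.single (Sum.inr i) 1 - Finsupp.single (Sum.inl (Sum.inr i)) 1 with hγ'
  have hz : ∀ j, γ' (Sum.inl (Sum.inl j)) = γ (Sum.inl (Sum.inl j)) := by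
    intro j; simp [hγ']
  have hv : γ' (Sum.inr i) = γ (Sum.inr i) - 1 := by simp [hγ']
  have hw : γ' (Sum.inl (Sum.inr i)) = γ (Sum.inl (Sum.inr i)) - 1 := by simp [hγ']
  have hv' : ∀ j ≠ i, γ' (Sum.inr j) = γ (Sum.inr j) := by
    intro j hj; simp [hγ', hj.symm]
  have hw' : ∀ j ≠ i, γ' (Sum.inl (Sum.inr j)) = γ (Sum.inl (Sum.inr j)) := by
    intro j hj; simp [hγ', hj.symm]
  simp only [lamW, hz]
  rw [← Finset.mul_prod_erase Finset.univ _ (Finset.mem_univ i),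
    ← Finset.mul_prod_erase Finset.univ (fun i => if γ (Sum.inl (Sum.inr i)) = γ (Sum.inr i)
      then ((γ (Sum.inr i)).factorial : ℂ) else 0) (Finset.mem_univ i)]
  have hrest : ∏ j ∈ Finset.univ.erase i, (if γ' (Sum.inl (Sum.inr j)) = γ' (Sum.inr j)
      then ((γ' (Sum.inr j)).factorial : ℂ) else 0) = ∏ j ∈ Finset.univ.erase i,
      (if γ (Sum.inl (Sum.inr j)) = γ (Sum.inr j) then ((γ (Sum.inr j)).factorial : ℂ) else 0) := by
    refine Finset.prod_congr rfl fun j hj => ?_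
    have := Finset.ne_of_mem_erase hj
    rw [hv' j this, hw' j this]
  rw [hrest, hv, hw]
  have key : ∀ a b : ℕ, (a : ℂ) * (b : ℂ) * (if b - 1 = a - 1 then ((a - 1).factorial : ℂ) else 0) =
      (a : ℂ) * (if b = a then (a.factorial : ℂ) else 0) := by
    intro a b
    rcases a with _ | a
    · simp
    rcases b with _ | b
    · simp
    simp only [Nat.add_sub_cancel, Nat.add_right_cancel_iff]
    split_ifs with h
    · subst h; rw [Nat.factorial_succ]; push_cast; ring
    · simp
  have := key (γ (Sum.inr i)) (γ (Sum.inl (Sum.inr i)))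
  linear_combination this * ((∏ j ∈ Finset.univ.erase i,
      (if γ (Sum.inl (Sum.inr j)) = γ (Sum.inr j) then ((γ (Sum.inr j)).factorial : ℂ) else 0)) *
      ∏ i, z i ^ γ (Sum.inl (Sum.inl i)))

theorem Lam_contr (z : Fin n → ℂ) (m : ℕ) (i : Fin n) (F : MvPolynomial (S3 n) ℂ) :
    Lam z (contr m (Sum.inr i) (Sum.inl (Sum.inr i)) F) = Lam z F := by
  induction F using MvPolynomial.induction_on' with
  | add p q hp hq => rw [contr_add, map_add, map_add, hp, hq]
  | monomial γ c =>
    rw [contr, X_mul_pderiv_monomial, pderiv_monomial, C_mul_monomial, pderiv_monomial, ← Nat.cast_smul_eq_nsmul ℂ,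
      smul_monomial, C_mul_monomial, map_add, map_sub, Lam_monomial, Lam_monomial, Lam_monomial]
    have h1 : (γ - Finsupp.single (Sum.inr i) 1 : S3 n →₀ ℕ) (Sum.inl (Sum.inr i)) = γ (Sum.inl (Sum.inr i)) := by
      simp
    rw [h1]
    have := lamW_step z γ i
    simp only [smul_eq_mul]
    linear_combination (1 / (m : ℂ)) * c * this

theorem coeff_X_mul_pderiv {σ : Type*} (i : σ) (F : MvPolynomial σ ℂ) (γ : σ →₀ ℕ) :
    coeff γ (X i * pderiv i F) = γ i * coeff γ F := by
  classical
  induction F using MvPolynomial.induction_on' with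
  | add p q hp hq => rw [map_add, mul_add, coeff_add, hp, hq, coeff_add]; ring
  | monomial γ' c =>
    rw [X_mul_pderiv_monomial, coeff_smul, coeff_monomial]
    split_ifs with h
    · subst h; simp
    · simp

theorem coeff_contr {σ : Type*} (m : ℕ) (i j : σ) (F : MvPolynomial σ ℂ) (γ : σ →₀ ℕ) :
    coeff γ (contr m i j F) = (1 - (1 / m) * γ i) * coeff γ F + (1 / m) *
      (coeff (γ + Finsupp.single j 1 + Finsupp.single i 1) F *
      (((γ + Finsupp.single j 1 : σ →₀ ℕ) i : ℂ) + 1)) * (γ j + 1) := by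
  rw [contr, coeff_add, coeff_sub, coeff_C_mul, coeff_X_mul_pderiv, coeff_pderiv, coeff_C_mul, coeff_pderiv]
  ring

theorem coeff_eq_zero_of_degreeOf {σ : Type*} {F : MvPolynomial σ ℂ} {i : σ} {d : ℕ} (h : degreeOf i F ≤ d)
    {γ : σ →₀ ℕ} (hγ : d < γ i) : coeff γ F = 0 := by
  by_contra hne
  have := monomial_le_degreeOf i (mem_support_iff.mpr hne)
  omega

theorem degreeOf_contr_le {σ : Type*} {m d : ℕ} {i j l : σ} {F : MvPolynomial σ ℂ} (h : degreeOf l F ≤ d) :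
    degreeOf l (contr m i j F) ≤ d := by
  rw [degreeOf_le_iff]
  intro γ hγ
  by_contra hlt
  rw [mem_support_iff] at hγ
  apply hγ
  rw [coeff_contr, coeff_eq_zero_of_degreeOf h (by omega), coeff_eq_zero_of_degreeOf h]
  · simp
  · simp only [Finsupp.add_apply]; omega

theorem degreeOf_contr_self {σ : Type*} {m : ℕ} {i j : σ} {F : MvPolynomial σ ℂ}
    (h : degreeOf i F ≤ m + 1) : degreeOf i (contr (m + 1) i j F) ≤ m := by
  rw [degreeOf_le_iff]
  intro γ hγ
  by_contra hlt
  rw [mem_support_iff] at hγ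
  apply hγ
  have h2 : coeff (γ + Finsupp.single j 1 + Finsupp.single i 1) F = 0 := by
    apply coeff_eq_zero_of_degreeOf h
    simp only [Finsupp.add_apply, Finsupp.single_eq_same]; omega
  rw [coeff_contr, h2]
  rcases Nat.lt_or_ge (m + 1) (γ i) with h3 | h3
  · rw [coeff_eq_zero_of_degreeOf h h3]; simp
  · have : γ i = m + 1 := by omega
    rw [this]
    have : ((m + 1 : ℕ) : ℂ) ≠ 0 := by exact_mod_cast Nat.succ_ne_zero m
    rw [one_div, inv_mul_cancel₀ this]; simp

theorem reduce_one (i : Fin n) (m : ℕ) : ∀ F : MvPolynomial (S3 n) ℂ, (F = 0 ∨ Stab F) →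
    degreeOf (Sum.inr i) F ≤ m → ∃ F' : MvPolynomial (S3 n) ℂ, (F' = 0 ∨ Stab F') ∧
    (∀ z, Lam z F' = Lam z F) ∧ degreeOf (Sum.inr i) F' = 0 ∧
    ∀ j : Fin n, degreeOf (Sum.inr j) F = 0 → degreeOf (Sum.inr j) F' = 0 := by
  induction m with
  | zero => exact fun F hF hd => ⟨F, hF, fun _ => rfl, by omega, fun _ h => h⟩
  | succ m ih =>
    intro F hF hd
    obtain ⟨F', h1, h2, h3, h4⟩ := ih (contr (m + 1) (Sum.inr i) (Sum.inl (Sum.inr i)) F)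
      (contr_stab hF (Nat.succ_ne_zero m) hd) (degreeOf_contr_self hd)
    refine ⟨F', h1, fun z => by rw [h2, Lam_contr], h3, fun j hj => h4 j ?_⟩
    have := degreeOf_contr_le (m := m + 1) (i := Sum.inr i) (j := Sum.inl (Sum.inr i)) (d := 0) hj.le
    omega

theorem reduce_all (s : Finset (Fin n)) (F : MvPolynomial (S3 n) ℂ) (hF : F = 0 ∨ Stab F) :
    ∃ F' : MvPolynomial (S3 n) ℂ, (F' = 0 ∨ Stab F') ∧
    (∀ z, Lam z F' = Lam z F) ∧ ∀ j ∈ s, degreeOf (Sum.inr j) F' = 0 := by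
  induction s using Finset.induction_on with
  | empty => exact ⟨F, hF, fun _ => rfl, by simp⟩
  | insert i s _ ih =>
    obtain ⟨F1, h1, h2, h3⟩ := ih
    obtain ⟨F2, g1, g2, g3, g4⟩ := reduce_one i _ F1 h1 le_rfl
    refine ⟨F2, g1, fun z => (g2 z).trans (h2 z), fun j hj => ?_⟩
    rcases Finset.mem_insert.mp hj with rfl | hj
    · exact g3
    · exact g4 j (h3 j hj)

noncomputable def pt (e : ℂ) (z : Fin n → ℂ) : S3 n → ℂ :=
  Sum.elim (Sum.elim z (fun _ => e)) (fun _ => e)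

theorem Lam_eq_eval {F : MvPolynomial (S3 n) ℂ} (h : ∀ j : Fin n, degreeOf (Sum.inr j) F = 0) (z : Fin n → ℂ) :
    Lam z F = eval (pt 0 z) F := by
  conv_lhs => rw [F.as_sum]
  rw [map_sum, eval_eq']
  refine Finset.sum_congr rfl fun γ hγ => ?_
  rw [Lam_monomial, lamW]
  have h0 : ∀ i, γ (Sum.inr i) = 0 := by
    intro i
    have := monomial_le_degreeOf (Sum.inr i) hγ
    rw [h i] at this; omega
  simp only [h0, Fintype.prod_sum_type, pt, Sum.elim_inl, Sum.elim_inr, pow_zero, Finset.prod_const_one, mul_one,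
    Nat.factorial_zero, Nat.cast_one, zero_pow_eq]
  ring

theorem Lam_stab (F : MvPolynomial (S3 n) ℂ) (hF : F = 0 ∨ Stab F) :
    ∃ Q : MvPolynomial (Fin n) ℂ, (Q = 0 ∨ Stab Q) ∧ ∀ z, eval z Q = Lam z F := by
  obtain ⟨F', h1, h2, h3⟩ := reduce_all Finset.univ F hF
  let Q : MvPolynomial (Fin n) ℂ := aeval (Sum.elim (Sum.elim X (fun _ => 0)) (fun _ => 0)) F'
  have hQ : ∀ z, eval z Q = eval (pt 0 z) F' := by
    intro z
    have : (aeval z).comp (aeval (Sum.elim (Sum.elim X (fun _ => 0)) (fun _ => 0)) :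
      MvPolynomial (S3 n) ℂ →ₐ[ℂ] MvPolynomial (Fin n) ℂ) = aeval (pt 0 z) := by
      apply MvPolynomial.algHom_ext
      rintro ((i | i) | i) <;> simp [pt]
    have := DFunLike.congr_fun this F'
    rw [AlgHom.comp_apply] at this
    exact this
  refine ⟨Q, ?_, fun z => by rw [hQ, ← h2, Lam_eq_eval (fun j => h3 j (Finset.mem_univ j))]⟩
  rcases h1 with h1 | h1
  · left; simp [Q, h1]
  have hcont : Continuous (Function.uncurry fun (e : ℂ) (z : Fin n → ℂ) => pt e z) := by
    refine continuous_pi ?_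
    rintro ((i | i) | i) <;> simp only [Function.uncurry, pt, Sum.elim_inl, Sum.elim_inr] <;> fun_prop
  have hdiff : ∀ e : ℂ, Differentiable ℂ (fun z : Fin n → ℂ => pt e z) := by
    intro e
    rw [differentiable_pi]
    rintro ((i | i) | i) <;> simp only [pt, Sum.elim_inl, Sum.elim_inr] <;> fun_prop
  have := hurwitz_param (fun e z => eval (pt e z) F')
    ((continuous_eval' F').comp hcont)
    (fun e => (differentiable_eval F').comp (hdiff e)) (by
      intro e he z hz
      apply h1
      rintro ((i | i) | i)
      · exact hz i
      · simpa [pt] using he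
      · simpa [pt] using he)
  rcases this with h | h
  · right; intro z hz; rw [hQ]; exact h z hz
  · left; apply eq_zero_of_RH; intro z hz; rw [hQ]; exact h z hz

end A
end BB


namespace BB
open Topology Metric

section A
variable {n : ℕ}

theorem mv_cauchy {m : ℕ} {P : MvPolynomial (Fin m) ℂ} {ε : ℝ}
    (h : ∀ w : Fin m → ℂ, (∀ i, ‖w i‖ ≤ 1) → ‖eval w P‖ ≤ ε) (γ : Fin m →₀ ℕ) : ‖coeff γ P‖ ≤ ε := by
  induction m generalizing ε with
  | zero =>
    have := h 0 (fun i => by simp)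
    have hγ : γ = 0 := Subsingleton.elim _ _
    rw [eq_C_of_isEmpty P, eval_C] at this
    rw [hγ]; exact this
  | succ m ih =>
    have h1 : ∀ w : Fin m → ℂ, (∀ i, ‖w i‖ ≤ 1) → ‖eval w ((finSuccEquiv ℂ m P).coeff (γ 0))‖ ≤ ε := by
      intro w hw
      have := coeff_cauchy (Polynomial.map (eval w) (finSuccEquiv ℂ m P)) (M := ε) one_pos ?_ (γ 0)
      · rwa [Polynomial.coeff_map, one_pow, mul_one] at this
      intro t ht
      rw [← eval_eq_eval_mv_eval']
      apply h
      intro i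
      refine Fin.cases ?_ (fun i => ?_) i
      · simp [ht]
      · simpa using hw i
    have h2 := ih h1 γ.tail
    rwa [finSuccEquiv_coeff_coeff, Finsupp.cons_tail] at h2

theorem coeff_close {m : ℕ} {P : MvPolynomial (Fin m) ℂ} {a : (Fin m →₀ ℕ) → ℂ} {Φ : (Fin m → ℂ) → ℂ}
    (ha : ∀ w, HasSum (fun α : Fin m →₀ ℕ => a α * ∏ i, w i ^ α i) (Φ w)) {ε : ℝ}
    (h : ∀ w : Fin m → ℂ, (∀ i, ‖w i‖ ≤ 1) → ‖eval w P - Φ w‖ ≤ ε) (α : Fin m →₀ ℕ) :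
    ‖coeff α P - a α‖ ≤ ε := by
  classical
  have hs : Summable (fun α => ‖a α‖) := by
    have := (ha (fun _ => 1)).summable.norm
    simpa using this
  refine le_of_forall_pos_le_add fun δ hδ => ?_
  have hev := hs.hasSum.eventually (lt_mem_nhds (show (∑' α, ‖a α‖) - δ < ∑' α, ‖a α‖ by linarith))
  obtain ⟨s, hs1, hs2⟩ := (hev.and (eventually_ge_atTop {α})).exists
  have hαs : α ∈ s := hs2 (Finset.mem_singleton_self α)
  have htail : ∀ w : Fin m → ℂ, (∀ i, ‖w i‖ ≤ 1) → ‖Φ w - ∑ α ∈ s, a α * ∏ i, w i ^ α i‖ ≤ δ := by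
    intro w hw
    refine le_of_tendsto ((ha w).sub_const _).norm ?_
    filter_upwards [eventually_ge_atTop s] with s' hs'
    rw [← Finset.sum_sdiff hs', add_sub_cancel_right]
    refine (norm_sum_le _ _).trans ?_
    have h1 : ∑ α ∈ s' \ s, ‖a α * ∏ i, w i ^ α i‖ ≤ ∑ α ∈ s' \ s, ‖a α‖ := by
      refine Finset.sum_le_sum fun α _ => ?_
      rw [norm_mul]
      apply mul_le_of_le_one_right (norm_nonneg _)
      have := norm_prod_pow_le hw α
      rwa [one_pow] at this
    have h2 := hs.sum_le_tsum s' (fun _ _ => norm_nonneg _)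
    rw [← Finset.sum_sdiff hs'] at h2
    linarith
  have := mv_cauchy (P := P - ∑ α ∈ s, monomial α (a α)) (ε := ε + δ) (fun w hw => by
    have e : eval w (P - ∑ α ∈ s, monomial α (a α)) =
        (eval w P - Φ w) + (Φ w - ∑ α ∈ s, a α * ∏ i, w i ^ α i) := by
      rw [map_sub, map_sum]
      simp only [eval_monomial]
      have : ∀ α : Fin m →₀ ℕ, (α.prod fun i e => w i ^ e) = ∏ i, w i ^ α i := fun α =>
        Finsupp.prod_fintype _ _ (fun _ => pow_zero _)
      simp only [this]
      ring
    rw [e]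
    exact (norm_add_le _ _).trans (add_le_add (h w hw) (htail w hw))) α
  rw [coeff_sub, coeff_sum] at this
  simp only [coeff_monomial] at this
  rwa [Finset.sum_ite_eq' s α, if_pos hαs] at this

noncomputable def Wz (z : Fin n → ℂ) : MvPolynomial (Fin n ⊕ Fin n) ℂ →ₐ[ℂ] MvPolynomial (Fin n) ℂ :=
  aeval (Sum.elim (fun i => C (z i)) X)

theorem eval_Wz (z w : Fin n → ℂ) (G : MvPolynomial (Fin n ⊕ Fin n) ℂ) :
    eval w (Wz z G) = eval (Sum.elim z w) G := by
  have : (aeval w).comp (Wz z) = aeval (Sum.elim z w) := by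
    apply MvPolynomial.algHom_ext
    rintro (i | i) <;> simp [Wz]
  have := DFunLike.congr_fun this G
  rw [AlgHom.comp_apply] at this
  exact this

theorem Wz_monomial (z : Fin n → ℂ) (β α : Fin n →₀ ℕ) (c : ℂ) :
    Wz z (monomial (β.sumElim α) c) = monomial α (c * ∏ i, z i ^ β i) := by
  rw [Wz, aeval_monomial, Finsupp.prod_fintype _ _ (fun _ => pow_zero _), Fintype.prod_sum_type]
  simp only [Sum.elim_inl, Sum.elim_inr, Finsupp.sumElim_inl, Finsupp.sumElim_inr, algebraMap_eq]
  rw [monomial_eq, Finsupp.prod_fintype _ _ (fun _ => pow_zero _), map_mul, map_prod]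
  simp only [map_pow]
  ring

noncomputable def fac (α : Fin n →₀ ℕ) : ℂ := ((∏ i, Nat.factorial (α i) : ℕ) : ℂ)

theorem fac_ne (α : Fin n →₀ ℕ) : fac α ≠ 0 := by
  rw [fac, Nat.cast_ne_zero, Finset.prod_ne_zero_iff]
  exact fun i _ => Nat.factorial_ne_zero _

theorem Lam_prod_monomial (z : Fin n → ℂ) (G : MvPolynomial (Fin n ⊕ Fin n) ℂ) (α : Fin n →₀ ℕ) :
    Lam z (rename Sum.inl G * rename Sum.inr (monomial α (1 : ℂ))) = fac α * coeff α (Wz z G) := by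
  induction G using MvPolynomial.induction_on' with
  | add p q hp hq => rw [map_add, add_mul, map_add, hp, hq, map_add, coeff_add, mul_add]
  | monomial γ c =>
    obtain ⟨⟨β, α'⟩, rfl⟩ := Finsupp.sumFinsuppEquivProdFinsupp.symm.surjective γ
    simp only [Finsupp.sumFinsuppEquivProdFinsupp_symm_apply]
    rw [rename_monomial, rename_monomial, monomial_mul, mul_one, ← Finsupp.sumElim_eq_add, Lam_monomial,
      Wz_monomial, coeff_monomial, lamW]
    simp only [Finsupp.sumElim_inl, Finsupp.sumElim_inr]
    by_cases h : α' = α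
    · subst h
      simp only [if_true, fac]
      push_cast; ring
    · rw [if_neg h]
      obtain ⟨i, hi⟩ : ∃ i, α' i ≠ α i := by
        by_contra hcon
        push Not at hcon
        exact h (Finsupp.ext hcon)
      rw [Finset.prod_eq_zero (Finset.mem_univ i) (if_neg hi)]
      ring

theorem Lam_prod (z : Fin n → ℂ) (G : MvPolynomial (Fin n ⊕ Fin n) ℂ) (f : MvPolynomial (Fin n) ℂ) :
    Lam z (rename Sum.inl G * rename Sum.inr f) =
      ∑ α ∈ f.support, coeff α f * (fac α * coeff α (Wz z G)) := by
  conv_lhs => rw [f.as_sum]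
  rw [map_sum, Finset.mul_sum, map_sum]
  refine Finset.sum_congr rfl fun α _ => ?_
  have : monomial α (coeff α f) = (coeff α f) • monomial α (1 : ℂ) := by
    rw [smul_monomial, smul_eq_mul, mul_one]
  rw [this, map_smul, mul_smul_comm, map_smul, Lam_prod_monomial, smul_eq_mul]

variable (T : MvPolynomial (Fin n) ℂ →ₗ[ℂ] MvPolynomial (Fin n) ℂ)

theorem eval_T (f : MvPolynomial (Fin n) ℂ) (z : Fin n → ℂ) :
    eval z (T f) = ∑ α ∈ f.support, coeff α f * eval z (T (monomial α 1)) := by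
  conv_lhs => rw [f.as_sum]
  rw [map_sum, map_sum]
  refine Finset.sum_congr rfl fun α _ => ?_
  have : monomial α (coeff α f) = (coeff α f) • monomial α (1 : ℂ) := by
    rw [smul_monomial, smul_eq_mul, mul_one]
  rw [this, T.map_smul, smul_eval]

theorem backward {F : ((Fin n ⊕ Fin n) → ℂ) → ℂ}
    (hF : ∀ v : (Fin n ⊕ Fin n) → ℂ,
            HasSum (fun α : Fin n →₀ ℕ =>
              eval (fun i => v (Sum.inl i)) (T (monomial α 1)) *
                (∏ i, v (Sum.inr i) ^ α i) / ((∏ i, Nat.factorial (α i) : ℕ) : ℂ))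
              (F v))
    {g : ℕ → MvPolynomial (Fin n ⊕ Fin n) ℂ} (hg : ∀ k, Stab (g k))
    (hlim : ∀ K : Set ((Fin n ⊕ Fin n) → ℂ), IsCompact K →
              TendstoUniformlyOn (fun k v => eval v (g k)) F atTop K)
    {f : MvPolynomial (Fin n) ℂ} (hf : Stab f) : T f = 0 ∨ Stab (T f) := by
  have hst : ∀ k, Stab (rename Sum.inl (g k) * rename Sum.inr f : MvPolynomial (S3 n) ℂ) := by
    intro k v hv
    rw [map_mul, eval_rename, eval_rename]
    exact mul_ne_zero (hg k _ fun i => hv _) (hf _ fun i => hv _)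
  choose Q hQ hQe using fun k => Lam_stab _ (Or.inr (hst k))
  have hunif : ∀ K : Set (Fin n → ℂ), IsCompact K →
      TendstoUniformlyOn (fun k z => eval z (Q k)) (fun z => eval z (T f)) atTop K := by
    intro K hK
    rw [Metric.tendstoUniformlyOn_iff]
    intro ε hε
    set A : ℝ := ∑ α ∈ f.support, ‖coeff α f‖ * ‖fac α‖ with hA
    have hA0 : 0 ≤ A := Finset.sum_nonneg fun _ _ => by positivity
    have hcont : Continuous (fun p : (Fin n → ℂ) × (Fin n → ℂ) => (Sum.elim p.1 p.2 : Fin n ⊕ Fin n → ℂ)) := by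
      refine continuous_pi ?_
      rintro (i | i) <;> simp only [Sum.elim_inl, Sum.elim_inr] <;> fun_prop
    have hK' := (hK.prod (isCompact_closedBall (0 : Fin n → ℂ) 1)).image hcont
    have hu := Metric.tendstoUniformlyOn_iff.mp (hlim _ hK') (ε / (A + 1)) (by positivity)
    filter_upwards [hu] with k hk z hz
    have hclose : ∀ α, ‖coeff α (Wz z (g k)) - eval z (T (monomial α 1)) / fac α‖ ≤ ε / (A + 1) := by
      intro α
      refine coeff_close (a := fun α => eval z (T (monomial α 1)) / fac α)
        (Φ := fun w => F (Sum.elim z w)) (fun w => ?_) (fun w hw => ?_) α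
      · refine Eq.mp (congrArg (fun f => HasSum f _) ?_) (hF (Sum.elim z w))
        funext α
        simp only [Sum.elim_inl, Sum.elim_inr, fac]
        ring
      · rw [eval_Wz, ← dist_eq_norm, dist_comm]
        refine (hk _ ⟨(z, w), ⟨hz, ?_⟩, rfl⟩).le
        rw [mem_closedBall_zero_iff]
        exact (pi_norm_le_iff_of_nonneg zero_le_one).mpr hw
    rw [dist_comm, dist_eq_norm, hQe, Lam_prod, eval_T, ← Finset.sum_sub_distrib]
    have hle : ‖∑ α ∈ f.support, (coeff α f * (fac α * coeff α (Wz z (g k))) -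
        coeff α f * eval z (T (monomial α 1)))‖ ≤ A * (ε / (A + 1)) := by
      rw [hA, Finset.sum_mul]
      refine (norm_sum_le _ _).trans (Finset.sum_le_sum fun α _ => ?_)
      have e : coeff α f * (fac α * coeff α (Wz z (g k))) - coeff α f * eval z (T (monomial α 1)) =
        (coeff α f * fac α) * (coeff α (Wz z (g k)) - eval z (T (monomial α 1)) / fac α) := by
        have := fac_ne α
        field_simp
      rw [e, norm_mul, norm_mul]
      exact mul_le_mul_of_nonneg_left (hclose α) (by positivity)
    refine hle.trans_lt ?_
    rw [mul_div_assoc', div_lt_iff₀ (by positivity)]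
    nlinarith
  by_cases hfr : ∃ᶠ k in atTop, Q k = 0
  · left
    apply eq_zero_of_RH
    intro z _
    have h1 := (hunif {z} isCompact_singleton).tendsto_at (Set.mem_singleton z)
    exact isClosed_singleton.mem_of_frequently_of_tendsto
      (hfr.mono fun k hk => by rw [hk, map_zero]; rfl) h1
  · rw [not_frequently] at hfr
    obtain ⟨N, hN⟩ := eventually_atTop.mp hfr
    rcases hurwitz (l := atTop) (fun k z => eval z (Q (k + N))) (fun z => eval z (T f))
      (fun k => differentiable_eval _) (fun K _ hK => shift_unif (hunif K hK) N)
      (fun k z hz => ((hQ (k + N)).resolve_left (hN _ (by omega))) z hz) with h | h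
    · exact Or.inr h
    · exact Or.inl (eq_zero_of_RH h)

end A
end BB


/-- **Classification of `ℍ_{π/2}`-stability preservers on `ℂ[z₁,…,zₙ]`** (`ℍ_{π/2}`
the open right half-plane). A linear operator `T` on `ℂ[z₁,…,zₙ]` preserves
`ℍ_{π/2}`-stability if and only if either (a) `T(f) = α(f) P` with `P` an
`ℍ_{π/2}`-stable polynomial, or (b) the transcendental symbol
`T[e^{z·w}] = ∑_α T(z^α) w^α / α!` converges on all of `ℂ^{2n}` to an entire function
which is the limit, uniformly on compact subsets of `ℂ^{2n}`, of `ℍ_{π/2}`-stable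
polynomials in the `2n` variables `z` (indexed by `Sum.inl`) and `w` (indexed by
`Sum.inr`). -/
theorem stability_preserver_classification_right_halfplane (n : ℕ)
    (T : MvPolynomial (Fin n) ℂ →ₗ[ℂ] MvPolynomial (Fin n) ℂ) :
    (∀ f : MvPolynomial (Fin n) ℂ,
        (∀ z : Fin n → ℂ, (∀ i, 0 < (z i).re) → eval z f ≠ 0) →
        T f = 0 ∨ ∀ z : Fin n → ℂ, (∀ i, 0 < (z i).re) → eval z (T f) ≠ 0) ↔
      ((∃ (l : MvPolynomial (Fin n) ℂ →ₗ[ℂ] ℂ) (P : MvPolynomial (Fin n) ℂ),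
          (∀ z : Fin n → ℂ, (∀ i, 0 < (z i).re) → eval z P ≠ 0) ∧
          ∀ f, T f = l f • P) ∨
        (∃ F : ((Fin n ⊕ Fin n) → ℂ) → ℂ,
          (∀ v : (Fin n ⊕ Fin n) → ℂ,
            HasSum (fun α : Fin n →₀ ℕ =>
              eval (fun i => v (Sum.inl i)) (T (monomial α 1)) *
                (∏ i, v (Sum.inr i) ^ α i) / ((∏ i, Nat.factorial (α i) : ℕ) : ℂ))
              (F v)) ∧
          AnalyticOnNhd ℂ F Set.univ ∧
          ∃ g : ℕ → MvPolynomial (Fin n ⊕ Fin n) ℂ,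
            (∀ k, ∀ v : (Fin n ⊕ Fin n) → ℂ, (∀ s, 0 < (v s).re) → eval v (g k) ≠ 0) ∧
            ∀ K : Set ((Fin n ⊕ Fin n) → ℂ), IsCompact K →
              TendstoUniformlyOn (fun k v => eval v (g k)) F atTop K)) := by
  constructor
  · intro hT
    by_cases hfr : ∃ᶠ k in atTop, ∀ w ∈ BB.RH (Fin n), T (BB.ek k w) ≠ 0
    · exact Or.inr (BB.caseA T hT hfr)
    · left
      rw [not_frequently] at hfr
      apply BB.caseB T
      apply BB.caseB_all T hT
      filter_upwards [hfr] with k hk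
      push Not at hk
      exact hk
  · rintro (⟨l, P, hP, hl⟩ | ⟨F, hF, _, g, hg, hlim⟩) f hf
    · by_cases h0 : l f = 0
      · left; rw [hl, h0, zero_smul]
      · right
        intro z hz
        rw [hl, smul_eval]
        exact mul_ne_zero h0 (hP z hz)
    · exact BB.backward T hF hg hlim hf
end

section
/- Let {P_i}_{i=1}^m and {Q_i}_{i=1}^m be polynomials in ℂ[u₁,…,uₙ] and ℂ[v₁,…,vₙ] respectively, and set R(u,v) = Σ_{i=1}^m P_i(u)Q_i(v), a polynomial in 2n variables, and S(z) = Σ_{i=1}^m P_i(∂/∂z)Q_i(z), where P_i(∂/∂z) is the constant-coefficient differential operator obtained by substituting ∂/∂z_j for the j-th variable of P_i. If R is ℍ_{π/2}-stable as a polynomial in 2n variables (i.e., R(u,v) ≠ 0 whenever Re(u_j) > 0 and Re(v_j) > 0 for all j), then S is either ℍ_{π/2}-stable or identically zero. -/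
open MvPolynomial

/-- The iterated partial derivative `∂^α = ∂^{|α|}/∂z₁^{α₁}⋯∂zₙ^{αₙ}`,
as a linear endomorphism of the polynomial ring. -/
noncomputable def pdPow {n : ℕ} (α : Fin n →₀ ℕ) :
    Module.End ℂ (MvPolynomial (Fin n) ℂ) :=
  (List.ofFn fun i : Fin n => ((pderiv i : Derivation ℂ (MvPolynomial (Fin n) ℂ)
      (MvPolynomial (Fin n) ℂ)).toLinearMap) ^ (α i)).prod

/-- The differential operator `P(∂/∂z)` applied to `Q`: if `P = ∑_α c_α u^α` then
`P(∂/∂z) Q = ∑_α c_α ∂^α Q`. -/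
noncomputable def diffOp {n : ℕ} (P Q : MvPolynomial (Fin n) ℂ) :
    MvPolynomial (Fin n) ℂ :=
  ∑ α ∈ P.support, P.coeff α • pdPow α Q

open Filter Topology

/-- Hurwitz near a zero, one complex variable, with parameters. -/
lemma hurwitz_one {X Y : Type*} [TopologicalSpace X] {l : Filter Y} [l.NeBot]
    (g : X → ℂ → ℂ) (hg : Continuous (Function.uncurry g)) (hd : ∀ x, Differentiable ℂ (g x))
    (a : Y → X) (x0 : X) (ha : Tendsto a l (𝓝 x0)) (r : ℝ) (hr : 0 < r)
    (hne : ∀ᶠ y in l, ∀ t ∈ Metric.ball (0 : ℂ) r, g (a y) t ≠ 0) (h0 : g x0 0 = 0) :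
    ∀ t, g x0 t = 0 := by
  have han : AnalyticOnNhd ℂ (g x0) Set.univ := fun t _ => (hd x0).analyticAt t
  rcases (han 0 trivial).eventually_eq_zero_or_eventually_ne_zero with h | h
  · intro t
    exact han.eqOn_zero_of_preconnected_of_eventuallyEq_zero isPreconnected_univ trivial h trivial
  · exfalso
    rw [eventually_nhdsWithin_iff, Metric.eventually_nhds_iff] at h
    obtain ⟨e, he, h⟩ := h
    set ρ := min e r / 2 with hρ
    have hm : 0 < min e r := lt_min he hr
    have hρ0 : 0 < ρ := by positivity
    have hρe : ρ < e := by have := min_le_left e r; linarith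
    have hρr : ρ < r := by have := min_le_right e r; linarith
    have hcs : IsCompact (Metric.sphere (0 : ℂ) ρ) := isCompact_sphere _ _
    have hns : (Metric.sphere (0 : ℂ) ρ).Nonempty := NormedSpace.sphere_nonempty.2 hρ0.le
    obtain ⟨t0, ht0, hmin⟩ := hcs.exists_isMinOn hns ((hd x0).continuous.norm.continuousOn)
    have hpos : 0 < ‖g x0 t0‖ := by
      rw [norm_pos_iff]
      have : ‖t0‖ = ρ := by simpa using ht0
      apply h
      · simpa [this] using hρe
      · simp only [Set.mem_compl_iff, Set.mem_singleton_iff]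
        rintro rfl
        simp at this
        linarith
    set m := ‖g x0 t0‖
    have hev : ∀ᶠ x in 𝓝 x0, ∀ t ∈ Metric.sphere (0 : ℂ) ρ, m / 2 < ‖g x t‖ := by
      apply hcs.eventually_forall_of_forall_eventually
      intro t ht
      have hc : ContinuousAt (fun z : X × ℂ => ‖g z.1 z.2‖) (x0, t) := hg.norm.continuousAt
      have h1 : m ≤ ‖g x0 t‖ := hmin ht
      exact hc.eventually (lt_mem_nhds (show m / 2 < ‖g x0 t‖ by linarith))
    have hev0 : ∀ᶠ x in 𝓝 x0, ‖g x 0‖ < m / 2 := by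
      have hc : Continuous (fun x : X => ‖g x 0‖) :=
        (hg.comp (by fun_prop : Continuous fun x : X => (x, (0 : ℂ)))).norm
      exact hc.continuousAt.eventually (gt_mem_nhds (show ‖g x0 0‖ < m / 2 by rw [h0]; simpa using hpos))
    obtain ⟨y, hy1, hy2, hy3⟩ := (hne.and ((ha.eventually hev).and (ha.eventually hev0))).exists
    have hz : ∀ t ∈ Metric.closedBall (0 : ℂ) ρ, g (a y) t ≠ 0 := fun t ht =>
      hy1 t (Metric.closedBall_subset_ball hρr ht)
    have hdc : DiffContOnCl ℂ (fun t => (g (a y) t)⁻¹) (Metric.ball 0 ρ) := by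
      apply DifferentiableOn.diffContOnCl
      rw [closure_ball _ hρ0.ne']
      exact fun t ht => ((hd (a y)) t).differentiableWithinAt.inv (hz t ht)
    have := Complex.norm_le_of_forall_mem_frontier_norm_le Metric.isBounded_ball hdc
      (C := (m / 2)⁻¹) (z := 0) (by
        intro t ht
        rw [frontier_ball _ hρ0.ne'] at ht
        rw [norm_inv]
        exact inv_anti₀ (by positivity) (hy2 t ht).le) (subset_closure (by simpa using hρ0))
    rw [norm_inv] at this
    have h3 : 0 < ‖g (a y) 0‖ := norm_pos_iff.2 (hz 0 (by simpa using hρ0.le))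
    have := (inv_le_inv₀ h3 (by positivity)).1 this
    linarith

/-- Points of the product of right half-planes. -/
def RHP {σ : Type*} (z : σ → ℂ) : Prop := ∀ k, 0 < (z k).re

lemma hurwitz_multi {σ X Y : Type*} [Fintype σ] [TopologicalSpace X] {l : Filter Y} [l.NeBot]
    (g : X → (σ → ℂ) → ℂ) (hg : Continuous (Function.uncurry g))
    (hd : ∀ x, Differentiable ℂ (g x))
    (a : Y → X) (x0 : X) (ha : Tendsto a l (𝓝 x0))
    (hne : ∀ᶠ y in l, ∀ z, RHP z → g (a y) z ≠ 0) :
    (∀ z, RHP z → g x0 z = 0) ∨ (∀ z, RHP z → g x0 z ≠ 0) := by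
  by_contra! hcon
  obtain ⟨⟨z1, hz1, hz1'⟩, z0, hz0, hz0'⟩ := hcon
  let L : ℂ → σ → ℂ := fun t => z0 + t • (z1 - z0)
  have hL : Continuous L := by fun_prop
  have hLd : Differentiable ℂ L := by fun_prop
  have hop : ∀ᶠ t in 𝓝 (0 : ℂ), RHP (L t) := by
    simp only [RHP]
    rw [eventually_all]
    intro k
    have : Continuous fun t => (L t k).re := by fun_prop
    exact this.continuousAt.eventually (lt_mem_nhds (by simpa [L] using hz0 k))
  obtain ⟨r, hr, hop⟩ := Metric.eventually_nhds_iff_ball.1 hop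
  have := hurwitz_one (l := l) (fun x t => g x (L t))
    (by
      have : Continuous fun p : X × ℂ => (p.1, L p.2) := by fun_prop
      exact hg.comp this)
    (fun x => (hd x).comp hLd) a x0 ha r hr
    (by filter_upwards [hne] with y hy t ht using hy _ (hop t ht))
    (by simpa [L] using hz0') 1
  exact hz1' (by simpa [L] using this)

lemma mv_differentiable {σ : Type*} [Fintype σ] (f : MvPolynomial σ ℂ) :
    Differentiable ℂ (fun z => eval z f) := by
  induction f using MvPolynomial.induction_on with
  | C a => simp
  | add p q hp hq =>
    simp only [map_add]
    exact hp.add hq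
  | mul_X p i hp =>
    simp only [map_mul, eval_X]
    exact hp.mul (differentiable_apply i)

lemma mv_zero_of_rhp {σ : Type*} [Finite σ] (f : MvPolynomial σ ℂ)
    (h : ∀ z, RHP z → eval z f = 0) : f = 0 := by
  apply MvPolynomial.funext_set (fun _ : σ => {t : ℂ | 0 < t.re})
  · intro _
    have : Function.Injective (fun n : ℕ => ((n : ℂ) + 1)) := by
      intro a b hab; simpa using hab
    refine (Set.infinite_range_of_injective this).mono ?_
    rintro _ ⟨n, rfl⟩
    simp
    positivity
  · intro x hx
    rw [map_zero]
    exact h x fun k => hx k trivial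

/-- Logarithmic derivative, one variable. -/
lemma logderiv_one (q : Polynomial ℂ) (hq : ∀ t : ℂ, 0 < t.re → q.eval t ≠ 0) (t : ℂ)
    (ht : 0 < t.re) :
    (q.derivative.eval t = 0) ∨ 0 < (q.derivative.eval t / q.eval t).re := by
  rw [or_iff_not_imp_left]
  intro hne
  rw [(IsAlgClosed.splits q).eval_derivative_div_eval_of_ne_zero (hq t ht)]
  have hpos : ∀ r ∈ q.roots, 0 < (1 / (t - r)).re := by
    intro r hr
    have h1 : r.re ≤ 0 := by
      by_contra! hc
      exact hq r hc (Polynomial.isRoot_of_mem_roots hr)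
    have h2 : 0 < (t - r).re := by simp; linarith
    rw [one_div, Complex.inv_re]
    apply div_pos h2
    rw [Complex.normSq_pos]
    intro h0
    rw [h0] at h2
    simp at h2
  have hr : q.roots ≠ 0 := by
    intro h0
    apply hne
    have := (IsAlgClosed.splits q).natDegree_eq_card_roots
    rw [h0] at this
    rw [Polynomial.derivative_of_natDegree_zero (by simpa using this)]
    simp
  have key : ∀ s : Multiset ℂ, (∀ r ∈ s, 0 < (1 / (t - r)).re) → s ≠ 0 →
      0 < ((s.map fun r => 1 / (t - r)).sum).re := by
    intro s
    induction s using Multiset.induction_on with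
    | empty => simp
    | cons b s ih =>
      intro h _
      rw [Multiset.map_cons, Multiset.sum_cons, Complex.add_re]
      have h1 := h b (by simp)
      by_cases hs : s = 0
      · simpa [hs] using h1
      · have := ih (fun r hr => h r (by simp [hr])) hs
        linarith
  exact key _ hpos hr

lemma logderiv_mv {σ : Type*} [DecidableEq σ] (f : MvPolynomial σ ℂ)
    (hf : ∀ z, RHP z → eval z f ≠ 0) (j : σ) (z : σ → ℂ) (hz : RHP z) :
    eval z (pderiv j f) = 0 ∨ 0 < (eval z (pderiv j f) / eval z f).re := by
  let φ : σ → Polynomial ℂ := fun k => if k = j then Polynomial.X else Polynomial.C (z k)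
  have hev : ∀ (p : MvPolynomial σ ℂ) (t : ℂ),
      (aeval φ p).eval t = eval (Function.update z j t) p := by
    intro p t
    induction p using MvPolynomial.induction_on with
    | C a => simp
    | add p q hp hq => simp [hp, hq]
    | mul_X p i hp =>
      simp only [map_mul, Polynomial.eval_mul, hp, aeval_X, eval_X]
      by_cases h : i = j <;> simp [φ, h]
  have hder : ∀ (p : MvPolynomial σ ℂ), (aeval φ p).derivative = aeval φ (pderiv j p) := by
    intro p
    induction p using MvPolynomial.induction_on with
    | C a => simp
    | add p q hp hq => simp [hp, hq]
    | mul_X p i hp =>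
      by_cases h : i = j
      · subst h
        simp [Derivation.leibniz, hp, φ]
        ring
      · simp [Derivation.leibniz, hp, φ, h, pderiv_X_of_ne h]
        ring
  have := logderiv_one (aeval φ f) (by
    intro t ht
    rw [hev]
    apply hf
    intro k
    by_cases h : k = j
    · subst h; simpa using ht
    · simpa [h] using hz k) (z j) (hz j)
  rw [hder, hev, hev, Function.update_eq_self] at this
  exact this

/-- `1 + ε ∂ᵢ∂ⱼ` preserves stability. -/
lemma stable_step {σ : Type*} [DecidableEq σ] [Fintype σ] (f : MvPolynomial σ ℂ)
    (hf : ∀ z, RHP z → eval z f ≠ 0) (i j : σ) (ε : ℝ) (hε : 0 < ε) :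
    ∀ z, RHP z → eval z (f + (ε : ℂ) • pderiv i (pderiv j f)) ≠ 0 := by
  intro z hz
  have hB : (∀ z, RHP z → eval z (pderiv j f) = 0) ∨ (∀ z, RHP z → eval z (pderiv j f) ≠ 0) := by
    have := hurwitz_multi (σ := σ) (X := ℝ) (l := 𝓝[>] (0 : ℝ))
      (fun δ z => eval z (pderiv j f) + (δ : ℂ) * eval z f)
      (by
        have h1 := MvPolynomial.continuous_eval f
        have h2 := MvPolynomial.continuous_eval (pderiv j f)
        simp only [Function.uncurry_def]
        fun_prop)
      (fun δ => (mv_differentiable _).add ((mv_differentiable f).const_mul _))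
      id 0 (tendsto_id.mono_left nhdsWithin_le_nhds)
      (by
        filter_upwards [self_mem_nhdsWithin] with δ hδ w hw h0
        have hδ : 0 < δ := hδ
        have hfw := hf w hw
        have h1 : eval w (pderiv j f) / eval w f = -(δ : ℂ) := by
          rw [div_eq_iff hfw]
          simp only [id] at h0
          linear_combination h0
        rcases logderiv_mv f hf j w hw with h2 | h2
        · simp [h2] at h1
          exact hδ.ne' h1
        · rw [h1] at h2
          simp at h2
          linarith)
    simpa using this
  rcases hB with hB | hB
  · rw [mv_zero_of_rhp _ hB]
    simpa using hf z hz
  · have hBz := hB z hz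
    have hfz := hf z hz
    have h1 := (logderiv_mv f hf j z hz).resolve_left hBz
    have h1' : 0 < (eval z f / eval z (pderiv j f)).re := by
      rw [← inv_div, Complex.inv_re]
      apply div_pos h1
      rw [Complex.normSq_pos]
      exact div_ne_zero hBz hfz
    have h2 : 0 ≤ (eval z (pderiv i (pderiv j f)) / eval z (pderiv j f)).re := by
      rcases logderiv_mv _ hB i z hz with h | h
      · simp [h]
      · exact h.le
    intro h0
    have h3 : eval z f / eval z (pderiv j f) +
        (ε : ℂ) * (eval z (pderiv i (pderiv j f)) / eval z (pderiv j f)) = 0 := by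
      field_simp
      rw [map_add, smul_eval] at h0
      rw [mul_zero]
      exact h0
    have h4 := congrArg Complex.re h3
    rw [Complex.add_re, Complex.re_ofReal_mul, Complex.zero_re] at h4
    have := mul_nonneg hε.le h2
    linarith

/-- Stable or zero, on the product of right half-planes. -/
def SZ {σ : Type*} (f : MvPolynomial σ ℂ) : Prop :=
  (∀ z, RHP z → eval z f = 0) ∨ (∀ z, RHP z → eval z f ≠ 0)

/-- The operator `∂ᵢ∂ⱼ`. -/
noncomputable def DD {σ : Type*} (i j : σ) : Module.End ℂ (MvPolynomial σ ℂ) :=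
  (pderiv i).toLinearMap * (pderiv j).toLinearMap

lemma DD_apply {σ : Type*} (i j : σ) (f : MvPolynomial σ ℂ) :
    DD i j f = pderiv i (pderiv j f) := rfl

lemma stable_pow {σ : Type*} [DecidableEq σ] [Fintype σ] (f : MvPolynomial σ ℂ)
    (hf : ∀ z, RHP z → eval z f ≠ 0) (i j : σ) (ε : ℝ) (hε : 0 < ε) (N : ℕ) :
    ∀ z, RHP z → eval z (((1 + (ε : ℂ) • DD i j) ^ N) f) ≠ 0 := by
  induction N with
  | zero => simpa using hf
  | succ N ih =>
    rw [pow_succ']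
    exact stable_step _ ih i j ε hε

lemma choose_tendsto (k : ℕ) :
    Tendsto (fun N : ℕ => ((N.choose k : ℂ) * (((1 / (N : ℝ) : ℝ) : ℂ)) ^ k)) atTop
      (𝓝 (1 / (k.factorial : ℂ))) := by
  have h1 : Tendsto (fun N : ℕ => ((N.choose k : ℝ) * (1 / (N : ℝ)) ^ k)) atTop
      (𝓝 (1 / (k.factorial : ℝ))) := by
    have h := isEquivalent_choose k
    have h2 := h.mul (Asymptotics.IsEquivalent.refl (u := fun N : ℕ => (1 / (N : ℝ)) ^ k))
    refine h2.symm.tendsto_nhds ?_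
    apply tendsto_const_nhds.congr'
    filter_upwards [eventually_gt_atTop 0] with N hN
    have : (N : ℝ) ≠ 0 := by positivity
    simp only [Pi.mul_apply]
    rw [div_mul_eq_mul_div, ← mul_pow, mul_one_div_cancel this, one_pow]
  have h2 := (Complex.continuous_ofReal.tendsto _).comp h1
  refine (h2.congr ?_).trans_eq ?_
  · intro N; simp
  · simp

lemma exp_stable {σ : Type*} [DecidableEq σ] [Fintype σ] (f : MvPolynomial σ ℂ)
    (hf : SZ f) (i j : σ) (K : ℕ) (hK : ∀ k, K ≤ k → ((DD i j) ^ k) f = 0) :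
    SZ (∑ k ∈ Finset.range K, (1 / (k.factorial : ℂ)) • ((DD i j) ^ k) f) := by
  rcases hf with hf | hf
  · left
    rw [mv_zero_of_rhp f hf]
    simp
  have := hurwitz_multi (σ := σ) (X := ℕ → ℂ) (l := (atTop : Filter ℕ))
    (fun a z => ∑ k ∈ Finset.range K, a k * eval z (((DD i j) ^ k) f))
    (by
      have h2 := fun k => MvPolynomial.continuous_eval (((DD i j) ^ k) f)
      simp only [Function.uncurry_def]
      fun_prop)
    (fun a => by
      have h2 := fun k => mv_differentiable (((DD i j) ^ k) f)
      fun_prop)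
    (fun N k => ((N.choose k : ℂ) * (((1 / (N : ℝ) : ℝ) : ℂ)) ^ k))
    (fun k => 1 / (k.factorial : ℂ))
    (tendsto_pi_nhds.2 choose_tendsto)
    (by
      filter_upwards [eventually_ge_atTop (K + 1)] with N hN z hz
      have hpos : (0 : ℝ) < 1 / (N : ℝ) := by
        have : 0 < N := by omega
        positivity
      have h := stable_pow f hf i j (1 / (N : ℝ)) hpos N z hz
      convert h using 1
      rw [add_comm, (Commute.one_right _).add_pow]
      simp only [one_pow, mul_one, smul_pow, LinearMap.sum_apply, map_sum]
      rw [← Finset.sum_subset (Finset.range_subset_range.2 (by omega : K ≤ N + 1))]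
      · apply Finset.sum_congr rfl
        intro k hk
        rw [← nsmul_eq_mul', LinearMap.smul_apply, LinearMap.smul_apply, map_nsmul, smul_eval,
          nsmul_eq_mul]
        ring
      · intro k _ hk
        rw [← nsmul_eq_mul', LinearMap.smul_apply, LinearMap.smul_apply, hK k (by simpa using hk)]
        simp)
  simpa [SZ, map_sum, smul_eval] using this

lemma sub_stable {σ : Type*} [DecidableEq σ] [Fintype σ] (f G : MvPolynomial σ ℂ)
    (hf : SZ f) (i : σ) (hG : ∀ z, eval z G = eval (Function.update z i 0) f) : SZ G := by
  rcases hf with hf | hf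
  · left
    intro z _
    rw [hG, mv_zero_of_rhp f hf, map_zero]
  have := hurwitz_multi (σ := σ) (X := ℝ) (l := 𝓝[>] (0 : ℝ))
    (fun δ z => eval (Function.update z i (δ : ℂ)) f)
    (by
      have h1 := MvPolynomial.continuous_eval f
      have h2 : Continuous fun p : ℝ × (σ → ℂ) => Function.update p.2 i (p.1 : ℂ) :=
        continuous_snd.update i (Complex.continuous_ofReal.comp continuous_fst)
      exact h1.comp h2)
    (fun δ => (mv_differentiable f).comp (by
      rw [differentiable_pi]
      intro k
      by_cases h : k = i
      · subst h; simp
      · simpa [h] using differentiable_apply k))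
    id 0 (tendsto_id.mono_left nhdsWithin_le_nhds)
    (by
      filter_upwards [self_mem_nhdsWithin] with δ hδ w hw
      have hδ : 0 < δ := hδ
      apply hf
      intro k
      by_cases h : k = i
      · subst h; simpa using hδ
      · simpa [h] using hw k)
  simpa [SZ, hG] using this

/-- The generator `u^t Q(v)`. -/
noncomputable def MM {n : ℕ} (t : Fin n → ℕ) (Q : MvPolynomial (Fin n) ℂ) :
    MvPolynomial (Fin n ⊕ Fin n) ℂ :=
  (∏ k, X (Sum.inl k) ^ t k) * rename Sum.inr Q

lemma pderiv_inl_rename {n : ℕ} (j : Fin n) (Q : MvPolynomial (Fin n) ℂ) :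
    pderiv (Sum.inl j : Fin n ⊕ Fin n) (rename Sum.inr Q) = 0 := by
  induction Q using MvPolynomial.induction_on with
  | C a => simp
  | add p q hp hq => simp [hp, hq]
  | mul_X p i hp => simp [Derivation.leibniz, hp, pderiv_X_of_ne]

lemma pderiv_prod_zero {σ ι : Type*} (s : Finset ι) (g : ι → MvPolynomial σ ℂ) (i : σ)
    (h : ∀ k ∈ s, pderiv i (g k) = 0) : pderiv i (∏ k ∈ s, g k) = 0 := by
  classical
  induction s using Finset.induction_on with
  | empty => simp
  | insert a s ha ih =>
    rw [Finset.prod_insert ha, Derivation.leibniz, h a (by simp),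
      ih fun k hk => h k (by simp [hk])]
    simp

lemma DD_pow_MM {n : ℕ} (j : Fin n) (a : ℕ) (c : MvPolynomial (Fin n ⊕ Fin n) ℂ)
    (hc1 : pderiv (Sum.inl j) c = 0) (hc2 : pderiv (Sum.inr j) c = 0)
    (Q : MvPolynomial (Fin n) ℂ) (k : ℕ) :
    ((DD (Sum.inl j) (Sum.inr j)) ^ k) (X (Sum.inl j) ^ a * c * rename Sum.inr Q) =
      (a.descFactorial k : MvPolynomial (Fin n ⊕ Fin n) ℂ) * (X (Sum.inl j) ^ (a - k) * c *
        rename Sum.inr (((pderiv j : Derivation ℂ (MvPolynomial (Fin n) ℂ)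
      (MvPolynomial (Fin n) ℂ)).toLinearMap ^ k) Q)) := by
  induction k with
  | zero => simp
  | succ k ih =>
    rw [pow_succ', Module.End.mul_apply, ih, DD_apply, pow_succ', Module.End.mul_apply]
    generalize ((pderiv j : Derivation ℂ (MvPolynomial (Fin n) ℂ)
      (MvPolynomial (Fin n) ℂ)).toLinearMap ^ k) Q = W
    have hX : pderiv (Sum.inr j : Fin n ⊕ Fin n)
        (X (Sum.inl j) : MvPolynomial (Fin n ⊕ Fin n) ℂ) = 0 := pderiv_X_of_ne (by simp)
    have hX' : pderiv (Sum.inl j : Fin n ⊕ Fin n)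
        (X (Sum.inl j) : MvPolynomial (Fin n ⊕ Fin n) ℂ) = 1 := pderiv_X_self _
    have h1 := pderiv_rename (R := ℂ) (Sum.inr_injective (α := Fin n)) j W
    have h2 := pderiv_inl_rename j (pderiv j W)
    rw [Nat.descFactorial_succ]
    simp only [Derivation.leibniz, Derivation.leibniz_pow, hX, hX', h1, h2, hc1, hc2,
      Derivation.map_natCast, smul_eq_mul, mul_zero, smul_zero, add_zero, zero_add,
      nsmul_eq_mul, mul_one]
    simp only [Derivation.coeFn_coe, Nat.sub_sub]
    push_cast
    ring

lemma step {n : ℕ} {ι : Type*} (s : Finset ι) (t : ι → Fin n → ℕ)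
    (Q : ι → MvPolynomial (Fin n) ℂ) (j : Fin n) (h : SZ (∑ x ∈ s, MM (t x) (Q x))) :
    SZ (∑ x ∈ s, MM (Function.update (t x) j 0)
      (((pderiv j : Derivation ℂ (MvPolynomial (Fin n) ℂ)
      (MvPolynomial (Fin n) ℂ)).toLinearMap ^ (t x j)) (Q x))) := by
  let c : ι → MvPolynomial (Fin n ⊕ Fin n) ℂ := fun x =>
    ∏ k ∈ Finset.univ.erase j, X (Sum.inl k) ^ t x k
  have hM : ∀ x Q, MM (t x) Q = X (Sum.inl j) ^ (t x j) * c x * rename Sum.inr Q := by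
    intro x Q
    rw [MM, ← Finset.mul_prod_erase Finset.univ _ (Finset.mem_univ j)]
  have hM' : ∀ x Q, MM (Function.update (t x) j 0) Q = c x * rename Sum.inr Q := by
    intro x Q
    rw [MM, ← Finset.mul_prod_erase Finset.univ _ (Finset.mem_univ j)]
    simp only [Function.update_self, pow_zero, one_mul, c]
    congr 1
    apply Finset.prod_congr rfl
    intro k hk
    rw [Function.update_of_ne (Finset.ne_of_mem_erase hk)]
  have hc1 : ∀ x, pderiv (Sum.inl j) (c x) = 0 := by
    intro x
    apply pderiv_prod_zero
    intro k hk
    rw [Derivation.leibniz_pow, pderiv_X_of_ne (by simpa using (Finset.ne_of_mem_erase hk))]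
    simp
  have hc2 : ∀ x, pderiv (Sum.inr j) (c x) = 0 := by
    intro x
    apply pderiv_prod_zero
    intro k hk
    rw [Derivation.leibniz_pow, pderiv_X_of_ne (by simp)]
    simp
  set K := s.sup (fun x => t x j) + 1 with hKdef
  have hlt : ∀ x ∈ s, t x j < K := fun x hx =>
    Nat.lt_succ_of_le (Finset.le_sup (f := fun x => t x j) hx)
  have hD : ∀ k, ((DD (Sum.inl j) (Sum.inr j)) ^ k) (∑ x ∈ s, MM (t x) (Q x)) =
      ∑ x ∈ s, ((t x j).descFactorial k : MvPolynomial (Fin n ⊕ Fin n) ℂ) *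
        (X (Sum.inl j) ^ (t x j - k) * c x *
        rename Sum.inr (((pderiv j : Derivation ℂ (MvPolynomial (Fin n) ℂ)
      (MvPolynomial (Fin n) ℂ)).toLinearMap ^ k) (Q x))) := by
    intro k
    rw [map_sum]
    apply Finset.sum_congr rfl
    intro x _
    rw [hM, DD_pow_MM j _ _ (hc1 x) (hc2 x)]
  have h1 := exp_stable _ h (Sum.inl j) (Sum.inr j) K (by
    intro k hk
    rw [hD]
    apply Finset.sum_eq_zero
    intro x hx
    rw [Nat.descFactorial_eq_zero_iff_lt.2 ((hlt x hx).trans_le hk)]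
    simp)
  refine sub_stable _ _ h1 (Sum.inl j) ?_
  intro z
  simp only [hD, hM', map_sum, smul_eval]
  simp only [Finset.mul_sum]
  rw [Finset.sum_comm]
  apply Finset.sum_congr rfl
  intro x hx
  have hcz : eval (Function.update z (Sum.inl j) 0) (c x) = eval z (c x) := by
    simp only [c, map_prod, map_pow, eval_X]
    apply Finset.prod_congr rfl
    intro k hk
    rw [Function.update_of_ne (by simpa using (Finset.ne_of_mem_erase hk))]
  have hrz : ∀ W : MvPolynomial (Fin n) ℂ,
      eval (Function.update z (Sum.inl j) 0) (rename Sum.inr W) = eval z (rename Sum.inr W) := by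
    intro W
    rw [eval_rename, eval_rename]
    congr 1
  rw [Finset.sum_eq_single (t x j)]
  · simp only [map_mul, map_natCast, map_pow, hcz, hrz, Nat.descFactorial_self, Nat.sub_self,
      pow_zero, one_mul]
    have : ((t x j).factorial : ℂ) ≠ 0 := by exact_mod_cast (Nat.factorial_ne_zero _)
    field_simp
  · intro k _ hk
    rcases lt_or_gt_of_ne hk with hk | hk
    · simp only [map_mul, map_pow, eval_X, Function.update_self]
      rw [zero_pow (by omega)]
      simp
    · rw [Nat.descFactorial_eq_zero_iff_lt.2 hk]
      simp
  · intro hn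
    exact absurd (Finset.mem_range.2 (hlt x hx)) hn

lemma steps {n : ℕ} {ι : Type*} (s : Finset ι) (t : ι → Fin n → ℕ)
    (Q : ι → MvPolynomial (Fin n) ℂ) (h : SZ (∑ x ∈ s, MM (t x) (Q x))) (l : List (Fin n))
    (hl : l.Nodup) :
    SZ (∑ x ∈ s, MM (fun k => if k ∈ l then 0 else t x k)
      ((l.map fun i => (pderiv i : Derivation ℂ (MvPolynomial (Fin n) ℂ)
      (MvPolynomial (Fin n) ℂ)).toLinearMap ^ (t x i)).prod (Q x))) := by
  induction l with
  | nil => simpa using h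
  | cons j l ih =>
    rw [List.nodup_cons] at hl
    have := step s _ _ j (ih hl.2)
    convert this using 3 with x hx
    · funext k
      by_cases hk : k = j
      · subst hk; simp
      · simp [hk]
    · simp [hl.1]

/-- **Lieb–Sokal lemma.** If `R(u,v) = ∑_i P_i(u) Q_i(v)` is `ℍ_{π/2}`-stable in the `2n`
variables `(u,v)`, then `S(z) = ∑_i P_i(∂/∂z) Q_i(z)` is `ℍ_{π/2}`-stable or zero. -/
theorem lieb_sokal (n m : ℕ) (P Q : Fin m → MvPolynomial (Fin n) ℂ)
    (hR : ∀ u v : Fin n → ℂ, (∀ k, 0 < (u k).re) → (∀ k, 0 < (v k).re) →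
      ∑ i, eval u (P i) * eval v (Q i) ≠ 0) :
    (∑ i, diffOp (P i) (Q i)) = 0 ∨
      ∀ z : Fin n → ℂ, (∀ k, 0 < (z k).re) → eval z (∑ i, diffOp (P i) (Q i)) ≠ 0 := by
  classical
  let s : Finset (Σ _ : Fin m, (Fin n →₀ ℕ)) := Finset.univ.sigma fun i => (P i).support
  have hPQ : ∀ u v : Fin n → ℂ, eval (Sum.elim u v)
      (∑ x ∈ s, MM (fun k => x.2 k) ((P x.1).coeff x.2 • Q x.1)) =
      ∑ i, eval u (P i) * eval v (Q i) := by
    intro u v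
    rw [Finset.sum_sigma, map_sum]
    apply Finset.sum_congr rfl
    intro i _
    rw [map_sum, eval_eq', Finset.sum_mul]
    apply Finset.sum_congr rfl
    intro α _
    simp only [MM, map_mul, map_prod, map_pow, eval_X, Sum.elim_inl, eval_rename, Sum.elim_comp_inr,
      smul_eval]
    ring
  have h0 : SZ (∑ x ∈ s, MM (fun k => x.2 k) ((P x.1).coeff x.2 • Q x.1)) := by
    right
    intro z hz
    have := hPQ (z ∘ Sum.inl) (z ∘ Sum.inr)
    rw [Sum.elim_comp_inl_inr] at this
    rw [this]
    exact hR _ _ (fun k => hz _) (fun k => hz _)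
  have h1 := steps s _ _ h0 (List.finRange n) (List.nodup_finRange n)
  have h2 : (∑ x ∈ s, MM (fun k => if k ∈ List.finRange n then 0 else x.2 k)
      (((List.finRange n).map fun i => (pderiv i : Derivation ℂ (MvPolynomial (Fin n) ℂ)
      (MvPolynomial (Fin n) ℂ)).toLinearMap ^ (x.2 i)).prod ((P x.1).coeff x.2 • Q x.1))) =
      rename Sum.inr (∑ i, diffOp (P i) (Q i)) := by
    rw [Finset.sum_sigma, map_sum]
    apply Finset.sum_congr rfl
    intro i _
    rw [diffOp, map_sum]
    apply Finset.sum_congr rfl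
    intro α _
    simp only [MM, List.mem_finRange, if_true, pow_zero, Finset.prod_const_one, one_mul]
    rw [map_smul, pdPow, List.ofFn_eq_map]
  rw [h2] at h1
  have h3 : ∀ z : Fin n → ℂ, (∀ k, 0 < (z k).re) → RHP (Sum.elim z z) := by
    rintro z hz (k | k) <;> exact hz k
  rcases h1 with h1 | h1
  · left
    apply mv_zero_of_rhp
    intro z hz
    simpa [eval_rename] using h1 _ (h3 z hz)
  · right
    intro z hz
    have := h1 _ (h3 z hz)
    rwa [eval_rename, Sum.elim_comp_inr] at this
end

section
/- Let κ ∈ ℕⁿ, θ ∈ [0,2π), and let f, g ∈ ℂ[z₁,…,zₙ,w₁,…,wₙ] satisfy deg_{z_j}(f) ≤ κ_j and deg_{w_j}(g) ≤ κ_j for all j, so that f(z,w) = Σ_{α≤κ} binom(κ,α) P_α(w) z^α and g(z,w) = Σ_{α≤κ} binom(κ,α) Q_α(z) w^α for unique polynomials P_α ∈ ℂ[w₁,…,wₙ] and Q_α ∈ ℂ[z₁,…,zₙ]. If f and g are both ℍ_θ-stable (as polynomials in 2n variables), then the polynomial Σ_{α≤κ} binom(κ,α) P_α(w) Q_{κ−α}(z),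 which equals (1/κ!) Σ_{α≤κ} (∂^α f/∂z^α)(0,w) · (∂^{κ−α} g/∂w^{κ−α})(z,0), is either ℍ_θ-stable in the 2n variables z₁,…,zₙ,w₁,…,wₙ or identically zero. -/
open MvPolynomial

/-- The multinomial coefficient `binom(κ,α) = ∏_i binom(κ_i, α_i)` as a complex number. -/
def binomC {n : ℕ} (κ α : Fin n →₀ ℕ) : ℂ :=
  ((∏ i, (κ i).choose (α i) : ℕ) : ℂ)

/-- The open half-plane `ℍ_θ = {ζ : Im (e^{iθ} ζ) > 0}`. -/
def Htheta (θ : ℝ) : Set ℂ :=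
  {ζ : ℂ | 0 < (Complex.exp (θ * Complex.I) * ζ).im}

namespace MC

lemma im_inv_neg {z : ℂ} (hz : 0 < z.im) : (1 / z).im < 0 := by
  have : z ≠ 0 := by rintro rfl; simp at hz
  have h2 := Complex.normSq_pos.mpr this
  rw [one_div, Complex.inv_im]
  exact div_neg_of_neg_of_pos (by linarith) h2

lemma logder (p : Polynomial ℂ) (x : ℂ) (hx : p.eval x ≠ 0) :
    p.derivative.eval x = p.eval x * (p.roots.map fun r => 1 / (x - r)).sum := by
  rw [← Polynomial.Splits.eval_derivative_div_eval_of_ne_zero (IsAlgClosed.splits p) hx]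
  field_simp

lemma root_im {p : Polynomial ℂ} (h : ∀ x : ℂ, 0 < x.im → p.eval x ≠ 0) {r : ℂ}
    (hr : r ∈ p.roots) : r.im ≤ 0 := by
  by_contra hc
  exact h r (not_le.mp hc) (Polynomial.isRoot_of_mem_roots hr)

lemma im_sum_nonpos (m : Multiset ℂ) (h : ∀ z ∈ m, z.im ≤ 0) : m.sum.im ≤ 0 := by
  induction m using Multiset.induction_on with
  | empty => simp
  | cons a m ih =>
    simp only [Multiset.sum_cons, Complex.add_im]
    have := h a (by simp)
    have := ih (fun z hz => h z (by simp [hz]))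
    linarith

lemma im_sum_ge (m : Multiset ℂ) (h : ∀ z ∈ m, 0 ≤ z.im) : 0 ≤ m.sum.im := by
  induction m using Multiset.induction_on with
  | empty => simp
  | cons a m ih =>
    simp only [Multiset.sum_cons, Complex.add_im]
    have := h a (by simp)
    have := ih (fun z hz => h z (by simp [hz]))
    linarith

/-- Gauss–Lucas type step. -/
lemma gl (p : Polynomial ℂ) (h : ∀ x : ℂ, 0 < x.im → p.eval x ≠ 0) (ε : ℝ) (hε : 0 < ε)
    (t : ℂ) (ht : 0 < t.im) :
    p.derivative.eval t - ε * Complex.I * p.eval t ≠ 0 := by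
  have h0 := h t ht
  rw [logder p t h0]
  intro hc
  have hc' : p.eval t * ((p.roots.map fun r => 1 / (t - r)).sum - ε * Complex.I) = 0 := by
    linear_combination hc
  have h1 := (mul_eq_zero.mp hc').resolve_left h0
  have h2 : ((p.roots.map fun r => 1 / (t - r)).sum).im ≤ 0 := by
    apply im_sum_nonpos
    intro z hz
    obtain ⟨r, hr, rfl⟩ := Multiset.mem_map.mp hz
    have := root_im h hr
    exact (im_inv_neg (by simp; linarith)).le
  have h3 := congrArg Complex.im h1
  simp at h3
  simp at h2
  linarith

lemma key_im (x s r : ℂ) (hx : 0 < x.im) (hs : 0 < s.im) (hr : r.im ≤ 0) :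
    0 < ((x - (starRingEnd ℂ) s) * (1 + (s - x) * (1 / (x - r)))).im := by
  have hne : x - r ≠ 0 := by
    intro hc
    have := congrArg Complex.im hc
    simp at this; linarith
  have hN := Complex.normSq_pos.mpr hne
  have e : (x - (starRingEnd ℂ) s) * (1 + (s - x) * (1 / (x - r)))
      = (x - (starRingEnd ℂ) s) * (s - r) * (starRingEnd ℂ) (x - r) * ((Complex.normSq (x - r))⁻¹ : ℝ) := by
    have : (1 / (x - r)) = (starRingEnd ℂ) (x - r) * ((Complex.normSq (x - r))⁻¹ : ℝ) := by
      rw [one_div, Complex.inv_def]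
    have h1 : (1 : ℂ) = (x - r) * ((starRingEnd ℂ) (x - r) * ((Complex.normSq (x - r))⁻¹ : ℝ)) := by
      rw [← this]; field_simp
    rw [this]
    linear_combination (x - (starRingEnd ℂ) s) * h1
  rw [e, Complex.im_mul_ofReal]
  apply mul_pos _ (inv_pos.mpr hN)
  simp only [Complex.mul_im, Complex.mul_re, Complex.sub_re, Complex.sub_im, Complex.conj_re,
    Complex.conj_im, map_sub]
  obtain ⟨x1, X⟩ := x
  obtain ⟨s1, S⟩ := s
  obtain ⟨r1, R⟩ := r
  simp only at *
  have h1 : 0 < (X + S) * ((S - R) * (X - R)) :=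
    mul_pos (by linarith) (mul_pos (by linarith) (by linarith))
  have h2 := mul_nonneg (sq_nonneg (x1 - r1)) hs.le
  have h3 := mul_nonneg (sq_nonneg (s1 - r1)) hx.le
  have h4 := mul_nonneg (sq_nonneg (x1 - s1)) (neg_nonneg.mpr hr)
  nlinarith

/-- Laguerre. -/
lemma laguerre (p : Polynomial ℂ) (h : ∀ x : ℂ, 0 < x.im → p.eval x ≠ 0) (k : ℕ) (hk : 1 ≤ k)
    (hd : p.natDegree ≤ k) (x s : ℂ) (hx : 0 < x.im) (hs : 0 < s.im) :
    k * p.eval x + (s - x) * p.derivative.eval x ≠ 0 := by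
  have h0 := h x hx
  rw [logder p x h0]
  intro hc
  have hc' : p.eval x * (k + (s - x) * (p.roots.map fun r => 1 / (x - r)).sum) = 0 := by
    linear_combination hc
  have h1 := (mul_eq_zero.mp hc').resolve_left h0
  have hcard : p.roots.card ≤ k := (Polynomial.card_roots' p).trans hd
  have main : ∀ m : Multiset ℂ, (∀ r ∈ m, r.im ≤ 0) → ∀ k : ℕ, m.card ≤ k → (1 ≤ k) →
      0 < ((x - (starRingEnd ℂ) s) * (k + (s - x) * (m.map fun r => 1 / (x - r)).sum)).im := by
    intro m
    have hb : 0 < (x - (starRingEnd ℂ) s).im := by simp; linarith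
    induction m using Multiset.induction_on with
    | empty =>
      intro _ k _ hk
      simp only [Multiset.map_zero, Multiset.sum_zero, mul_zero, add_zero]
      have : (0 : ℝ) < k := by exact_mod_cast hk
      rw [← Complex.ofReal_natCast, Complex.im_mul_ofReal]
      exact mul_pos hb this
    | cons a m ih =>
      intro hm k hcard hk
      obtain ⟨j, rfl⟩ : ∃ j, k = j + 1 := ⟨k - 1, by omega⟩
      have ha := key_im x s a hx hs (hm a (by simp))
      have e : (x - (starRingEnd ℂ) s) * (((j + 1 : ℕ) : ℂ) + (s - x) * ((a ::ₘ m).map fun r => 1 / (x - r)).sum)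
        = (x - (starRingEnd ℂ) s) * (1 + (s - x) * (1 / (x - a))) +
          (x - (starRingEnd ℂ) s) * (j + (s - x) * (m.map fun r => 1 / (x - r)).sum) := by
        simp only [Multiset.map_cons, Multiset.sum_cons]; push_cast; ring
      rw [e, Complex.add_im]
      simp only [Multiset.card_cons] at hcard
      by_cases hj : 1 ≤ j
      · have := ih (fun r hr => hm r (by simp [hr])) j (by omega) hj
        linarith
      · have hj0 : j = 0 := by omega
        have hm0 : m = 0 := by rw [← Multiset.card_eq_zero]; omega
        subst hj0 hm0
        simpa using ha
  have := main p.roots (fun r hr => root_im h hr) k hcard hk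
  rw [h1] at this
  simp at this

/-- Laguerre in coefficient form. -/
lemma laguerre' {ι : Type*} (S : Finset ι) (c : ι → ℂ) (α : ι → ℕ) (k : ℕ)
    (hα : ∀ i ∈ S, c i ≠ 0 → α i ≤ k + 1)
    (h : ∀ x : ℂ, 0 < x.im → ∑ i ∈ S, c i * x ^ α i ≠ 0) (x s : ℂ) (hx : 0 < x.im) (hs : 0 < s.im) :
    ∑ i ∈ S, c i * ((((k + 1 : ℂ) - α i) / (k + 1)) * x ^ α i
      + (α i / (k + 1 : ℂ)) * s * x ^ (α i - 1)) ≠ 0 := by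
  set p : Polynomial ℂ := ∑ i ∈ S, Polynomial.C (c i) * Polynomial.X ^ α i with hp
  have hev : ∀ x, p.eval x = ∑ i ∈ S, c i * x ^ α i := by
    intro x; simp [hp, Polynomial.eval_finsetSum]
  have hder : p.derivative.eval x = ∑ i ∈ S, c i * (α i * x ^ (α i - 1)) := by
    simp [hp, Polynomial.eval_finsetSum, Polynomial.derivative_X_pow]
  have hdeg : p.natDegree ≤ k + 1 := by
    apply Polynomial.natDegree_sum_le_of_forall_le
    intro i hi
    by_cases hc : c i = 0
    · simp [hc]
    · exact (Polynomial.natDegree_C_mul_X_pow_le _ _).trans (hα i hi hc)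
  have hk : (k + 1 : ℂ) ≠ 0 := by exact_mod_cast Nat.succ_ne_zero k
  have := laguerre p (fun x hx => by rw [hev]; exact h x hx) (k + 1) (by omega) hdeg x s hx hs
  intro hc
  apply this
  push_cast
  rw [hev, hder, Finset.mul_sum, Finset.mul_sum, ← Finset.sum_add_distrib]
  rw [← mul_zero (k + 1 : ℂ), ← hc, Finset.mul_sum]
  apply Finset.sum_congr rfl
  intro i _
  rcases Nat.eq_zero_or_pos (α i) with h0 | h0
  · rw [h0]; push_cast; field_simp; ring
  · obtain ⟨a, ha⟩ : ∃ a, α i = a + 1 := ⟨α i - 1, by omega⟩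
    rw [ha]; rw [Nat.add_sub_cancel]; push_cast
    field_simp; ring

/-- The regularised weights. -/
noncomputable def ew : ℕ → ℝ → ℕ → ℕ → ℂ
  | 0, _, _, _ => 1
  | k + 1, ε, a, b =>
      (((k + 1 : ℂ) - a) / (k + 1)) * (((k + 1 : ℂ) - b) / (k + 1)) * (-(ε * Complex.I)) * ew k ε a b
      + (a / (k + 1 : ℂ)) * (((k + 1 : ℂ) - b) / (k + 1)) * (1 + ε ^ 2) * ew k ε (a - 1) b
      + (((k + 1 : ℂ) - a) / (k + 1)) * (b / (k + 1 : ℂ)) * (1 + ε ^ 2) * ew k ε a (b - 1)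
      + (a / (k + 1 : ℂ)) * (b / (k + 1 : ℂ)) * (2 * ε * Complex.I + ε ^ 3 * Complex.I)
        * ew k ε (a - 1) (b - 1)

lemma ew_cont (k a b : ℕ) : Continuous fun ε => ew k ε a b := by
  induction k generalizing a b with
  | zero => simp only [ew]; fun_prop
  | succ k ih =>
    have h1 := ih a b
    have h2 := ih (a - 1) b
    have h3 := ih a (b - 1)
    have h4 := ih (a - 1) (b - 1)
    simp only [ew]
    fun_prop

lemma ew_zero (k a b : ℕ) (ha : a ≤ k) (hb : b ≤ k) :
    ew k 0 a b = if a + b = k then 1 / (k.choose a : ℂ) else 0 := by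
  induction k generalizing a b with
  | zero =>
    obtain rfl : a = 0 := by omega
    obtain rfl : b = 0 := by omega
    simp [ew]
  | succ k ih =>
    have hk : (k + 1 : ℂ) ≠ 0 := by exact_mod_cast Nat.succ_ne_zero k
    have e1 : (a / (k + 1 : ℂ)) * (((k + 1 : ℂ) - b) / (k + 1)) * ew k 0 (a - 1) b
        = if a + b = k + 1 then (a / (k + 1 : ℂ)) * (1 / ((k + 1).choose a : ℂ)) else 0 := by
      rcases Nat.eq_zero_or_pos a with h0 | h0
      · simp [h0]
      obtain ⟨a, rfl⟩ : ∃ j, a = j + 1 := ⟨a - 1, by omega⟩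
      by_cases hb' : b = k + 1
      · subst hb'
        simp
      rw [Nat.add_sub_cancel, ih a b (by omega) (by omega)]
      by_cases hs : a + b = k
      · rw [if_pos hs, if_pos (by omega)]
        have hc : ((k + 1 : ℂ)) * (k.choose a) = (k + 1).choose (a + 1) * (a + 1) := by
          exact_mod_cast Nat.add_one_mul_choose_eq k a
        have n1 : ((k.choose a : ℕ) : ℂ) ≠ 0 := by
          exact_mod_cast (Nat.choose_pos (by omega)).ne'
        have n2 : (((k+1).choose (a+1) : ℕ) : ℂ) ≠ 0 := by
          exact_mod_cast (Nat.choose_pos (by omega)).ne'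
        have hk' : (k : ℂ) = a + b := by exact_mod_cast hs.symm
        push_cast
        field_simp
        rw [hk'] at hc ⊢
        linear_combination -hc
      · rw [if_neg hs, if_neg (by omega), mul_zero]
    have e2 : (((k + 1 : ℂ) - a) / (k + 1)) * (b / (k + 1 : ℂ)) * ew k 0 a (b - 1)
        = if a + b = k + 1 then (b / (k + 1 : ℂ)) * (1 / ((k + 1).choose a : ℂ)) else 0 := by
      rcases Nat.eq_zero_or_pos b with h0 | h0
      · simp [h0]
      obtain ⟨b, rfl⟩ : ∃ j, b = j + 1 := ⟨b - 1, by omega⟩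
      by_cases ha' : a = k + 1
      · subst ha'
        simp
      rw [Nat.add_sub_cancel, ih a b (by omega) (by omega)]
      by_cases hs : a + b = k
      · rw [if_pos hs, if_pos (by omega)]
        have hc : ((k + 1 : ℂ)) * (k.choose a) = (k + 1).choose a * (b + 1) := by
          have := Nat.add_one_mul_choose_eq k b
          have h1 : k.choose b = k.choose a := by
            rw [← hs, Nat.choose_symm_add]
          have h2 : (k+1).choose (b+1) = (k+1).choose a :=
            Nat.choose_symm_of_eq_add (by omega)
          rw [h1, h2] at this
          exact_mod_cast this
        have n1 : ((k.choose a : ℕ) : ℂ) ≠ 0 := by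
          exact_mod_cast (Nat.choose_pos (by omega)).ne'
        have n2 : (((k+1).choose a : ℕ) : ℂ) ≠ 0 := by
          exact_mod_cast (Nat.choose_pos (by omega)).ne'
        have hk' : (k : ℂ) = a + b := by exact_mod_cast hs.symm
        push_cast
        field_simp
        rw [hk'] at hc ⊢
        linear_combination -hc
      · rw [if_neg hs, if_neg (by omega), mul_zero]
    have : ew (k + 1) 0 a b = (a / (k + 1 : ℂ)) * (((k + 1 : ℂ) - b) / (k + 1)) * ew k 0 (a - 1) b
       + (((k + 1 : ℂ) - a) / (k + 1)) * (b / (k + 1 : ℂ)) * ew k 0 a (b - 1) := by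
      simp [ew]
    rw [this, e1, e2]
    split_ifs with hs
    · have : (a : ℂ) + b = k + 1 := by exact_mod_cast hs
      rw [← add_mul, ← add_div, this, div_self hk, one_mul]
    · simp

theorem ew_ne {ι : Type} (S : Finset ι) (c : ι → ℂ) (α β : ι → ℕ) (k : ℕ) (ε : ℝ) (hε : 0 < ε)
    (hα : ∀ i ∈ S, c i ≠ 0 → α i ≤ k) (hβ : ∀ i ∈ S, c i ≠ 0 → β i ≤ k)
    (h : ∀ x y : ℂ, 0 < x.im → 0 < y.im → ∑ i ∈ S, c i * (x ^ α i * y ^ β i) ≠ 0) :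
    ∑ i ∈ S, c i * ew k ε (α i) (β i) ≠ 0 := by
  induction k generalizing ι with
  | zero =>
    have := h Complex.I Complex.I (by simp) (by simp)
    convert this using 1
    apply Finset.sum_congr rfl
    intro i hi
    by_cases hc : c i = 0
    · simp [hc]
    · have h1 := hα i hi hc
      have h2 := hβ i hi hc
      simp [ew, Nat.le_zero.mp h1, Nat.le_zero.mp h2]
  | succ k ih =>
    have s1 : ∀ x y s : ℂ, 0 < x.im → 0 < y.im → 0 < s.im →
        ∑ i ∈ S, c i * y ^ β i * ((((k + 1 : ℂ) - α i) / (k + 1)) * x ^ α i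
          + (α i / (k + 1 : ℂ)) * s * x ^ (α i - 1)) ≠ 0 := by
      intro x y s hx hy hs
      apply laguerre' S (fun i => c i * y ^ β i) α k _ _ x s hx hs
      · intro i hi hc
        exact hα i hi (left_ne_zero_of_mul hc)
      · intro x hx
        convert h x y hx hy using 1
        apply Finset.sum_congr rfl; intros; ring
    have s2 : ∀ x y s r : ℂ, 0 < x.im → 0 < y.im → 0 < s.im → 0 < r.im →
        ∑ i ∈ S, c i * ((((k + 1 : ℂ) - α i) / (k + 1)) * x ^ α i
          + (α i / (k + 1 : ℂ)) * s * x ^ (α i - 1)) * ((((k + 1 : ℂ) - β i) / (k + 1)) * y ^ β i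
          + (β i / (k + 1 : ℂ)) * r * y ^ (β i - 1)) ≠ 0 := by
      intro x y s r hx hy hs hr
      apply laguerre' S (fun i => c i * ((((k + 1 : ℂ) - α i) / (k + 1)) * x ^ α i
          + (α i / (k + 1 : ℂ)) * s * x ^ (α i - 1))) β k _ _ y r hy hr
      · intro i hi hc
        exact hβ i hi (left_ne_zero_of_mul hc)
      · intro y hy
        convert s1 x y s hx hy hs using 1
        apply Finset.sum_congr rfl; intros; ring
    let Ac : ι → ℂ := fun i => (((k + 1 : ℂ) - α i) / (k + 1))
    let A : ι → ℂ := fun i => (α i / (k + 1 : ℂ))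
    let Bc : ι → ℂ := fun i => (((k + 1 : ℂ) - β i) / (k + 1))
    let B : ι → ℂ := fun i => (β i / (k + 1 : ℂ))
    have s3 : ∀ x y : ℂ, 0 < x.im → 0 < y.im →
        ∑ i ∈ S, (c i * (Ac i * Bc i * (-(ε * Complex.I))) * (x ^ α i * y ^ β i)
         + c i * (A i * Bc i * (1 + ε ^ 2)) * (x ^ (α i - 1) * y ^ β i)
         + c i * (Ac i * B i * (1 + ε ^ 2)) * (x ^ α i * y ^ (β i - 1))
         + c i * (A i * B i * (2 * ε * Complex.I + ε ^ 3 * Complex.I)) * (x ^ (α i - 1) * y ^ (β i - 1))) ≠ 0 := by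
      intro x y hx hy
      let q : Polynomial ℂ := ∑ i ∈ S, Polynomial.C (c i) *
        ((Polynomial.C (Ac i * x ^ α i) + Polynomial.C (A i * x ^ (α i - 1)) * Polynomial.X) *
        (Polynomial.C (Bc i * y ^ β i) + Polynomial.C (B i * y ^ (β i - 1)) * Polynomial.X))
      have hq : ∀ t : ℂ, 0 < t.im → q.eval t ≠ 0 := by
        intro t ht
        convert s2 x y t t hx hy ht ht using 1
        simp only [q, Polynomial.eval_finsetSum, Polynomial.eval_mul, Polynomial.eval_add, Polynomial.eval_C, Polynomial.eval_X]
        apply Finset.sum_congr rfl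
        intro i _
        simp only [A, Ac, B, Bc]
        ring
      have := gl q hq ε hε (ε * Complex.I) (by simpa using hε)
      convert this using 1
      simp only [q, Polynomial.derivative_sum, Polynomial.eval_finsetSum, Polynomial.eval_mul, Polynomial.eval_add, Polynomial.eval_C, Polynomial.eval_X, Polynomial.derivative_mul, Polynomial.derivative_add, Polynomial.derivative_C, Polynomial.derivative_X, Polynomial.eval_zero, Polynomial.eval_one, Finset.mul_sum]
      rw [← Finset.sum_sub_distrib]
      apply Finset.sum_congr rfl
      intro i _
      have hI : Complex.I ^ 2 = -1 := Complex.I_sq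
      have hI3 : Complex.I ^ 3 = -Complex.I := by rw [pow_succ, hI]; ring
      ring_nf
      rw [hI3, hI]
      ring
    have hAz : ∀ i ∈ S, c i ≠ 0 → Ac i ≠ 0 → α i ≤ k := by
      intro i hi hc hA
      have := hα i hi hc
      by_contra hcon
      apply hA
      have : α i = k + 1 := by omega
      simp [Ac, this]
    have hBz : ∀ i ∈ S, c i ≠ 0 → Bc i ≠ 0 → β i ≤ k := by
      intro i hi hc hA
      have := hβ i hi hc
      by_contra hcon
      apply hA
      have : β i = k + 1 := by omega
      simp [Bc, this]
    have := ih (S ×ˢ (Finset.univ : Finset (Fin 4)))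
      (fun p => c p.1 * (![Ac p.1 * Bc p.1 * (-(ε * Complex.I)), A p.1 * Bc p.1 * (1 + ε ^ 2),
         Ac p.1 * B p.1 * (1 + ε ^ 2), A p.1 * B p.1 * (2 * ε * Complex.I + ε ^ 3 * Complex.I)] p.2))
      (fun p => ![α p.1, α p.1 - 1, α p.1, α p.1 - 1] p.2)
      (fun p => ![β p.1, β p.1, β p.1 - 1, β p.1 - 1] p.2) ?_ ?_ ?_
    · convert this using 1
      rw [Finset.sum_product]
      apply Finset.sum_congr rfl
      intro i _
      simp [Fin.sum_univ_four, ew, A, Ac, B, Bc]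
      ring
    · rintro ⟨i, m⟩ hi hc
      have hi := (Finset.mem_product.mp hi).1
      have hc1 := left_ne_zero_of_mul hc
      have hc2 := right_ne_zero_of_mul hc
      have := hα i hi hc1
      fin_cases m <;> simp at hc2 ⊢
      · exact hAz i hi hc1 hc2.1.1
      · omega
      · exact hAz i hi hc1 hc2.1.1
      · omega
    · rintro ⟨i, m⟩ hi hc
      have hi := (Finset.mem_product.mp hi).1
      have hc1 := left_ne_zero_of_mul hc
      have hc2 := right_ne_zero_of_mul hc
      have := hβ i hi hc1
      fin_cases m <;> simp at hc2 ⊢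
      · exact hBz i hi hc1 hc2.1.2
      · exact hBz i hi hc1 hc2.1.2
      · omega
      · omega
    · intro x y hx hy
      convert s3 x y hx hy using 1
      rw [Finset.sum_product]
      apply Finset.sum_congr rfl
      intro i _
      simp [Fin.sum_univ_four]

end MC

namespace MC

/-- Rotated weights. -/
noncomputable def wt (θ : ℝ) (k : ℕ) (ε : ℝ) (a b : ℕ) : ℂ :=
  Complex.exp (θ * Complex.I) ^ k * (Complex.exp (θ * Complex.I))⁻¹ ^ (a + b) * ew k ε a b

lemma wt_cont (θ : ℝ) (k a b : ℕ) : Continuous fun ε => wt θ k ε a b := by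
  have := ew_cont k a b
  unfold wt
  fun_prop

lemma wt_zero (θ : ℝ) (k a b : ℕ) (ha : a ≤ k) (hb : b ≤ k) :
    wt θ k 0 a b = if a + b = k then 1 / (k.choose a : ℂ) else 0 := by
  unfold wt
  rw [ew_zero k a b ha hb]
  split_ifs with h
  · rw [h, ← mul_pow, mul_inv_cancel₀ (Complex.exp_ne_zero _), one_pow, one_mul]
  · simp

lemma wt_ne {ι : Type} (θ : ℝ) (S : Finset ι) (c : ι → ℂ) (α β : ι → ℕ) (k : ℕ) (ε : ℝ)
    (hε : 0 < ε) (hα : ∀ i ∈ S, α i ≤ k) (hβ : ∀ i ∈ S, β i ≤ k)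
    (h : ∀ x ∈ Htheta θ, ∀ y ∈ Htheta θ, ∑ i ∈ S, c i * (x ^ α i * y ^ β i) ≠ 0) :
    ∑ i ∈ S, c i * wt θ k ε (α i) (β i) ≠ 0 := by
  have hω := Complex.exp_ne_zero (θ * Complex.I)
  unfold wt
  have hH : ∀ x : ℂ, 0 < x.im → (Complex.exp (θ * Complex.I))⁻¹ * x ∈ Htheta θ := by
    intro x hx
    simp only [Htheta, Set.mem_ofPred_eq, mul_inv_cancel_left₀ hω]
    exact hx
  have := ew_ne S (fun i => c i * (Complex.exp (θ * Complex.I))⁻¹ ^ (α i + β i)) α β k ε hε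
    (fun i hi _ => hα i hi) (fun i hi _ => hβ i hi) (by
      intro x y hx hy
      convert h _ (hH x hx) _ (hH y hy) using 1
      apply Finset.sum_congr rfl
      intro i _
      simp only [mul_pow, pow_add]
      ring)
  have h2 := mul_ne_zero (pow_ne_zero k hω) this
  convert h2 using 1
  rw [Finset.mul_sum]
  apply Finset.sum_congr rfl
  intro i _
  ring

lemma iter {n : ℕ} (κ : Fin n →₀ ℕ) (θ : ℝ) (T : Finset ((Fin n →₀ ℕ) × (Fin n →₀ ℕ)))
    (hT : ∀ p ∈ T, p.1 ≤ κ ∧ p.2 ≤ κ) (c : (Fin n →₀ ℕ) × (Fin n →₀ ℕ) → ℂ)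
    (ε : ℝ) (hε : 0 < ε)
    (h : ∀ x y : Fin n → ℂ, (∀ i, x i ∈ Htheta θ) → (∀ i, y i ∈ Htheta θ) →
      ∑ p ∈ T, c p * ∏ i, (x i ^ p.1 i * y i ^ p.2 i) ≠ 0) (J : Finset (Fin n)) :
    ∀ x y : Fin n → ℂ, (∀ i, x i ∈ Htheta θ) → (∀ i, y i ∈ Htheta θ) →
      ∑ p ∈ T, c p * ∏ i, (if i ∈ J then wt θ (κ i) ε (p.1 i) (p.2 i)
        else x i ^ p.1 i * y i ^ p.2 i) ≠ 0 := by
  classical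
  induction J using Finset.induction_on with
  | empty => simpa using h
  | insert j J hj ih =>
    intro x y hx hy
    have := wt_ne θ T (fun p => c p * ∏ i ∈ Finset.univ.erase j,
      (if i ∈ J then wt θ (κ i) ε (p.1 i) (p.2 i) else x i ^ p.1 i * y i ^ p.2 i))
      (fun p => p.1 j) (fun p => p.2 j) (κ j) ε hε (fun p hp => (hT p hp).1 j)
      (fun p hp => (hT p hp).2 j) (by
        intro a ha b hb
        have := ih (Function.update x j a) (Function.update y j b)
          (fun i => by by_cases hi : i = j
                       · subst hi; simpa using ha
                       · simpa [hi] using hx i)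
          (fun i => by by_cases hi : i = j
                       · subst hi; simpa using hb
                       · simpa [hi] using hy i)
        convert this using 1
        apply Finset.sum_congr rfl
        intro p _
        rw [← Finset.mul_prod_erase Finset.univ _ (Finset.mem_univ j)]
        simp only [hj, if_false, Function.update_self]
        rw [mul_assoc, mul_comm (Finset.prod _ _)]
        congr 2
        apply Finset.prod_congr rfl
        intro i hi
        rw [Function.update_of_ne (Finset.ne_of_mem_erase hi),
          Function.update_of_ne (Finset.ne_of_mem_erase hi)])
    convert this using 1
    apply Finset.sum_congr rfl
    intro p _
    rw [← Finset.mul_prod_erase Finset.univ _ (Finset.mem_univ j)]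
    simp only [Finset.mem_insert_self, if_true]
    rw [mul_assoc, mul_comm (Finset.prod _ _)]
    congr 2
    apply Finset.prod_congr rfl
    intro i hi
    simp [Finset.ne_of_mem_erase hi]

/-- Growth bound for zero-free polynomials. -/
lemma growth (p : Polynomial ℂ) (N : ℕ) (hN : p.natDegree ≤ N) (r : ℝ) (hr : 0 < r)
    (h : ∀ t : ℂ, ‖t‖ < r → p.eval t ≠ 0) :
    ‖p.eval 1‖ ≤ ‖p.eval 0‖ * (1 + 1 / r) ^ N := by
  have hs := IsAlgClosed.splits p
  rw [hs.eval_eq_prod_roots, hs.eval_eq_prod_roots, norm_mul, norm_mul, mul_assoc]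
  apply mul_le_mul_of_nonneg_left _ (norm_nonneg _)
  have hroot : ∀ z ∈ p.roots, r ≤ ‖z‖ := by
    intro z hz
    by_contra hc
    exact h z (not_le.mp hc) (Polynomial.isRoot_of_mem_roots hz)
  have hcard : p.roots.card ≤ N := (Polynomial.card_roots' p).trans hN
  have h1 : 1 ≤ 1 + 1 / r := by have : 0 < 1 / r := by positivity
                                linarith
  have main : ∀ m : Multiset ℂ, (∀ z ∈ m, r ≤ ‖z‖) →
      ‖(m.map (fun a => 1 - a)).prod‖ ≤ ‖(m.map (fun a => 0 - a)).prod‖ * (1 + 1 / r) ^ m.card := by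
    intro m
    induction m using Multiset.induction_on with
    | empty => simp
    | cons a m ih =>
      intro hm
      have ha := hm a (by simp)
      have := ih (fun z hz => hm z (by simp [hz]))
      simp only [Multiset.map_cons, Multiset.prod_cons, norm_mul, Multiset.card_cons, pow_succ]
      have h2 : ‖1 - a‖ ≤ ‖0 - a‖ * (1 + 1 / r) := by
        have e : ‖1 - a‖ ≤ 1 + ‖a‖ := by simpa using norm_sub_le 1 a
        have e2 : 1 ≤ ‖a‖ * (1 / r) := by
          rw [mul_one_div, le_div_iff₀ hr]; linarith
        simp only [zero_sub, norm_neg]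
        linarith
      calc _ ≤ (‖0 - a‖ * (1 + 1 / r)) * (‖(m.map (fun a => 0 - a)).prod‖ * (1 + 1 / r) ^ m.card) := by
            gcongr
        _ = _ := by ring
  refine (main _ hroot).trans ?_
  gcongr

lemma hurwitz {σ ι : Type} [Finite σ] (θ : ℝ) (T : Finset ι) (R : ι → MvPolynomial σ ℂ)
    (w : ℝ → ι → ℂ) (hw : ∀ i, Continuous fun ε => w ε i)
    (hne : ∀ ε : ℝ, 0 < ε → ∀ v : σ → ℂ, (∀ s, v s ∈ Htheta θ) →
      ∑ i ∈ T, w ε i * eval v (R i) ≠ 0) :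
    (∑ i ∈ T, C (w 0 i) * R i) = 0 ∨ ∀ v : σ → ℂ, (∀ s, v s ∈ Htheta θ) →
      eval v (∑ i ∈ T, C (w 0 i) * R i) ≠ 0 := by
  classical
  have := Fintype.ofFinite σ
  rw [or_iff_not_imp_left]
  intro hS v0 hv0 hz
  apply hS
  have hopen : IsOpen (Htheta θ) := by
    apply isOpen_lt continuous_const
    fun_prop
  have hinf : (Htheta θ).Infinite := by
    have hne' : (Htheta θ).Nonempty := by
      refine ⟨(Complex.exp (θ * Complex.I))⁻¹ * Complex.I, ?_⟩
      simp only [Htheta, Set.mem_ofPred_eq, mul_inv_cancel_left₀ (Complex.exp_ne_zero _)]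
      simp
    obtain ⟨a, ha⟩ := hne'
    exact infinite_of_mem_nhds a (hopen.mem_nhds ha)
  apply MvPolynomial.funext_set (fun _ => Htheta θ) (fun _ => hinf)
  intro v1 hv1
  rw [map_zero]
  -- the line
  let ℓ : σ → Polynomial ℂ := fun s => Polynomial.C (v0 s) + Polynomial.X * Polynomial.C (v1 s - v0 s)
  have hev : ∀ (t : ℂ) (q : MvPolynomial σ ℂ),
      (aeval ℓ q).eval t = eval (fun s => v0 s + t * (v1 s - v0 s)) q := by
    intro t q
    induction q using MvPolynomial.induction_on with
    | C a => simp
    | add p q hp hq => simp [hp, hq]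
    | mul_X p s hp => rw [map_mul, map_mul, Polynomial.eval_mul, hp, aeval_X, eval_X]; simp [ℓ]
  obtain ⟨r, hr, hball⟩ : ∃ r > 0, ∀ t : ℂ, ‖t‖ < r → ∀ s, v0 s + t * (v1 s - v0 s) ∈ Htheta θ := by
    have : ∀ᶠ t : ℂ in nhds 0, ∀ s, v0 s + t * (v1 s - v0 s) ∈ Htheta θ := by
      rw [Filter.eventually_all]
      intro s
      have hc : Continuous fun t : ℂ => v0 s + t * (v1 s - v0 s) := by fun_prop
      apply hc.continuousAt.eventually_mem
      apply hopen.mem_nhds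
      simpa using hv0 s
    obtain ⟨r, hr, hb⟩ := Metric.eventually_nhds_iff.mp this
    exact ⟨r, hr, fun t ht => hb (by simpa using ht)⟩
  let pε : ℝ → Polynomial ℂ := fun ε => ∑ i ∈ T, Polynomial.C (w ε i) * aeval ℓ (R i)
  let N := T.sup fun i => (aeval ℓ (R i)).natDegree
  have hpe : ∀ ε t, (pε ε).eval t = ∑ i ∈ T, w ε i * eval (fun s => v0 s + t * (v1 s - v0 s)) (R i) := by
    intro ε t
    simp [pε, Polynomial.eval_finsetSum, hev]
  have hdeg : ∀ ε, (pε ε).natDegree ≤ N := by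
    intro ε
    apply Polynomial.natDegree_sum_le_of_forall_le
    intro i hi
    exact (Polynomial.natDegree_C_mul_le _ _).trans (Finset.le_sup (f := fun i => (aeval ℓ (R i)).natDegree) hi)
  have hcont : ∀ t, Continuous fun ε => (pε ε).eval t := by
    intro t
    simp only [hpe]
    fun_prop
  have hb : ∀ ε > 0, ‖(pε ε).eval 1‖ ≤ ‖(pε ε).eval 0‖ * (1 + 1 / r) ^ N := by
    intro ε hε
    apply growth _ N (hdeg ε) r hr
    intro t ht
    rw [hpe]
    exact hne ε hε _ (hball t ht)
  have hlim : ‖(pε 0).eval 1‖ ≤ ‖(pε 0).eval 0‖ * (1 + 1 / r) ^ N := by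
    have t1 : Filter.Tendsto (fun ε => ‖(pε ε).eval 1‖) (nhdsWithin 0 (Set.Ioi 0)) (nhds ‖(pε 0).eval 1‖) :=
      ((hcont 1).norm.tendsto 0).mono_left nhdsWithin_le_nhds
    have t2 : Filter.Tendsto (fun ε => ‖(pε ε).eval 0‖ * (1 + 1 / r) ^ N) (nhdsWithin 0 (Set.Ioi 0))
        (nhds (‖(pε 0).eval 0‖ * (1 + 1 / r) ^ N)) :=
      (((hcont 0).norm.mul continuous_const).tendsto 0).mono_left nhdsWithin_le_nhds
    exact le_of_tendsto_of_tendsto t1 t2 (by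
      filter_upwards [self_mem_nhdsWithin] with ε hε using hb ε hε)
  have z0 : (pε 0).eval 0 = 0 := by
    rw [hpe]
    simpa using hz
  rw [z0, norm_zero, zero_mul] at hlim
  have z1 := norm_le_zero_iff.mp hlim
  rw [hpe] at z1
  simpa using z1

end MC

/-- **Master composition theorem for half-planes.** Let
`f(z,w) = ∑_{α≤κ} binom(κ,α) P_α(w) z^α` and `g(z,w) = ∑_{α≤κ} binom(κ,α) Q_α(z) w^α`
be `ℍ_θ`-stable polynomials in the `2n` variables `(z,w)`. Then
`∑_{α≤κ} binom(κ,α) P_α(w) Q_{κ−α}(z)` is `ℍ_θ`-stable or identically zero.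
(Variables indexed by `Sum.inl` are the `z`-variables; by `Sum.inr` the `w`-variables.) -/
theorem master_composition_halfplane (n : ℕ) (κ : Fin n →₀ ℕ)
    (θ : ℝ) (hθ : θ ∈ Set.Ico 0 (2 * Real.pi))
    (P : (Fin n →₀ ℕ) → MvPolynomial (Fin n) ℂ)
    (Q : (Fin n →₀ ℕ) → MvPolynomial (Fin n) ℂ)
    (f g : MvPolynomial (Fin n ⊕ Fin n) ℂ)
    (hf : f = ∑ α ∈ Finset.Iic κ,
      C (binomC κ α) * rename Sum.inr (P α) * ∏ i, X (Sum.inl i) ^ (α i))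
    (hg : g = ∑ α ∈ Finset.Iic κ,
      C (binomC κ α) * rename Sum.inl (Q α) * ∏ i, X (Sum.inr i) ^ (α i))
    (hfs : ∀ v : Fin n ⊕ Fin n → ℂ, (∀ s, v s ∈ Htheta θ) → eval v f ≠ 0)
    (hgs : ∀ v : Fin n ⊕ Fin n → ℂ, (∀ s, v s ∈ Htheta θ) → eval v g ≠ 0) :
    (∑ α ∈ Finset.Iic κ,
        C (binomC κ α) * rename Sum.inr (P α) * rename Sum.inl (Q (κ - α))) = 0 ∨
      ∀ v : Fin n ⊕ Fin n → ℂ, (∀ s, v s ∈ Htheta θ) →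
        eval v (∑ α ∈ Finset.Iic κ,
          C (binomC κ α) * rename Sum.inr (P α) * rename Sum.inl (Q (κ - α))) ≠ 0 := by
  classical
  let T := Finset.Iic κ ×ˢ Finset.Iic κ
  let w : ℝ → (Fin n →₀ ℕ) × (Fin n →₀ ℕ) → ℂ := fun ε p => ∏ i, MC.wt θ (κ i) ε (p.1 i) (p.2 i)
  let R : (Fin n →₀ ℕ) × (Fin n →₀ ℕ) → MvPolynomial (Fin n ⊕ Fin n) ℂ := fun p =>
    C (binomC κ p.1) * rename Sum.inr (P p.1) * (C (binomC κ p.2) * rename Sum.inl (Q p.2))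
  have hT : ∀ p ∈ T, p.1 ≤ κ ∧ p.2 ≤ κ := by
    intro p hp
    simpa [T] using hp
  have key := MC.hurwitz θ T R w
    (fun p => continuous_finsetProd _ (fun i _ => MC.wt_cont θ (κ i) (p.1 i) (p.2 i))) (by
      intro ε hε v hv
      have h0 : ∀ x y : Fin n → ℂ, (∀ i, x i ∈ Htheta θ) → (∀ i, y i ∈ Htheta θ) →
          ∑ p ∈ T, eval v (R p) * ∏ i, (x i ^ p.1 i * y i ^ p.2 i) ≠ 0 := by
        intro x y hx hy
        have e1 := hfs (Sum.elim x (fun i => v (Sum.inr i))) (by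
          rintro (s | s)
          · exact hx s
          · exact hv _)
        have e2 := hgs (Sum.elim (fun i => v (Sum.inl i)) y) (by
          rintro (s | s)
          · exact hv _
          · exact hy s)
        have e3 := mul_ne_zero e1 e2
        rw [hf, hg, map_sum, map_sum, Finset.sum_mul_sum, ← Finset.sum_product'] at e3
        convert e3 using 1
        apply Finset.sum_congr rfl
        intro p _
        simp only [R, map_mul, map_prod, map_pow, eval_C, eval_X, eval_rename, Sum.elim_inl,
          Sum.elim_inr, Finset.prod_mul_distrib, Function.comp_def]
        ring
      have := MC.iter κ θ T hT (fun p => eval v (R p)) ε hε h0 Finset.univ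
        (fun i => v (Sum.inl i)) (fun i => v (Sum.inr i)) (fun i => hv _) (fun i => hv _)
      convert this using 1
      apply Finset.sum_congr rfl
      intro p _
      simp [w, mul_comm])
  have heq : (∑ p ∈ T, C (w 0 p) * R p) = ∑ α ∈ Finset.Iic κ,
        C (binomC κ α) * rename Sum.inr (P α) * rename Sum.inl (Q (κ - α)) := by
    simp only [T]
    rw [Finset.sum_product]
    apply Finset.sum_congr rfl
    intro α hα
    have hα' : α ≤ κ := Finset.mem_Iic.mp hα
    rw [Finset.sum_eq_single (κ - α)]
    · have hb : w 0 (α, κ - α) * binomC κ (κ - α) = 1 := by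
        simp only [w, binomC]
        push_cast
        rw [← Finset.prod_mul_distrib]
        apply Finset.prod_eq_one
        intro i _
        have hi := hα' i
        rw [MC.wt_zero θ _ _ _ hi (by simp), Pi.sub_apply,
          if_pos (by omega), Nat.choose_symm hi]
        have : (((κ i).choose (α i) : ℕ) : ℂ) ≠ 0 := by
          exact_mod_cast (Nat.choose_pos hi).ne'
        field_simp
      have hb' : C (w 0 (α, κ - α)) * C (binomC κ (κ - α)) = (1 : MvPolynomial (Fin n ⊕ Fin n) ℂ) := by
        rw [← C_mul, hb, C_1]
      simp only [R]
      linear_combination (C (binomC κ α) * rename Sum.inr (P α) * rename Sum.inl (Q (κ - α))) * hb'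
    · intro β hβ hne
      have hβ' : β ≤ κ := Finset.mem_Iic.mp hβ
      have : w 0 (α, β) = 0 := by
        obtain ⟨i, hi⟩ : ∃ i, α i + β i ≠ κ i := by
          by_contra hc
          push Not at hc
          apply hne
          ext i
          have := hc i
          rw [Finsupp.tsub_apply]
          omega
        apply Finset.prod_eq_zero (Finset.mem_univ i)
        rw [MC.wt_zero θ _ _ _ (hα' i) (hβ' i), if_neg hi]
      rw [this]; simp
    · intro hc
      exact absurd (Finset.mem_Iic.mpr tsub_le_self) hc
  rw [heq] at key
  exact key
end
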